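/- arXiv:2502.03105 — 3 statements merged into one kernel-verified Lean document; each statement's English description precedes it below -/
import Mathlib

section
/- For all integers s ≥ 1, k ≥ 1 and n ≥ max(2^8 · s^{3/2} · (log₂(sk))^{3/2}, 8s²), the sequence f_i = i·n^{k-1} (i = 1, …, s) is satisfying: whenever families F_1, …, F_s ⊆ [n]^k satisfy |F_i| > i·n^{k-1} for every i ∈ [s], the families contain a rainbow matching. -/
/-- The vertices of colour `a`. -/
def colorClass {V C : Type*} [Fintype V] [DecidableEq C] (c : V → C) (a : C) : Finset V :=
  Finset.univ.filter fun v => c v = a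

theorem mem_colorClass {V C : Type*} [Fintype V] [DecidableEq C] {c : V → C} {a : C} {v : V} :
    v ∈ colorClass c a ↔ c v = a := by
  simp [colorClass]

section SpreadLemma

variable {V ι C : Type*} [DecidableEq V] [Fintype ι] [DecidableEq C]

/-- Among the members of the family `S` inside `W ∪ S x` that are no larger than `S x`, one has the
smallest part outside `W`. -/
theorem exists_min_fragment (S : ι → Finset V) (W : Finset V) (x : ι) :
    ∃ y, S y ⊆ W ∪ S x ∧ (S y).card ≤ (S x).card ∧
      ∀ z, S z ⊆ W ∪ S x → (S z).card ≤ (S x).card → (S y \ W).card ≤ (S z \ W).card := by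
  classical
  obtain ⟨y, hy, hmin⟩ := Finset.exists_min_image
    (Finset.univ.filter fun y => S y ⊆ W ∪ S x ∧ (S y).card ≤ (S x).card)
    (fun y => (S y \ W).card) ⟨x, by simp⟩
  simp only [Finset.mem_filter, Finset.mem_univ, true_and] at hy hmin
  exact ⟨y, hy.1, hy.2, fun z h1 h2 => hmin z ⟨h1, h2⟩⟩

/-- The part outside `W` of a member of `S` chosen as in `exists_min_fragment`. -/
noncomputable def fragment (S : ι → Finset V) (W : Finset V) (x : ι) : Finset V :=
  S (exists_min_fragment S W x).choose \ W

theorem fragment_subset (S : ι → Finset V) (W : Finset V) (x : ι) : fragment S W x ⊆ S x := by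
  have h := (exists_min_fragment S W x).choose_spec.1
  intro v hv
  rw [fragment, Finset.mem_sdiff] at hv
  exact (Finset.mem_union.1 (h hv.1)).resolve_left hv.2

/-- Every set `Z` is assigned a set `H Z` that contains all the fragments `T` with `W ∪ T = Z`
and is no larger than the sets these fragments come from. -/
theorem exists_fragment_container (S : ι → Finset V) :
    ∃ H : Finset V → Finset V, ∀ W x,
      fragment S W x ⊆ H (W ∪ fragment S W x) ∧
        (H (W ∪ fragment S W x)).card ≤ (S x).card := by
  classical
  have key : ∀ Z : Finset V, ∃ H : Finset V, (∃ z, S z ⊆ Z) →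
      (∃ z, H = S z) ∧ H ⊆ Z ∧ ∀ z, S z ⊆ Z → H.card ≤ (S z).card := by
    intro Z
    by_cases h : ∃ z, S z ⊆ Z
    · obtain ⟨z, hz⟩ := h
      obtain ⟨y, hy, hmin⟩ := Finset.exists_min_image
        (Finset.univ.filter fun y => S y ⊆ Z) (fun y => (S y).card) ⟨z, by simp [hz]⟩
      simp only [Finset.mem_filter, Finset.mem_univ, true_and] at hy hmin
      exact ⟨S y, fun _ => ⟨⟨y, rfl⟩, hy, hmin⟩⟩
    · exact ⟨∅, fun h' => absurd h' h⟩
  choose H hH using key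
  refine ⟨H, fun W x => ?_⟩
  obtain ⟨h1, h2, h3⟩ := (exists_min_fragment S W x).choose_spec
  set y := (exists_min_fragment S W x).choose with hy
  have hT : fragment S W x = S y \ W := rfl
  have hyZ : S y ⊆ W ∪ fragment S W x := by
    rw [hT]; intro v hv; by_cases hvW : v ∈ W <;> simp [hv, hvW]
  obtain ⟨⟨z, hz⟩, hHZ, hmin⟩ := hH (W ∪ fragment S W x) ⟨y, hyZ⟩
  have hcard : (H (W ∪ fragment S W x)).card ≤ (S x).card := (hmin y hyZ).trans h2
  refine ⟨?_, hcard⟩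
  have hsub : S z \ W ⊆ fragment S W x := by
    rw [← hz]
    intro v hv
    rw [Finset.mem_sdiff] at hv
    exact (Finset.mem_union.1 (hHZ hv.1)).resolve_left hv.2
  have hle : (fragment S W x).card ≤ (S z \ W).card := by
    rw [hT]
    refine h3 z ?_ (hz ▸ hcard)
    rw [← hz]
    exact hHZ.trans (Finset.union_subset_union_right (fragment_subset S W x))
  rw [hz, ← Finset.eq_of_subset_of_card_le hsub hle]
  exact Finset.sdiff_subset

variable [Fintype V]

/-- The colouring `c` with all the vertices of `T` recoloured to `a`. -/
def recolor (T : Finset V) (a : C) (c : V → C) : V → C := fun v => if v ∈ T then a else c v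

theorem colorClass_recolor (T : Finset V) (a : C) (c : V → C) :
    colorClass (recolor T a c) a = colorClass c a ∪ T := by
  ext v
  by_cases hv : v ∈ T <;> simp [mem_colorClass, recolor, hv]

theorem sum_recolor_le [Fintype C] (T : Finset V) (a : C) (h : (V → C) → ℝ) (h0 : ∀ c, 0 ≤ h c) :
    ∑ c, h (recolor T a c) ≤ (Fintype.card C : ℝ) ^ T.card * ∑ c, h c := by
  classical
  have hfib : ∀ d : V → C, (Finset.univ.filter fun c => recolor T a c = d).card
      ≤ Fintype.card C ^ T.card := by
    intro d
    have : (Finset.univ.filter fun c => recolor T a c = d).card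
        ≤ (Finset.univ : Finset (T → C)).card := by
      refine Finset.card_le_card_of_injOn (fun c v => c v) (by simp) ?_
      intro c hc c' hc' hcc
      simp only [Finset.coe_filter, Finset.mem_univ, true_and, Set.mem_ofPred_eq] at hc hc'
      funext v
      by_cases hv : v ∈ T
      · exact congrFun hcc ⟨v, hv⟩
      · have := congrFun (hc.trans hc'.symm) v
        simpa [recolor, hv] using this
    simpa using this
  rw [← Finset.sum_fiberwise (Finset.univ) (recolor T a) (fun c => h (recolor T a c)),
    Finset.mul_sum]
  refine Finset.sum_le_sum fun d _ => ?_
  have : ∑ c ∈ Finset.univ.filter (fun c => recolor T a c = d), h (recolor T a c)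
      = (Finset.univ.filter fun c => recolor T a c = d).card * h d := by
    rw [← nsmul_eq_mul]
    refine Finset.sum_eq_card_nsmul fun c hc => ?_
    rw [(Finset.mem_filter.1 hc).2]
  rw [this]
  exact mul_le_mul_of_nonneg_right (by exact_mod_cast hfib d) (h0 d)

theorem one_add_two_mul_sub_le (a b : ℕ) :
    1 + 2 * (a : ℝ) - b ≤ 4 ^ a * (1 / 2) ^ b := by
  have h4 : (4 : ℝ) ^ a = 2 ^ (2 * a) := by rw [pow_mul]; norm_num
  rcases le_total b (2 * a) with h | h
  · obtain ⟨d, hd⟩ := Nat.exists_eq_add_of_le h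
    have h2 : (1 : ℝ) + d ≤ 2 ^ d := by
      exact_mod_cast (by have := @Nat.lt_two_pow_self d; omega : 1 + d ≤ 2 ^ d)
    have h3 : (2 : ℝ) * a = b + d := by exact_mod_cast hd
    have h5 : (4 : ℝ) ^ a * (1 / 2) ^ b = 2 ^ d := by
      rw [h4, hd, pow_add, one_div, inv_pow]; field_simp
    rw [h5]; linarith
  · rcases h.eq_or_lt with h | h
    · rw [h4, h, ← h, ← mul_pow]; push_cast; norm_num
    · have : (2 * (a : ℝ)) + 1 ≤ b := by exact_mod_cast h
      have : (0 : ℝ) ≤ 4 ^ a * (1 / 2) ^ b := by positivity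
      linarith

theorem sum_card_fragment_le [Fintype C] [Nonempty ι] {r : ℕ} (hr : 4 * Fintype.card C ≤ r)
    (S : (V → C) → ι → Finset V) (a : C)
    (hinv : ∀ c x T, T ⊆ S c x → S (recolor T a c) = S c)
    (hspread : ∀ c (T : Finset V),
      r ^ T.card * (Finset.univ.filter fun x => T ⊆ S c x).card ≤ Fintype.card ι) :
    2 * ∑ c, ∑ x, (fragment (S c) (colorClass c a) x).card ≤ ∑ c, ∑ x, (S c x).card := by
  classical
  choose H hH using fun c : V → C => exists_fragment_container (S c)
  set frag := fun c x => fragment (S c) (colorClass c a) x with hfrag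
  set A : (V → C) → Finset V := fun c => H c (colorClass c a) with hA
  have hq : 0 < Fintype.card C := Fintype.card_pos_iff.2 ⟨a⟩
  have hr0 : (0 : ℝ) < r := by exact_mod_cast (by omega : 0 < r)
  have hrecolor : ∀ c x, frag c x ⊆ A (recolor (frag c x) a c) ∧
      (A (recolor (frag c x) a c)).card ≤ (S c x).card := by
    intro c x
    have hS : S (recolor (frag c x) a c) = S c := hinv c x _ (fragment_subset _ _ _)
    have := hH (recolor (frag c x) a c) (colorClass c a) x
    rw [hS] at this
    simpa only [hA, colorClass_recolor] using this
  have hmain : ∑ c, ∑ x, (4 : ℝ) ^ (frag c x).card *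
      (1 / 2) ^ (A (recolor (frag c x) a c)).card ≤ ∑ _c : V → C, (Fintype.card ι : ℝ) := by
    set h : Finset V → (V → C) → ℝ := fun T c =>
      if T ⊆ A c then (4 : ℝ) ^ T.card * (1 / 2) ^ (A c).card *
        (Fintype.card ι / r ^ T.card) else 0 with hh
    have h0 : ∀ T c, 0 ≤ h T c := by
      intro T c; simp only [hh]; split_ifs <;> positivity
    have step1 : ∀ c, ∑ x, (4 : ℝ) ^ (frag c x).card *
        (1 / 2) ^ (A (recolor (frag c x) a c)).card ≤ ∑ T, h T (recolor T a c) := by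
      intro c
      rw [← Finset.sum_fiberwise Finset.univ (frag c)]
      refine Finset.sum_le_sum fun T _ => ?_
      rcases (Finset.univ.filter fun x => frag c x = T).eq_empty_or_nonempty with he | ⟨x, hx⟩
      · rw [he]; simpa using h0 _ _
      have hxT := (Finset.mem_filter.1 hx).2
      have hTA : T ⊆ A (recolor T a c) := by rw [← hxT]; exact (hrecolor c x).1
      rw [Finset.sum_congr rfl (g := fun _ => (4 : ℝ) ^ T.card *
        (1 / 2) ^ (A (recolor T a c)).card)
        (fun y hy => by rw [(Finset.mem_filter.1 hy).2])]
      simp only [hh, if_pos hTA, Finset.sum_const, nsmul_eq_mul]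
      rw [mul_comm]
      refine mul_le_mul_of_nonneg_left ?_ (by positivity)
      rw [le_div_iff₀ (by positivity), mul_comm]
      have hsub : (Finset.univ.filter fun x => frag c x = T).card
          ≤ (Finset.univ.filter fun x => T ⊆ S c x).card := by
        refine Finset.card_le_card fun y hy => ?_
        simp only [Finset.mem_filter, Finset.mem_univ, true_and] at hy ⊢
        rw [← hy]; exact fragment_subset _ _ _
      exact_mod_cast (Nat.mul_le_mul_left _ hsub).trans (hspread c T)
    calc _ ≤ ∑ c, ∑ T, h T (recolor T a c) := Finset.sum_le_sum fun c _ => step1 c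
      _ = ∑ T, ∑ c, h T (recolor T a c) := Finset.sum_comm
      _ ≤ ∑ T, (Fintype.card C : ℝ) ^ T.card * ∑ c, h T c :=
        Finset.sum_le_sum fun T _ => sum_recolor_le T a (h T) (h0 T)
      _ = ∑ c, ∑ T, (Fintype.card C : ℝ) ^ T.card * h T c := by
        simp_rw [Finset.mul_sum]; exact Finset.sum_comm
      _ ≤ ∑ _c : V → C, (Fintype.card ι : ℝ) := by
        refine Finset.sum_le_sum fun c _ => ?_
        have hterm : ∀ T : Finset V, (Fintype.card C : ℝ) ^ T.card * h T c ≤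
            if T ⊆ A c then (Fintype.card ι : ℝ) * (1 / 2) ^ (A c).card else 0 := by
          intro T
          simp only [hh]
          split_ifs
          · have : (Fintype.card C : ℝ) ^ T.card * 4 ^ T.card / r ^ T.card ≤ 1 := by
              rw [← mul_pow, div_le_one (by positivity)]
              refine pow_le_pow_left₀ (by positivity) ?_ _
              exact_mod_cast (by omega : Fintype.card C * 4 ≤ r)
            calc _ = ((Fintype.card C : ℝ) ^ T.card * 4 ^ T.card / r ^ T.card) *
                    ((Fintype.card ι : ℝ) * (1 / 2) ^ (A c).card) := by ring
              _ ≤ _ := mul_le_of_le_one_left (by positivity) this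
          · simp
        refine (Finset.sum_le_sum fun T _ => hterm T).trans ?_
        rw [← Finset.sum_filter, Finset.sum_const, nsmul_eq_mul]
        have : (Finset.univ.filter fun T => T ⊆ A c) = (A c).powerset := by ext; simp
        rw [this, Finset.card_powerset]
        push_cast
        rw [mul_left_comm, ← mul_pow]
        norm_num
  have hlin : ∑ c, ∑ x, (1 + 2 * ((frag c x).card : ℝ) - (S c x).card) ≤
      ∑ _c : V → C, (Fintype.card ι : ℝ) := by
    refine le_trans (Finset.sum_le_sum fun c _ => Finset.sum_le_sum fun x _ => ?_) hmain
    refine le_trans ?_ (one_add_two_mul_sub_le _ _)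
    have : ((A (recolor (frag c x) a c)).card : ℝ) ≤ (S c x).card := by
      exact_mod_cast (hrecolor c x).2
    linarith
  have hexp : ∑ c, ∑ x, (1 + 2 * ((frag c x).card : ℝ) - (S c x).card) =
      ∑ _c : V → C, (Fintype.card ι : ℝ) + 2 * ∑ c, ∑ x, ((frag c x).card : ℝ)
        - ∑ c, ∑ x, ((S c x).card : ℝ) := by
    simp only [Finset.sum_sub_distrib, Finset.sum_add_distrib, ← Finset.mul_sum]
    simp
  rw [hexp] at hlin
  have : 2 * ∑ c, ∑ x, ((frag c x).card : ℝ) ≤ ∑ c, ∑ x, ((S c x).card : ℝ) := by linarith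
  exact_mod_cast this

/-- The fragments left of the family `A` after the colour classes `a 0, …, a (l - 1)`. -/
noncomputable def iterFragment (A : ι → Finset V) (a : ℕ → C) (c : V → C) : ℕ → ι → Finset V
  | 0 => A
  | l + 1 => fragment (iterFragment A a c l) (colorClass c (a l))

theorem iterFragment_subset (A : ι → Finset V) (a : ℕ → C) (c : V → C) (l : ℕ) (x : ι) :
    iterFragment A a c l x ⊆ A x := by
  induction l with
  | zero => exact subset_rfl
  | succ l ih => exact (fragment_subset _ _ _).trans ih

theorem exists_iterFragment_eq (A : ι → Finset V) (a : ℕ → C) (c : V → C) (l : ℕ) (x : ι) :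
    ∃ y, ∀ v, v ∈ iterFragment A a c l x ↔ v ∈ A y ∧ ∀ m < l, c v ≠ a m := by
  induction l generalizing x with
  | zero => exact ⟨x, by simp [iterFragment]⟩
  | succ l ih =>
    obtain ⟨y, hy⟩ := ih (exists_min_fragment (iterFragment A a c l) (colorClass c (a l)) x).choose
    refine ⟨y, fun v => ?_⟩
    rw [iterFragment, fragment, Finset.mem_sdiff, hy]
    simp only [colorClass, Finset.mem_filter, Finset.mem_univ, true_and, Nat.lt_succ_iff_lt_or_eq,
      or_imp, forall_and, forall_eq, and_assoc, ne_eq]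

theorem iterFragment_recolor (A : ι → Finset V) (a : ℕ → C) (c : V → C) {l : ℕ} {b : C}
    (hb : ∀ m < l, a m ≠ b) {T : Finset V} (hT : ∀ v ∈ T, ∀ m < l, c v ≠ a m) :
    iterFragment A a (recolor T b c) l = iterFragment A a c l := by
  induction l with
  | zero => rfl
  | succ l ih =>
    have hcl : colorClass (recolor T b c) (a l) = colorClass c (a l) := by
      ext v
      by_cases hv : v ∈ T
      · simp [mem_colorClass, recolor, hv, hT v hv l (Nat.lt_succ_self l),
          (hb l (Nat.lt_succ_self l)).symm]
      · simp [mem_colorClass, recolor, hv]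
    rw [iterFragment, iterFragment, hcl,
      ih (fun m hm => hb m (hm.trans (Nat.lt_succ_self l)))
        (fun v hv m hm => hT v hv m (hm.trans (Nat.lt_succ_self l)))]

/-- **Spread lemma**: for few colourings does a spread family have no member covered by the
colours `a 0, …, a (β - 1)`. -/
theorem card_uncovered_colorings_le [Fintype C] [Nonempty ι] {r k β : ℕ} (hr : 4 * Fintype.card C ≤ r)
    (A : ι → Finset V) (hA : ∀ x, (A x).card ≤ k)
    (hspread : ∀ T : Finset V,
      r ^ T.card * (Finset.univ.filter fun x => T ⊆ A x).card ≤ Fintype.card ι)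
    (a : ℕ → C) (ha : ∀ l < β, ∀ m < l, a m ≠ a l)
    (bad : Finset (V → C)) (hbad : ∀ c ∈ bad, ∀ x, ∃ v ∈ A x, ∀ m < β, c v ≠ a m) :
    bad.card * 2 ^ β ≤ k * Fintype.card (V → C) := by
  classical
  have hiter : ∀ l ≤ β, 2 ^ l * ∑ c, ∑ x, (iterFragment A a c l x).card ≤
      ∑ _c : V → C, ∑ x, (A x).card := by
    intro l
    induction l with
    | zero => simp [iterFragment]
    | succ l ih =>
      intro hl
      refine le_trans ?_ (ih (by omega))
      rw [pow_succ, mul_assoc]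
      refine Nat.mul_le_mul_left _ ?_
      refine sum_card_fragment_le hr (fun c => iterFragment A a c l) (a l) ?_ ?_
      · intro c x T hT
        refine iterFragment_recolor A a c (ha l (by omega)) fun v hv m hm => ?_
        obtain ⟨y, hy⟩ := exists_iterFragment_eq A a c l x
        exact ((hy v).1 (hT hv)).2 m hm
      · intro c T
        refine le_trans (Nat.mul_le_mul_left _ (Finset.card_le_card ?_)) (hspread T)
        intro x hx
        simp only [Finset.mem_filter, Finset.mem_univ, true_and] at hx ⊢
        exact hx.trans (iterFragment_subset A a c l x)
  have hupper : ∑ _c : V → C, ∑ x, (A x).card ≤ Fintype.card (V → C) * (Fintype.card ι * k) := by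
    rw [Finset.sum_const, smul_eq_mul, Finset.card_univ]
    refine Nat.mul_le_mul_left _ ?_
    rw [← Finset.card_univ, ← smul_eq_mul]
    exact Finset.sum_le_card_nsmul _ _ _ fun x _ => hA x
  have hlower : bad.card * Fintype.card ι ≤ ∑ c, ∑ x, (iterFragment A a c β x).card := by
    refine le_trans ?_ (Finset.sum_le_sum_of_subset (Finset.subset_univ bad))
    rw [← smul_eq_mul]
    refine Finset.card_nsmul_le_sum _ _ _ fun c hc => ?_
    rw [← Finset.card_univ, Finset.card_eq_sum_ones]
    refine Finset.sum_le_sum fun x _ => ?_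
    obtain ⟨y, hy⟩ := exists_iterFragment_eq A a c β x
    obtain ⟨v, hv, hvc⟩ := hbad c hc y
    exact Finset.card_pos.2 ⟨v, (hy v).2 ⟨hv, hvc⟩⟩
  have hι : 0 < Fintype.card ι := Fintype.card_pos
  refine Nat.le_of_mul_le_mul_right ?_ hι
  calc bad.card * 2 ^ β * Fintype.card ι = 2 ^ β * (bad.card * Fintype.card ι) := by ring
    _ ≤ 2 ^ β * ∑ c, ∑ x, (iterFragment A a c β x).card := Nat.mul_le_mul_left _ hlower
    _ ≤ _ := hiter β le_rfl
    _ ≤ _ := hupper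
    _ = _ := by ring

end SpreadLemma

section Tuples

variable {n k : ℕ}

/-- The graph of a tuple, as a set of pairs (coordinate, value). -/
def cells (x : Fin k → Fin n) : Finset (Fin k × Fin n) := Finset.univ.image fun j => (j, x j)

theorem mem_cells {x : Fin k → Fin n} {v : Fin k × Fin n} : v ∈ cells x ↔ x v.1 = v.2 := by
  simp only [cells, Finset.mem_image, Finset.mem_univ, true_and]
  constructor
  · rintro ⟨j, rfl⟩; rfl
  · intro h; exact ⟨v.1, by rw [h]⟩

theorem card_cells_le (x : Fin k → Fin n) : (cells x).card ≤ k :=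
  Finset.card_image_le.trans (by simp)

/-- The members of `G` whose graph contains `X`. -/
def link (G : Finset (Fin k → Fin n)) (X : Finset (Fin k × Fin n)) : Finset (Fin k → Fin n) :=
  G.filter fun x => X ⊆ cells x

/-- The members of `G` whose graph is disjoint from `U`. -/
def avoid (G : Finset (Fin k → Fin n)) (U : Finset (Fin k × Fin n)) : Finset (Fin k → Fin n) :=
  G.filter fun x => Disjoint (cells x) U

theorem mem_link {G : Finset (Fin k → Fin n)} {X : Finset (Fin k × Fin n)} {x : Fin k → Fin n} :
    x ∈ link G X ↔ x ∈ G ∧ X ⊆ cells x := by simp [link]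

theorem mem_avoid {G : Finset (Fin k → Fin n)} {U : Finset (Fin k × Fin n)} {x : Fin k → Fin n} :
    x ∈ avoid G U ↔ x ∈ G ∧ Disjoint (cells x) U := by simp [avoid]

theorem link_subset (G : Finset (Fin k → Fin n)) (X : Finset (Fin k × Fin n)) : link G X ⊆ G :=
  Finset.filter_subset _ _

theorem avoid_subset (G : Finset (Fin k → Fin n)) (U : Finset (Fin k × Fin n)) : avoid G U ⊆ G :=
  Finset.filter_subset _ _

theorem link_link (G : Finset (Fin k → Fin n)) (X T : Finset (Fin k × Fin n)) :
    link (link G X) T = link G (X ∪ T) := by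
  ext x
  simp only [mem_link, Finset.union_subset_iff, and_assoc]

theorem card_link_mul_le (G : Finset (Fin k → Fin n)) (X : Finset (Fin k × Fin n)) :
    (link G X).card * n ^ X.card ≤ n ^ k := by
  have : (link G X ×ˢ (Finset.univ : Finset (X → Fin n))).card
      ≤ (Finset.univ : Finset (Fin k → Fin n)).card := by
    refine Finset.card_le_card_of_injOn
      (fun p j => if h : (j, p.1 j) ∈ X then p.2 ⟨_, h⟩ else p.1 j) (by simp) ?_
    rintro ⟨x, f⟩ hx ⟨y, g⟩ hy hxy
    simp only [Finset.coe_product, Set.mem_prod, Finset.mem_coe, mem_link] at hx hy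
    have hX := hx.1.2
    have hY := hy.1.2
    have hval : ∀ {z : Fin k → Fin n}, X ⊆ cells z → ∀ {v}, v ∈ X → z v.1 = v.2 :=
      fun hz _ hv => mem_cells.1 (hz hv)
    have hxy1 : x = y := by
      funext j
      by_cases h : (j, x j) ∈ X
      · exact (hval hY h).symm
      · by_cases h' : (j, y j) ∈ X
        · exact hval hX h'
        · simpa [h, h'] using congrFun hxy j
    subst hxy1
    refine Prod.ext rfl ?_
    funext ⟨v, hv⟩
    have hv' : (v.1, x v.1) = v := Prod.ext rfl (hval hX hv)
    have := congrFun hxy v.1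
    have hmem : (v.1, x v.1) ∈ X := hv'.symm ▸ hv
    simp only [dif_pos hmem] at this
    simpa only [hv'] using this
  simpa using this

theorem card_le_card_avoid_add (G : Finset (Fin k → Fin n)) (U : Finset (Fin k × Fin n)) :
    G.card ≤ (avoid G U).card + ∑ v ∈ U, (link G {v}).card := by
  have hsub : G ⊆ avoid G U ∪ U.biUnion fun v => link G {v} := by
    intro x hx
    rw [Finset.mem_union, mem_avoid, Finset.mem_biUnion]
    by_cases h : Disjoint (cells x) U
    · exact Or.inl ⟨hx, h⟩
    · obtain ⟨v, hv, hvU⟩ := Finset.not_disjoint_iff.1 h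
      exact Or.inr ⟨v, hvU, mem_link.2 ⟨hx, by simpa using hv⟩⟩
  exact (Finset.card_le_card hsub).trans ((Finset.card_union_le _ _).trans
    (Nat.add_le_add_left Finset.card_biUnion_le _))

/-- The family `G` is `r`-spread over `X`. -/
def IsSpreadOver (r : ℕ) (G : Finset (Fin k → Fin n)) (X : Finset (Fin k × Fin n)) : Prop :=
  G.Nonempty ∧ (∀ x ∈ G, X ⊆ cells x) ∧
    ∀ T, Disjoint T X → r ^ T.card * (link G T).card ≤ G.card

theorem exists_isSpreadOver_link {r : ℕ} (hk : 1 ≤ k) (hr0 : 0 < r) (hrn : r ≤ n)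
    (hr : 16 * r ^ 3 ≤ n ^ 2) {H : Finset (Fin k → Fin n)} {Y : Finset (Fin k × Fin n)}
    (hY : ∀ x ∈ H, Y ⊆ cells x) (hH : n ^ (k - 1) < 16 * (r ^ Y.card * H.card)) :
    ∃ X, Y ⊆ X ∧ X.card ≤ 2 ∧ IsSpreadOver r (link H X) X := by
  have hlinkY : link H Y = H := Finset.filter_true_of_mem hY
  obtain ⟨X, hX, hmax⟩ := Finset.exists_max_image
    (Finset.univ.filter fun X => Y ⊆ X ∧ r ^ Y.card * H.card ≤ r ^ X.card * (link H X).card)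
    Finset.card ⟨Y, by simp [hlinkY]⟩
  simp only [Finset.mem_filter, Finset.mem_univ, true_and] at hX hmax
  obtain ⟨hYX, hX⟩ := hX
  have hpos : 0 < (link H X).card := by
    rcases Nat.eq_zero_or_pos (link H X).card with h | h
    · rw [h] at hX; omega
    · exact h
  refine ⟨X, hYX, ?_, Finset.card_pos.1 hpos, fun x hx => (mem_link.1 hx).2, ?_⟩
  · by_contra! h3
    obtain ⟨d, hd⟩ := Nat.exists_eq_add_of_le (show 3 ≤ X.card from h3)
    have hb := card_link_mul_le H X
    have hnk : n ^ k = n ^ (k - 1) * n := by rw [← pow_succ]; congr 1; omega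
    have hn0 : 0 < n := hr0.trans_le hrn
    have h1 : n ^ (k - 1) * n ^ X.card < n ^ (k - 1) * (16 * r ^ X.card * n) :=
      calc n ^ (k - 1) * n ^ X.card < 16 * (r ^ Y.card * H.card) * n ^ X.card :=
            Nat.mul_lt_mul_of_pos_right hH (by positivity)
        _ ≤ 16 * (r ^ X.card * (link H X).card) * n ^ X.card := by gcongr
        _ = 16 * r ^ X.card * ((link H X).card * n ^ X.card) := by ring
        _ ≤ 16 * r ^ X.card * n ^ k := by gcongr
        _ = _ := by rw [hnk]; ring
    have h2 := Nat.lt_of_mul_lt_mul_left h1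
    rw [hd] at h2
    have h4 : 16 * r ^ (3 + d) * n ≤ n ^ (3 + d) :=
      calc 16 * r ^ (3 + d) * n = (16 * r ^ 3) * r ^ d * n := by ring
        _ ≤ n ^ 2 * n ^ d * n := by gcongr
        _ = n ^ (3 + d) := by ring
    omega
  · intro T hT
    by_contra! hlt
    rw [link_link] at hlt
    have hcard : (X ∪ T).card = X.card + T.card := Finset.card_union_of_disjoint hT.symm
    have hle := hmax (X ∪ T) ⟨hYX.trans Finset.subset_union_left, by
      rw [hcard, pow_add, mul_assoc]
      exact hX.trans (Nat.mul_le_mul_left _ hlt.le)⟩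
    have hT0 : T.card = 0 := by omega
    rw [Finset.card_eq_zero.1 hT0] at hlt
    simp at hlt

/-- Deleting few cells outside `X` keeps a spread family spread. -/
theorem IsSpreadOver.avoid {r : ℕ} {G : Finset (Fin k → Fin n)} {X U : Finset (Fin k × Fin n)}
    (h : IsSpreadOver (2 * r) G X) (hUX : Disjoint U X) (hU : U.card ≤ r) (hr0 : 0 < r) :
    IsSpreadOver r (avoid G U) X := by
  obtain ⟨hne, hX, hs⟩ := h
  have hG : 0 < G.card := hne.card_pos
  have hsum : 2 * r * ∑ v ∈ U, (link G {v}).card ≤ r * G.card := by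
    rw [Finset.mul_sum]
    refine (Finset.sum_le_card_nsmul _ _ G.card fun v hv => ?_).trans ?_
    · have := hs {v} (Finset.disjoint_singleton_left.2 (Finset.disjoint_left.1 hUX hv))
      simpa using this
    · rw [smul_eq_mul]; gcongr
  have hhalf : G.card ≤ 2 * (_root_.avoid G U).card := by
    have h1 := card_le_card_avoid_add G U
    have h2 : 2 * ∑ v ∈ U, (link G {v}).card ≤ G.card := by
      refine Nat.le_of_mul_le_mul_left ?_ hr0
      linarith
    omega
  refine ⟨Finset.card_pos.1 (by omega), fun x hx => hX x (avoid_subset _ _ hx), fun T hT => ?_⟩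
  rcases T.eq_empty_or_nonempty with rfl | hTne
  · simpa using Finset.card_le_card (link_subset (_root_.avoid G U) ∅)
  · have h1 : (link (_root_.avoid G U) T).card ≤ (link G T).card :=
      Finset.card_le_card (Finset.filter_subset_filter _ (avoid_subset _ _))
    have h2 := hs T hT
    have h3 : 2 ≤ 2 ^ T.card := Nat.le_self_pow hTne.card_pos.ne' 2
    rw [mul_pow] at h2
    have h4 : 2 * (r ^ T.card * (link (_root_.avoid G U) T).card) ≤ 2 * (_root_.avoid G U).card :=
      calc 2 * (r ^ T.card * (link (_root_.avoid G U) T).card)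
          ≤ 2 ^ T.card * (r ^ T.card * (link G T).card) := by gcongr
        _ ≤ G.card := by rw [← mul_assoc]; exact h2
        _ ≤ _ := hhalf
    omega

/-- Either `Y` is one cell that lies in many members of `F`, or `Y` is empty and `F` has a large
subfamily in which no cell has large degree. -/
def IsPrimary (s : ℕ) (F : Finset (Fin k → Fin n)) (Y : Finset (Fin k × Fin n)) : Prop :=
  (∃ v, Y = {v} ∧ 3 * n ^ (k - 1) ≤ 8 * s * (link F {v}).card) ∨
    Y = ∅ ∧ ∃ R ⊆ F, n ^ (k - 1) < R.card ∧ ∀ v, 8 * s * (link R {v}).card < 3 * n ^ (k - 1)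

theorem card_link_singleton_le (hk : 1 ≤ k) (hn : 0 < n) (G : Finset (Fin k → Fin n))
    (v : Fin k × Fin n) : (link G {v}).card ≤ n ^ (k - 1) := by
  have h := card_link_mul_le G {v}
  have hnk : n ^ k = n ^ (k - 1) * n := by rw [← pow_succ]; congr 1; omega
  rw [hnk, Finset.card_singleton, pow_one] at h
  exact Nat.le_of_mul_le_mul_right h hn

theorem exists_isPrimary {s : ℕ} (hk : 1 ≤ k) (hn : 0 < n) {F : Fin s → Finset (Fin k → Fin n)}
    (hF : ∀ i : Fin s, ((i : ℕ) + 1) * n ^ (k - 1) < (F i).card) :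
    ∃ Y : Fin s → Finset (Fin k × Fin n),
      (∀ i j, i ≠ j → Disjoint (Y i) (Y j)) ∧ ∀ i, IsPrimary s (F i) (Y i) := by
  have hN : 0 < n ^ (k - 1) := by positivity
  have key : ∀ (i : ℕ) (Q : Finset (Fin k × Fin n)), ∃ Y : Finset (Fin k × Fin n),
      Disjoint Y Q ∧ Y.card ≤ 1 ∧
        ∀ h : i < s, Q.card ≤ i → IsPrimary s (F ⟨i, h⟩) Y := by
    intro i Q
    by_cases h : i < s
    swap
    · exact ⟨∅, by simp, by simp, fun h' => absurd h' h⟩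
    by_cases hv : ∃ v ∉ Q, 3 * n ^ (k - 1) ≤ 8 * s * (link (F ⟨i, h⟩) {v}).card
    · obtain ⟨v, hvQ, hv⟩ := hv
      exact ⟨{v}, by simpa using hvQ, by simp, fun _ _ => Or.inl ⟨v, rfl, hv⟩⟩
    · push Not at hv
      refine ⟨∅, by simp, by simp, fun _ hQ =>
        Or.inr ⟨rfl, avoid (F ⟨i, h⟩) Q, avoid_subset _ _, ?_, fun v => ?_⟩⟩
      · have h1 := card_le_card_avoid_add (F ⟨i, h⟩) Q
        have h2 : ∑ v ∈ Q, (link (F ⟨i, h⟩) {v}).card ≤ i * n ^ (k - 1) := by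
          refine (Finset.sum_le_card_nsmul _ _ (n ^ (k - 1)) fun v _ =>
            card_link_singleton_le hk hn _ v).trans ?_
          rw [smul_eq_mul]; gcongr
        have h3 := hF ⟨i, h⟩
        simp only [add_mul, one_mul] at h3
        omega
      · by_cases hvQ : v ∈ Q
        · have : link (avoid (F ⟨i, h⟩) Q) {v} = ∅ := by
            refine Finset.eq_empty_of_forall_notMem fun x hx => ?_
            rw [mem_link, mem_avoid, Finset.singleton_subset_iff] at hx
            exact Finset.disjoint_left.1 hx.1.2 hx.2 hvQ
          rw [this]; simpa using hN
        · refine lt_of_le_of_lt (Nat.mul_le_mul_left _ (Finset.card_le_card ?_)) (hv v hvQ)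
          exact Finset.filter_subset_filter _ (avoid_subset _ _)
  choose y hy using key
  let P : ℕ → Finset (Fin k × Fin n) := fun i => Nat.rec ∅ (fun i Q => Q ∪ y i Q) i
  have hP : ∀ i, P (i + 1) = P i ∪ y i (P i) := fun _ => rfl
  have hcard : ∀ i, (P i).card ≤ i := by
    intro i
    induction i with
    | zero => simp [P]
    | succ i ih =>
      rw [hP]
      exact (Finset.card_union_le _ _).trans (add_le_add ih (hy i (P i)).2.1)
  have hmono : Monotone P := monotone_nat_of_le_succ fun i => by
    rw [hP]; exact Finset.subset_union_left
  have hdisj : ∀ i j : Fin s, i < j → Disjoint (y i (P i)) (y j (P j)) := by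
    intro i j hij
    refine Finset.disjoint_of_subset_left ?_ (hy j (P j)).1.symm
    refine subset_trans ?_ (hmono (show (i : ℕ) + 1 ≤ j from hij))
    rw [hP]; exact Finset.subset_union_right
  refine ⟨fun i => y i (P i), fun i j hij => ?_, fun i => (hy i (P i)).2.2 i.2 (hcard i)⟩
  rcases lt_or_gt_of_ne hij with h | h
  · exact hdisj i j h
  · exact (hdisj j i h).symm

theorem IsPrimary.exists_isSpreadOver {s r : ℕ} (hk : 1 ≤ k) (hs : 0 < s) (hsr : 8 * s ≤ r)
    (hrn : r ≤ n) (hr : 16 * r ^ 3 ≤ n ^ 2) (hn : 8 * s ^ 2 ≤ n)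
    {F : Finset (Fin k → Fin n)} {Y : Finset (Fin k × Fin n)} (hY : IsPrimary s F Y)
    (Q : Finset (Fin k × Fin n)) (hQ : Q.card ≤ 2 * s) :
    ∃ X, Y ⊆ X ∧ X.card ≤ 2 ∧ Disjoint X (Q \ Y) ∧ ∃ G ⊆ F, IsSpreadOver r G X := by
  have hn0 : 0 < n := by omega
  have hN : 0 < n ^ (k - 1) := by positivity
  suffices h : ∃ H ⊆ F, (∀ x ∈ H, Y ⊆ cells x ∧ Disjoint (cells x) (Q \ Y)) ∧
      n ^ (k - 1) < 16 * (r ^ Y.card * H.card) by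
    obtain ⟨H, hHF, hH, hcard⟩ := h
    obtain ⟨X, hYX, hX2, hX⟩ := exists_isSpreadOver_link hk (by omega) hrn hr
      (fun x hx => (hH x hx).1) hcard
    refine ⟨X, hYX, hX2, ?_, link H X, (link_subset _ _).trans hHF, hX⟩
    obtain ⟨x, hx⟩ := hX.1
    exact Finset.disjoint_of_subset_left (hX.2.1 x hx) (hH x (link_subset _ _ hx)).2
  rcases hY with ⟨v, rfl, hv⟩ | ⟨rfl, R, hRF, hR, hdeg⟩
  · refine ⟨avoid (link F {v}) (Q \ {v}), (avoid_subset _ _).trans (link_subset _ _),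
      fun x hx => ?_, ?_⟩
    · rw [mem_avoid, mem_link] at hx
      exact ⟨hx.1.2, hx.2⟩
    · have h1 := card_le_card_avoid_add (link F {v}) (Q \ {v})
      set H := avoid (link F {v}) (Q \ {v})
      have h2 : n * ∑ u ∈ Q \ {v}, (link (link F {v}) {u}).card ≤ 2 * s * n ^ (k - 1) := by
        rw [Finset.mul_sum]
        refine (Finset.sum_le_card_nsmul _ _ (n ^ (k - 1)) fun u hu => ?_).trans ?_
        · have huv : v ≠ u := by
            rintro rfl; simp at hu
          have h := card_link_mul_le F ({v} ∪ {u})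
          have hnk : n ^ k = n ^ (k - 1) * n := by rw [← pow_succ]; congr 1; omega
          rw [link_link]
          rw [Finset.card_union_of_disjoint (by simpa using huv), Finset.card_singleton,
            Finset.card_singleton, hnk] at h
          refine Nat.le_of_mul_le_mul_right (le_trans (le_of_eq ?_) h) hn0
          ring
        · rw [smul_eq_mul]
          exact Nat.mul_le_mul_right _ ((Finset.card_le_card Finset.sdiff_subset).trans hQ)
      have h3 : n * n ^ (k - 1) ≤ n * (8 * s * H.card) := by
        have e1 : n * (3 * n ^ (k - 1)) ≤ n * (8 * s * (link F {v}).card) := by gcongr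
        have e2 : 8 * s * n * (link F {v}).card ≤
            8 * s * n * (H.card + ∑ u ∈ Q \ {v}, (link (link F {v}) {u}).card) := by gcongr
        have e3 := Nat.mul_le_mul_left (8 * s) h2
        have e4 := Nat.mul_le_mul_right (2 * n ^ (k - 1)) hn
        nlinarith
      have h4 : n ^ (k - 1) ≤ 8 * s * H.card := Nat.le_of_mul_le_mul_left h3 hn0
      have h5 : 8 * s * H.card ≤ r * H.card := by gcongr
      rw [Finset.card_singleton, pow_one]
      omega
  · refine ⟨avoid R Q, (avoid_subset _ _).trans hRF, fun x hx => ?_, ?_⟩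
    · exact ⟨by simp, by simpa using (mem_avoid.1 hx).2⟩
    · have h1 := card_le_card_avoid_add R Q
      have h2 : 8 * s * ∑ v ∈ Q, (link R {v}).card ≤ 2 * s * (3 * n ^ (k - 1)) := by
        rw [Finset.mul_sum]
        refine (Finset.sum_le_card_nsmul _ _ (3 * n ^ (k - 1)) fun v _ => (hdeg v).le).trans ?_
        rw [smul_eq_mul]; gcongr
      have h3 : 4 * ∑ v ∈ Q, (link R {v}).card ≤ 3 * n ^ (k - 1) := by
        refine Nat.le_of_mul_le_mul_left ?_ (show 0 < 2 * s by omega)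
        linarith
      simp only [Finset.card_empty, pow_zero, one_mul]
      omega

end Tuples

/-- Disjoint sets `Y i` can be enlarged one after the other, keeping them disjoint. -/
theorem exists_disjoint_extension {V : Type*} [DecidableEq V] {s d : ℕ} {Y : Fin s → Finset V}
    (good : Fin s → Finset V → Prop) (hYcard : ∀ i, (Y i).card ≤ d)
    (hYdisj : ∀ i j, i ≠ j → Disjoint (Y i) (Y j))
    (hext : ∀ i (Q : Finset V), Q.card ≤ d * s →
      ∃ X, Y i ⊆ X ∧ X.card ≤ d ∧ Disjoint X (Q \ Y i) ∧ good i X) :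
    ∃ X : Fin s → Finset V, (∀ i, (X i).card ≤ d) ∧
      (∀ i j, i ≠ j → Disjoint (X i) (X j)) ∧ ∀ i, good i (X i) := by
  have key : ∀ m ≤ s, ∃ X : Fin s → Finset V, (∀ i, (X i).card ≤ d) ∧
      (∀ i j, i ≠ j → Disjoint (X i) (X j)) ∧ (∀ i : Fin s, (i : ℕ) < m → good i (X i)) ∧
      ∀ i : Fin s, m ≤ i → X i = Y i := by
    intro m
    induction m with
    | zero => exact fun _ => ⟨Y, hYcard, hYdisj, by simp, fun _ _ => rfl⟩
    | succ m ih =>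
      intro hm
      obtain ⟨X, hcard, hdisj, hgood, heq⟩ := ih (by omega)
      set i₀ : Fin s := ⟨m, hm⟩
      have hQ : (Finset.univ.biUnion X).card ≤ d * s := by
        refine Finset.card_biUnion_le.trans ((Finset.sum_le_card_nsmul _ _ d
          fun i _ => hcard i).trans ?_)
        simp [mul_comm]
      obtain ⟨Z, hYZ, hZd, hZ, hZgood⟩ := hext i₀ _ hQ
      have hZX : ∀ j, j ≠ i₀ → Disjoint Z (X j) := by
        intro j hj
        refine Finset.disjoint_of_subset_right ?_ hZ
        rw [← heq i₀ le_rfl, Finset.subset_sdiff]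
        exact ⟨Finset.subset_biUnion_of_mem X (Finset.mem_univ j), hdisj j i₀ hj⟩
      refine ⟨Function.update X i₀ Z, fun i => ?_, fun i j hij => ?_, fun i hi => ?_,
        fun i hi => ?_⟩
      · by_cases h : i = i₀
        · subst h; simpa using hZd
        · simpa [h] using hcard i
      · by_cases h : i = i₀
        · subst h
          simpa [hij.symm] using hZX j hij.symm
        · by_cases h' : j = i₀
          · subst h'
            simpa [hij] using (hZX i hij).symm
          · simpa [h, h'] using hdisj i j hij
      · by_cases h : i = i₀
        · subst h; simpa using hZgood
        · have : (i : ℕ) ≠ m := fun e => h (Fin.ext e)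
          simpa [h] using hgood i (by omega)
      · have h : i ≠ i₀ := by
          rintro rfl
          exact absurd hi (by simp [i₀])
        simpa [h] using heq i (by omega)
  obtain ⟨X, h1, h2, h3, -⟩ := key s le_rfl
  exact ⟨X, h1, h2, fun i => h3 i i.2⟩

/-- Families that are spread over disjoint sets contain a rainbow matching. -/
theorem exists_rainbow_of_isSpreadOver {n k s r β : ℕ} (hs : 0 < s) (hβ : s * k < 2 ^ β)
    (hβ0 : 0 < β) (hr : 4 * (s * β) ≤ r)
    {G : Fin s → Finset (Fin k → Fin n)} {X : Fin s → Finset (Fin k × Fin n)}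
    (hG : ∀ i, IsSpreadOver r (G i) (X i))
    (hGX : ∀ i j, i ≠ j → ∀ x ∈ G i, Disjoint (cells x) (X j)) :
    ∃ g : Fin s → (Fin k → Fin n), (∀ i, g i ∈ G i) ∧
      ∀ i i', i ≠ i' → ∀ j, g i j ≠ g i' j := by
  classical
  let bad : Fin s → Finset (Fin k × Fin n → Fin s × Fin β) := fun i =>
    Finset.univ.filter fun c => ∀ x ∈ G i, ∃ v ∈ cells x \ X i, (c v).1 ≠ i
  have hbad : ∀ i, (bad i).card * 2 ^ β ≤ k * Fintype.card (Fin k × Fin n → Fin s × Fin β) := by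
    intro i
    obtain ⟨hne, hX, hspread⟩ := hG i
    have : Nonempty (G i) := hne.to_subtype
    refine card_uncovered_colorings_le (r := r) (ι := G i) (by simpa using hr)
      (fun x => cells x.1 \ X i)
      (fun x => (Finset.card_le_card Finset.sdiff_subset).trans (card_cells_le _)) ?_
      (fun l => (i, ⟨l % β, Nat.mod_lt _ hβ0⟩)) ?_ (bad i) ?_
    · intro T
      by_cases hT : Disjoint T (X i)
      · rw [Fintype.card_coe]
        refine le_trans (Nat.mul_le_mul_left _ ?_) (hspread T hT)
        refine Finset.card_le_card_of_injOn Subtype.val ?_ Subtype.val_injective.injOn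
        intro x hx
        simp only [Finset.coe_filter, Finset.mem_univ, true_and, Set.mem_ofPred_eq] at hx
        exact mem_link.2 ⟨x.2, hx.trans Finset.sdiff_subset⟩
      · rw [Finset.filter_false_of_mem]
        · simp
        · intro x _ hx
          exact hT (Finset.disjoint_of_subset_left hx Finset.sdiff_disjoint)
    · intro l hl m hm h
      have := congrArg (fun p : Fin s × Fin β => (p.2 : ℕ)) h
      simp only [Nat.mod_eq_of_lt hl, Nat.mod_eq_of_lt (hm.trans hl)] at this
      omega
    · intro c hc x
      obtain ⟨v, hv, hcv⟩ := (Finset.mem_filter.1 hc).2 x.1 x.2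
      exact ⟨v, hv, fun m _ h => hcv (by rw [h])⟩
  obtain ⟨c, hc⟩ : ∃ c, ∀ i, c ∉ bad i := by
    by_contra! hall
    have hcov : Fintype.card (Fin k × Fin n → Fin s × Fin β) ≤ ∑ i, (bad i).card := by
      rw [← Finset.card_univ]
      refine le_trans (Finset.card_le_card fun c _ => ?_) Finset.card_biUnion_le
      obtain ⟨i, hi⟩ := hall c
      exact Finset.mem_biUnion.2 ⟨i, Finset.mem_univ i, hi⟩
    have hpos : 0 < Fintype.card (Fin k × Fin n → Fin s × Fin β) := by
      have : Nonempty (Fin s × Fin β) := ⟨⟨0, hs⟩, ⟨0, hβ0⟩⟩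
      exact Fintype.card_pos
    have hsum : (∑ i, (bad i).card) * 2 ^ β ≤
        s * k * Fintype.card (Fin k × Fin n → Fin s × Fin β) := by
      rw [Finset.sum_mul]
      refine (Finset.sum_le_card_nsmul _ _ _ fun i _ => hbad i).trans ?_
      simp [mul_assoc]
    have h1 := Nat.mul_le_mul_right (2 ^ β) hcov
    have h2 := Nat.mul_lt_mul_of_pos_right hβ hpos
    linarith
  have hgood : ∀ i, ∃ x ∈ G i, ∀ v ∈ cells x \ X i, (c v).1 = i := by
    intro i
    have := hc i
    simp only [bad, Finset.mem_filter, Finset.mem_univ, true_and] at this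
    push Not at this
    exact this
  choose g hgG hg using hgood
  refine ⟨g, hgG, fun i i' hii j hj => ?_⟩
  have hv : (j, g i j) ∈ cells (g i) := mem_cells.2 rfl
  have hv' : (j, g i j) ∈ cells (g i') := mem_cells.2 hj.symm
  have h1 : (j, g i j) ∉ X i :=
    Finset.disjoint_left.1 (hGX i' i hii.symm _ (hgG i')) hv'
  have h2 : (j, g i j) ∉ X i' := Finset.disjoint_left.1 (hGX i i' hii _ (hgG i)) hv
  exact hii ((hg i _ (Finset.mem_sdiff.2 ⟨hv, h1⟩)).symm.trans
    (hg i' _ (Finset.mem_sdiff.2 ⟨hv', h2⟩)))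

theorem exists_rainbow_of_card {n k s β : ℕ} (hk : 1 ≤ k) (hs : 0 < s) (hβ : s * k < 2 ^ β)
    (hβ0 : 0 < β) (hn : 8 * s ^ 2 ≤ n) (hn' : 16 * (8 * (s * β)) ^ 3 ≤ n ^ 2)
    {F : Fin s → Finset (Fin k → Fin n)}
    (hF : ∀ i : Fin s, ((i : ℕ) + 1) * n ^ (k - 1) < (F i).card) :
    ∃ g : Fin s → (Fin k → Fin n), (∀ i, g i ∈ F i) ∧
      ∀ i i', i ≠ i' → ∀ j, g i j ≠ g i' j := by
  have hsβ : s ≤ s * β := Nat.le_mul_of_pos_right s hβ0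
  have hn0 : 0 < n := lt_of_lt_of_le (by positivity) hn
  have hrn : 2 * (4 * (s * β)) ≤ n := by
    have h1 : 2 * (4 * (s * β)) = 8 * (s * β) := by ring
    rw [h1]
    refine (Nat.pow_le_pow_iff_left two_ne_zero).1 ?_
    set r := 8 * (s * β)
    have hr1 : 1 ≤ r := by omega
    calc r ^ 2 ≤ r ^ 3 := Nat.pow_le_pow_right hr1 (by norm_num)
      _ ≤ 16 * r ^ 3 := by omega
      _ ≤ n ^ 2 := hn'
  obtain ⟨Y, hYdisj, hY⟩ := exists_isPrimary hk hn0 hF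
  obtain ⟨X, hXcard, hXdisj, hX⟩ := exists_disjoint_extension (d := 2)
    (fun i X => ∃ G ⊆ F i, IsSpreadOver (2 * (4 * (s * β))) G X)
    (fun i => by
      rcases hY i with ⟨v, hv, -⟩ | ⟨hv, -⟩ <;> simp [hv])
    hYdisj
    (fun i Q hQ => (hY i).exists_isSpreadOver hk hs (by omega) hrn
      (by rw [← mul_assoc]; exact hn') hn Q hQ)
  choose G hGF hG using hX
  let U : Fin s → Finset (Fin k × Fin n) := fun i => (Finset.univ.erase i).biUnion X
  have hU : ∀ i, (U i).card ≤ 4 * (s * β) := by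
    intro i
    have : (U i).card ≤ s * 2 := by
      refine Finset.card_biUnion_le.trans ((Finset.sum_le_card_nsmul _ _ 2
        fun i _ => hXcard i).trans ?_)
      rw [smul_eq_mul]
      gcongr
      simp
    omega
  have hUX : ∀ i, Disjoint (U i) (X i) := fun i =>
    (Finset.disjoint_biUnion_left _ _ _).2 fun j hj => hXdisj j i (Finset.ne_of_mem_erase hj)
  obtain ⟨g, hg, hdisj⟩ := exists_rainbow_of_isSpreadOver hs hβ hβ0 le_rfl
    (G := fun i => avoid (G i) (U i)) (X := X)
    (fun i => (hG i).avoid (hUX i) (hU i) (by omega))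
    (fun i j hij x hx => Finset.disjoint_of_subset_right
      (Finset.subset_biUnion_of_mem X (Finset.mem_erase.2 ⟨hij.symm, Finset.mem_univ j⟩))
      (mem_avoid.1 hx).2)
  exact ⟨g, fun i => hGF i (avoid_subset _ _ (hg i)), hdisj⟩

/-- Theorem 1.2: for `n ≥ max(2^8 s^{3/2} (log₂(sk))^{3/2}, 8s²)`, the sequence
`f_i = i·n^{k-1}` is satisfying. -/
theorem stmt0 (s k n : ℕ) (hs : 1 ≤ s) (hk : 1 ≤ k)
    (hn : (n : ℝ) ≥ max (2 ^ 8 * (s : ℝ) ^ ((3 : ℝ) / 2) *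
        (Real.logb 2 ((s : ℝ) * (k : ℝ))) ^ ((3 : ℝ) / 2)) (8 * (s : ℝ) ^ 2))
    (F : Fin s → Finset (Fin k → Fin n))
    (hF : ∀ i : Fin s, ((i : ℕ) + 1) * n ^ (k - 1) < (F i).card) :
    ∃ g : Fin s → (Fin k → Fin n), (∀ i, g i ∈ F i) ∧
      ∀ i i', i ≠ i' → ∀ j, g i j ≠ g i' j := by
  rcases hs.eq_or_lt with rfl | hs2
  · have hne : ∀ i, ∃ x, x ∈ F i := fun i => Finset.card_pos.1 ((Nat.zero_le _).trans_lt (hF i))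
    choose g hg using hne
    exact ⟨g, hg, fun i i' h => absurd (Subsingleton.elim i i') h⟩
  have hsk : 2 ≤ s * k := by nlinarith
  set L := Real.logb 2 ((s : ℝ) * (k : ℝ)) with hL
  have hlog : ((Nat.log 2 (s * k) : ℕ) : ℝ) ≤ L := by
    rw [hL, ← Nat.cast_mul]
    exact Real.natLog_le_logb (s * k) 2
  have hL1 : 1 ≤ L := by
    have : 1 ≤ Nat.log 2 (s * k) := Nat.log_pos (by norm_num) hsk
    exact le_trans (by exact_mod_cast this) hlog
  have hn1 : 2 ^ 8 * (s : ℝ) ^ ((3 : ℝ) / 2) * L ^ ((3 : ℝ) / 2) ≤ n := (le_max_left _ _).trans hn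
  have hn2 : 8 * (s : ℝ) ^ 2 ≤ n := (le_max_right _ _).trans hn
  refine exists_rainbow_of_card (β := Nat.log 2 (s * k) + 1) hk (by omega)
    (Nat.lt_pow_succ_log_self (by norm_num) _) (Nat.succ_pos _) (by exact_mod_cast hn2) ?_ hF
  have hsq : ∀ x : ℝ, 0 ≤ x → (x ^ ((3 : ℝ) / 2)) ^ 2 = x ^ 3 := by
    intro x hx
    rw [← Real.rpow_natCast, ← Real.rpow_mul hx, ← Real.rpow_natCast]
    norm_num
  have h1 : (2 ^ 16 : ℝ) * (s : ℝ) ^ 3 * L ^ 3 ≤ (n : ℝ) ^ 2 := by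
    have h := pow_le_pow_left₀ (by positivity) hn1 2
    rw [mul_pow, mul_pow, hsq _ (by positivity), hsq _ (by linarith)] at h
    norm_num at h ⊢
    exact h
  have h2 : (16 : ℝ) * (8 * (s * ((Nat.log 2 (s * k) : ℕ) + 1 : ℝ))) ^ 3 ≤ (n : ℝ) ^ 2 := by
    refine le_trans ?_ h1
    calc (16 : ℝ) * (8 * (s * ((Nat.log 2 (s * k) : ℕ) + 1 : ℝ))) ^ 3
        ≤ 16 * (8 * (s * (2 * L))) ^ 3 := by
          gcongr
          linarith
      _ = 2 ^ 16 * (s : ℝ) ^ 3 * L ^ 3 := by ring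
  exact_mod_cast h2
end

section
/- For every real C ≥ 20 there exists s_0 (depending only on C) such that for all integers s > s_0, all integers n, and all integers k with k < C·n/(3·√(s/log s)), the sequence f_i = min(s−1, i + C√(s·log s))·n^{k−1} (i = 1, …, s) is satisfying: whenever families F_1, …, F_s ⊆ [n]^k satisfy |F_i| > f_i for every i ∈ [s], the families contain a rainbow matching. (log denotes the natural logarithm.) -/
namespace CrossMatching
open Finset
open scoped BigOperators

lemma one_add_sum_le_prod_of_nonneg {ι : Type*} (s : Finset ι) (a : ι → ℝ)
    (h : ∀ i ∈ s, 0 ≤ a i) : 1 + ∑ i ∈ s, a i ≤ ∏ i ∈ s, (1 + a i) := by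
  classical
  induction s using Finset.induction_on with
  | empty => simp
  | insert i s hi ih =>
    rw [sum_insert hi, prod_insert hi]
    have h0 : 0 ≤ a i := h i (mem_insert_self _ _)
    have h1 := ih fun j hj => h j (mem_insert_of_mem hj)
    have h2 : 0 ≤ ∑ j ∈ s, a j := sum_nonneg fun j hj => h j (mem_insert_of_mem hj)
    nlinarith [mul_le_mul_of_nonneg_left h1 (by linarith : 0 ≤ 1 + a i), mul_nonneg h0 h2]

lemma one_add_sum_le_prod_of_nonpos {ι : Type*} (s : Finset ι) (a : ι → ℝ)
    (h : ∀ i ∈ s, a i ≤ 0) (h' : ∀ i ∈ s, -1 ≤ a i) :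
    1 + ∑ i ∈ s, a i ≤ ∏ i ∈ s, (1 + a i) := by
  classical
  induction s using Finset.induction_on with
  | empty => simp
  | insert i s hi ih =>
    rw [sum_insert hi, prod_insert hi]
    have h0 := h i (mem_insert_self _ _)
    have h0' := h' i (mem_insert_self _ _)
    have h1 := ih (fun j hj => h j (mem_insert_of_mem hj)) fun j hj => h' j (mem_insert_of_mem hj)
    have h2 : ∑ j ∈ s, a j ≤ 0 := sum_nonpos fun j hj => h j (mem_insert_of_mem hj)
    nlinarith [mul_le_mul_of_nonneg_left h1 (by linarith : 0 ≤ 1 + a i), mul_nonneg_of_nonpos_of_nonpos h0 h2]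

lemma sum_sq_le_prod {N : ℕ} (hN : 0 < N) (y : Fin N → ℝ) :
    (∑ v, y v) ^ 2 ≤ (N : ℝ) ^ 2 * ∏ v, (((N : ℝ) - 1 + y v ^ 2) / N) := by
  have hN' : (1 : ℝ) ≤ N := by exact_mod_cast hN
  have hN0 : (0 : ℝ) < N := by linarith
  set f : Fin N → ℝ := fun v => max (y v ^ 2) 1 with hf
  set g : Fin N → ℝ := fun v => min (y v ^ 2) 1 with hg
  have hfg : ∀ v, f v * g v = y v ^ 2 := fun v => by
    simp only [hf, hg]; rw [mul_comm, min_mul_max, mul_one]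
  have hsum : (∑ v, y v) ^ 2 ≤ (∑ v, f v) * ∑ v, g v := by
    apply sum_sq_le_sum_mul_sum_of_sq_le_mul
    · intro v _; exact le_trans zero_le_one (le_max_right _ _)
    · intro v _; exact le_min (sq_nonneg _) zero_le_one
    · intro v _; exact (hfg v).ge
  have hprod : ∏ v, (((N : ℝ) - 1 + y v ^ 2) / N)
      = (∏ v, (1 + (f v - 1) / N)) * ∏ v, (1 + (g v - 1) / N) := by
    rw [← prod_mul_distrib]
    refine prod_congr rfl fun v _ => ?_
    simp only [hf, hg]
    rcases le_total (y v ^ 2) 1 with h | h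
    · rw [max_eq_right h, min_eq_left h]; field_simp; ring
    · rw [max_eq_left h, min_eq_right h]; field_simp; ring
  have h1 : ∑ v, f v ≤ N * ∏ v, (1 + (f v - 1) / N) := by
    have := one_add_sum_le_prod_of_nonneg univ (fun v => (f v - 1) / N) fun v _ =>
      div_nonneg (sub_nonneg.2 (le_max_right _ _)) hN0.le
    rw [← Finset.sum_div, sum_sub_distrib] at this
    simp only [sum_const, card_univ, Fintype.card_fin, nsmul_eq_mul, mul_one] at this
    calc ∑ v, f v = N * (1 + (∑ v, f v - N) / N) := by field_simp; ring
      _ ≤ _ := mul_le_mul_of_nonneg_left this hN0.le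
  have h2 : ∑ v, g v ≤ N * ∏ v, (1 + (g v - 1) / N) := by
    have := one_add_sum_le_prod_of_nonpos univ (fun v => (g v - 1) / N)
      (fun v _ => div_nonpos_of_nonpos_of_nonneg (sub_nonpos.2 (min_le_right _ _)) hN0.le)
      (fun v _ => by
        rw [le_div_iff₀ hN0]
        have : 0 ≤ g v := le_min (sq_nonneg _) zero_le_one
        linarith)
    rw [← Finset.sum_div, sum_sub_distrib] at this
    simp only [sum_const, card_univ, Fintype.card_fin, nsmul_eq_mul, mul_one] at this
    calc ∑ v, g v = N * (1 + (∑ v, g v - N) / N) := by field_simp; ring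
      _ ≤ _ := mul_le_mul_of_nonneg_left this hN0.le
  have hf0 : 0 ≤ ∑ v, f v := sum_nonneg fun v _ => le_trans zero_le_one (le_max_right _ _)
  have hg0 : 0 ≤ ∑ v, g v := sum_nonneg fun v _ => le_min (sq_nonneg _) zero_le_one
  calc _ ≤ _ := hsum
    _ ≤ (N * ∏ v, (1 + (f v - 1) / N)) * (N * ∏ v, (1 + (g v - 1) / N)) :=
        mul_le_mul h1 h2 hg0 (hf0.trans h1)
    _ = _ := by rw [hprod]; ring

/-- The permanent bound of Carlen, Lieb and Loss (in sum form). -/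
lemma sum_perm_prod_le (n : ℕ) : ∀ b : Fin n → Fin n → ℝ, (∀ t v, 0 < b t v) →
    ∑ σ : Equiv.Perm (Fin n), ∏ t, b t (σ t) ≤
      (n.factorial : ℝ) * ∏ v, Real.sqrt ((∑ t, b t v ^ 2) / n) := by
  induction n with
  | zero => intro b _; simp
  | succ n ih =>
    intro b hb
    rcases Nat.eq_zero_or_pos n with rfl | hn
    · have : (univ : Finset (Equiv.Perm (Fin (0+1)))) = {1} := by
        ext σ
        simp only [mem_univ, mem_singleton, true_iff]
        ext x
        omega
      rw [this]
      simp [Real.sqrt_sq (hb 0 0).le]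
    have hn0 : (0 : ℝ) < n := by exact_mod_cast hn
    have : NeZero n := ⟨hn.ne'⟩
    set h : Fin (n+1) → ℝ := fun v => Real.sqrt ((∑ t : Fin n, b t.succ v ^ 2) / n) with hh
    have hpos : ∀ v, 0 < h v := fun v => Real.sqrt_pos.2 <|
      div_pos (sum_pos (fun t _ => by have := hb t.succ v; positivity) univ_nonempty) hn0
    have hsq : ∀ v, h v ^ 2 = (∑ t : Fin n, b t.succ v ^ 2) / n := fun v =>
      Real.sq_sqrt (div_nonneg (sum_nonneg fun t _ => sq_nonneg _) hn0.le)
    have e1 : ∑ σ : Equiv.Perm (Fin (n+1)), ∏ t, b t (σ t) =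
        ∑ p : Fin (n+1), b 0 p * ∑ e : Equiv.Perm (Fin n),
          ∏ t : Fin n, b t.succ (Equiv.swap 0 p (e t).succ) := by
      rw [← (Equiv.Perm.decomposeFin (n := n)).symm.sum_comp, Fintype.sum_prod_type]
      refine sum_congr rfl fun p _ => ?_
      rw [mul_sum]
      refine sum_congr rfl fun e _ => ?_
      rw [Fin.prod_univ_succ, Equiv.Perm.decomposeFin_symm_apply_zero]
      simp only [Equiv.Perm.decomposeFin_symm_apply_succ]
    have e2 : ∀ p : Fin (n+1), ∏ w : Fin n, h (Equiv.swap 0 p w.succ) = (∏ v, h v) / h p := by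
      intro p
      rw [eq_div_iff (hpos p).ne', ← Equiv.prod_comp (Equiv.swap 0 p) h, Fin.prod_univ_succ,
        Equiv.swap_apply_left, mul_comm]
    have hH : 0 < ∏ v, h v := prod_pos fun v _ => hpos v
    have key := sum_sq_le_prod (Nat.succ_pos n) (fun p => b 0 p / h p)
    have key2 : ∑ p, b 0 p / h p ≤ ((n+1 : ℕ) : ℝ) *
        ∏ v, Real.sqrt ((((n+1 : ℕ) : ℝ) - 1 + (b 0 v / h v) ^ 2) / (n+1 : ℕ)) := by
      have hnn : ∀ v, 0 ≤ (((n+1 : ℕ) : ℝ) - 1 + (b 0 v / h v) ^ 2) / (n+1 : ℕ) := fun v => by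
        have : ((n+1 : ℕ) : ℝ) - 1 = n := by push_cast; ring
        rw [this]; positivity
      refine le_of_sq_le_sq ?_
        (mul_nonneg (Nat.cast_nonneg _) (prod_nonneg fun v _ => Real.sqrt_nonneg _))
      rw [mul_pow, ← prod_pow]
      simpa only [Real.sq_sqrt (hnn _)] using key
    calc _ = _ := e1
      _ ≤ ∑ p : Fin (n+1), b 0 p * ((n.factorial : ℝ) * ((∏ v, h v) / h p)) := by
          refine sum_le_sum fun p _ => mul_le_mul_of_nonneg_left ?_ (hb 0 p).le
          rw [← e2]
          exact ih (fun t w => b t.succ (Equiv.swap 0 p w.succ)) fun t w => hb _ _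
      _ = (n.factorial : ℝ) * ((∏ v, h v) * ∑ p, b 0 p / h p) := by
          rw [mul_sum, mul_sum]; exact sum_congr rfl fun p _ => by ring
      _ ≤ (n.factorial : ℝ) * ((∏ v, h v) * (((n+1 : ℕ) : ℝ) *
            ∏ v, Real.sqrt ((((n+1 : ℕ) : ℝ) - 1 + (b 0 v / h v) ^ 2) / (n+1 : ℕ)))) := by
          gcongr
      _ = ((n+1).factorial : ℝ) * ∏ v, (h v *
            Real.sqrt ((((n+1 : ℕ) : ℝ) - 1 + (b 0 v / h v) ^ 2) / (n+1 : ℕ))) := by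
          rw [prod_mul_distrib, Nat.factorial_succ]; push_cast; ring
      _ = _ := by
          congr 1
          refine prod_congr rfl fun v _ => ?_
          nth_rw 1 [← Real.sqrt_sq (hpos v).le]
          rw [← Real.sqrt_mul (sq_nonneg _)]
          congr 1
          have hv := (hpos v).ne'
          have : (∑ t : Fin (n+1), b t v ^ 2) = b 0 v ^ 2 + n * h v ^ 2 := by
            rw [Fin.sum_univ_succ, hsq]; field_simp
          rw [this]; push_cast; field_simp; ring

/-- The permanent bound, row version, in terms of averages. -/
lemma expect_perm_prod_le {n : ℕ} (b : Fin n → Fin n → ℝ) (hb : ∀ t v, 0 < b t v) :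
    𝔼 σ : Equiv.Perm (Fin n), ∏ t, b t (σ t) ≤ ∏ t, Real.sqrt (𝔼 v, b t v ^ 2) := by
  have h := sum_perm_prod_le n (fun v t => b t v) fun v t => hb t v
  have e : ∑ σ : Equiv.Perm (Fin n), ∏ t, b t (σ t) =
      ∑ σ : Equiv.Perm (Fin n), ∏ t, b (σ t) t := by
    rw [← Equiv.sum_comp (Equiv.inv _)]
    refine sum_congr rfl fun σ _ => ?_
    rw [← Equiv.prod_comp σ]
    simp
  rw [Fintype.expect_eq_sum_div_card, Fintype.card_perm, Fintype.card_fin, e,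
    div_le_iff₀ (by positivity), mul_comm]
  simpa only [Fintype.expect_eq_sum_div_card, Fintype.card_fin] using h

/-- The indicator function of a finite set. -/
noncomputable def ind {α : Type*} (F : Finset α) (x : α) : ℝ := by
  classical exact if x ∈ F then 1 else 0

section ind
variable {α : Type*} {F : Finset α} {x : α}

lemma ind_of_mem (h : x ∈ F) : ind F x = 1 := by simp [ind, h]

lemma ind_of_notMem (h : x ∉ F) : ind F x = 0 := by simp [ind, h]

lemma ind_eq_or (F : Finset α) (x : α) : ind F x = 0 ∨ ind F x = 1 := by
  by_cases h : x ∈ F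
  · exact Or.inr (ind_of_mem h)
  · exact Or.inl (ind_of_notMem h)

lemma ind_nonneg (F : Finset α) (x : α) : 0 ≤ ind F x := by
  rcases ind_eq_or F x with h | h <;> rw [h] <;> norm_num

lemma ind_le_one (F : Finset α) (x : α) : ind F x ≤ 1 := by
  rcases ind_eq_or F x with h | h <;> simp [h]

lemma ind_sq (F : Finset α) (x : α) : ind F x ^ 2 = ind F x := by
  rcases ind_eq_or F x with h | h <;> rw [h] <;> norm_num

lemma sum_ind [Fintype α] (F : Finset α) : ∑ x, ind F x = #F := by
  classical
  simp [ind]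

end ind

/-- The density of a finite set in a finite type. -/
noncomputable def dens {α : Type*} [Fintype α] (F : Finset α) : ℝ := 𝔼 x, ind F x

lemma dens_eq {α : Type*} [Fintype α] (F : Finset α) : dens F = #F / Fintype.card α := by
  rw [dens, Fintype.expect_eq_sum_div_card, sum_ind]

lemma dens_nonneg {α : Type*} [Fintype α] (F : Finset α) : 0 ≤ dens F :=
  expect_nonneg fun _ _ => ind_nonneg _ _

section grid
variable {k n : ℕ}

/-- Coordinatewise action of a tuple of permutations. -/
def act (π : Fin k → Equiv.Perm (Fin n)) (x : Fin k → Fin n) : Fin k → Fin n := fun j => π j (x j)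

/-- The `t`-th edge of the perfect matching given by a tuple of permutations. -/
def edge (π : Fin k → Equiv.Perm (Fin n)) (t : Fin n) : Fin k → Fin n := fun j => π j t

/-- The number of edges of the perfect matching belonging to a family. -/
noncomputable def cnt (F : Finset (Fin k → Fin n)) (π : Fin k → Equiv.Perm (Fin n)) : ℝ :=
  ∑ t, ind F (edge π t)

/-- The expected number of edges of a random perfect matching belonging to a family. -/
noncomputable def mean (F : Finset (Fin k → Fin n)) : ℝ := n * dens F

lemma mean_nonneg (F : Finset (Fin k → Fin n)) : 0 ≤ mean F :=
  mul_nonneg (Nat.cast_nonneg _) (dens_nonneg _)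

lemma cnt_nonneg (F : Finset (Fin k → Fin n)) (π) : 0 ≤ cnt F π :=
  sum_nonneg fun _ _ => ind_nonneg _ _

lemma act_mul (π ρ : Fin k → Equiv.Perm (Fin n)) (x) : act (π * ρ) x = act π (act ρ x) := rfl

lemma expect_act_left (π : Fin k → Equiv.Perm (Fin n)) (g : (Fin k → Fin n) → ℝ) :
    𝔼 x, g (act π x) = 𝔼 x, g x :=
  Fintype.expect_equiv (Equiv.piCongrRight π) _ _ fun _ => rfl

lemma expect_mul_right (ρ : Fin k → Equiv.Perm (Fin n))
    (g : (Fin k → Equiv.Perm (Fin n)) → ℝ) : 𝔼 π, g (π * ρ) = 𝔼 π, g π :=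
  Fintype.expect_equiv (Equiv.mulRight ρ) _ _ fun _ => rfl

lemma expect_act (x : Fin k → Fin n) (g : (Fin k → Fin n) → ℝ) :
    𝔼 π, g (act π x) = 𝔼 y, g y := by
  have h : ∀ y, 𝔼 π, g (act π y) = 𝔼 π, g (act π x) := fun y => by
    rw [← expect_mul_right (fun j => Equiv.swap (x j) (y j)) fun π => g (act π x)]
    refine expect_congr rfl fun π _ => ?_
    rw [act_mul]
    congr 2
    funext j
    simp [act]
  have : Nonempty (Fin k → Fin n) := ⟨x⟩
  rw [← Fintype.expect_const (ι := Fin k → Fin n) (𝔼 π, g (act π x)),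
    ← expect_congr rfl fun y _ => h y, expect_comm]
  simp only [expect_act_left]
  exact Fintype.expect_const _

lemma expect_edge (t : Fin n) (g : (Fin k → Fin n) → ℝ) : 𝔼 π, g (edge π t) = 𝔼 y, g y :=
  expect_act (fun _ => t) g

lemma exists_perm_pair {α : Type*} [DecidableEq α] {a b c d : α} (hab : a ≠ b) (hcd : c ≠ d) :
    ∃ ρ : Equiv.Perm α, ρ a = c ∧ ρ b = d := by
  refine ⟨Equiv.swap (Equiv.swap a c b) d * Equiv.swap a c, ?_, by simp⟩
  rw [Equiv.Perm.mul_apply, Equiv.swap_apply_left]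
  refine Equiv.swap_apply_of_ne_of_ne ?_ hcd
  intro h
  apply hab
  apply (Equiv.swap a c).injective
  rw [Equiv.swap_apply_left, ← h]

lemma expect_act_act {z w : Fin k → Fin n} (hzw : ∀ j, z j ≠ w j) {t u : Fin n} (htu : t ≠ u)
    (G : (Fin k → Fin n) → (Fin k → Fin n) → ℝ) :
    𝔼 π, G (act π z) (act π w) = 𝔼 π, G (edge π t) (edge π u) := by
  choose ρ h1 h2 using fun j => exists_perm_pair htu (hzw j)
  rw [← expect_mul_right ρ fun π => G (edge π t) (edge π u)]
  refine expect_congr rfl fun π _ => ?_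
  congr 1 <;> funext j <;> simp [act, edge, h1, h2]

lemma expect_act_both (G : (Fin k → Fin n) → (Fin k → Fin n) → ℝ) :
    𝔼 x, 𝔼 y, 𝔼 π, G (act π x) (act π y) = 𝔼 x, 𝔼 y, G x y := by
  have h : ∀ x, 𝔼 y, 𝔼 π, G (act π x) (act π y) = 𝔼 π, 𝔼 y, G (act π x) y := fun x => by
    rw [expect_comm]
    exact expect_congr rfl fun π _ => expect_act_left π (G (act π x))
  simp only [h]
  rw [expect_comm]
  simp only [expect_act_left _ fun x => 𝔼 y, G x y]
  exact Fintype.expect_const _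

lemma expect_cons {α : Type*} [Fintype α] (g : (Fin (k+1) → α) → ℝ) :
    𝔼 x, g x = 𝔼 a, 𝔼 y, g (Fin.cons a y) := by
  rw [← Fintype.expect_equiv (Fin.consEquiv fun _ => α) (fun p => g (Fin.cons p.1 p.2)) g
    fun _ => rfl, ← univ_product_univ, expect_product]

lemma expect_matching_prod_le (b : Fin n → (Fin k → Fin n) → ℝ) (hb : ∀ t x, 0 < b t x) :
    𝔼 π, ∏ t, b t (edge π t) ≤ ∏ t, Real.sqrt (𝔼 x, b t x ^ 2) := by
  induction k with
  | zero =>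
    rcases Nat.eq_zero_or_pos n with rfl | hn
    · simp
    rw [show (fun π => ∏ t, b t (edge π t)) = fun _ => ∏ t, b t default from
      funext fun π => prod_congr rfl fun t _ => congrArg _ (Subsingleton.elim _ _)]
    rw [Fintype.expect_const]
    refine (prod_congr rfl fun t _ => ?_).le
    rw [show (fun x => b t x ^ 2) = fun _ => b t default ^ 2 from
      funext fun x => congrArg (fun x => b t x ^ 2) (Subsingleton.elim _ _), Fintype.expect_const,
      Real.sqrt_sq (hb _ _).le]
  | succ k ih =>
    rcases Nat.eq_zero_or_pos n with rfl | hn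
    · simp
    have : NeZero n := ⟨hn.ne'⟩
    have hpos : ∀ t v, 0 < 𝔼 x : Fin k → Fin n, b t (Fin.cons v x) ^ 2 := fun t v =>
      expect_pos (fun x _ => pow_pos (hb _ _) 2) univ_nonempty
    calc 𝔼 π, ∏ t, b t (edge π t)
        = 𝔼 σ : Equiv.Perm (Fin n), 𝔼 π, ∏ t, b t (Fin.cons (σ t) (edge π t)) := by
          rw [expect_cons]
          refine expect_congr rfl fun σ _ => expect_congr rfl fun π _ => prod_congr rfl fun t _ => ?_
          congr 1
          funext j
          refine Fin.cases rfl (fun i => rfl) j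
      _ ≤ 𝔼 σ : Equiv.Perm (Fin n), ∏ t, Real.sqrt (𝔼 x, b t (Fin.cons (σ t) x) ^ 2) :=
          expect_le_expect fun σ _ => ih (fun t x => b t (Fin.cons (σ t) x)) fun t x => hb _ _
      _ ≤ ∏ t, Real.sqrt (𝔼 v, Real.sqrt (𝔼 x : Fin k → Fin n, b t (Fin.cons v x) ^ 2) ^ 2) :=
          expect_perm_prod_le (fun t v => Real.sqrt (𝔼 x : Fin k → Fin n, b t (Fin.cons v x) ^ 2))
            fun t v => Real.sqrt_pos.2 (hpos t v)
      _ = _ := by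
          refine prod_congr rfl fun t _ => ?_
          rw [expect_cons]
          simp only [Real.sq_sqrt (hpos _ _).le]

lemma expect_exp_cnt_le [NeZero n] (F : Finset (Fin k → Fin n)) (l : ℝ) :
    𝔼 π, Real.exp (l * cnt F π) ≤ Real.exp (mean F / 2 * (Real.exp (2 * l) - 1)) := by
  have h := expect_matching_prod_le (fun (_ : Fin n) x => Real.exp (l * ind F x))
    fun _ _ => Real.exp_pos _
  have e1 : 𝔼 x, Real.exp (l * ind F x) ^ 2 = 1 + dens F * (Real.exp (2 * l) - 1) := by
    rw [dens, expect_mul, ← Fintype.expect_const (ι := Fin k → Fin n) (1 : ℝ),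
      ← expect_add_distrib]
    refine expect_congr rfl fun x _ => ?_
    rw [Fintype.expect_const, ← Real.exp_nat_mul]
    rcases ind_eq_or F x with h | h <;> rw [h] <;> norm_num
  rw [e1] at h
  calc _ = _ := expect_congr rfl fun π _ => by rw [cnt, mul_sum, Real.exp_sum]
    _ ≤ _ := h
    _ ≤ ∏ t : Fin n, Real.sqrt (Real.exp (dens F * (Real.exp (2 * l) - 1))) := by
        refine prod_le_prod (fun _ _ => Real.sqrt_nonneg _) fun _ _ => Real.sqrt_le_sqrt ?_
        rw [add_comm]
        exact Real.add_one_le_exp _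
    _ = _ := by
        rw [prod_const, card_univ, Fintype.card_fin, ← Real.exp_half, ← Real.exp_nat_mul, mean]
        congr 1
        ring

lemma expect_cnt [NeZero n] (F : Finset (Fin k → Fin n)) : 𝔼 π, cnt F π = mean F := by
  simp only [cnt]
  rw [expect_sum_comm]
  simp only [expect_edge _ (ind F)]
  simp [mean, dens]

end grid

section grid
variable {k n : ℕ}

/-- The indices of the edges of a perfect matching that belong to a family. -/
def hits (F : Finset (Fin k → Fin n)) (π : Fin k → Equiv.Perm (Fin n)) : Finset (Fin n) :=
  univ.filter fun t => edge π t ∈ F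

lemma mem_hits {F : Finset (Fin k → Fin n)} {π : Fin k → Equiv.Perm (Fin n)} {t : Fin n} :
    t ∈ hits F π ↔ edge π t ∈ F := by simp [hits]

lemma ind_hits (F : Finset (Fin k → Fin n)) (π : Fin k → Equiv.Perm (Fin n)) (t : Fin n) :
    ind (hits F π) t = ind F (edge π t) := by
  simp [ind, mem_hits]

lemma cnt_eq_card_hits (F : Finset (Fin k → Fin n)) (π : Fin k → Equiv.Perm (Fin n)) :
    cnt F π = #(hits F π) := by
  rw [← sum_ind]
  simp only [ind_hits, cnt]

/-- The families contain pairwise disjoint representatives. -/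
def Rainbow {r : ℕ} (F : Fin r → Finset (Fin k → Fin n)) : Prop :=
  ∃ g : Fin r → (Fin k → Fin n), (∀ i, g i ∈ F i) ∧ ∀ i i', i ≠ i' → ∀ j, g i j ≠ g i' j

lemma Rainbow.mono {r : ℕ} {F G : Fin r → Finset (Fin k → Fin n)} (h : Rainbow F)
    (hFG : ∀ i, F i ⊆ G i) : Rainbow G :=
  let ⟨g, h1, h2⟩ := h
  ⟨g, fun i => hFG i (h1 i), h2⟩

lemma rainbow_of_injective_hits {r : ℕ} {F : Fin r → Finset (Fin k → Fin n)}
    (π : Fin k → Equiv.Perm (Fin n)) (f : Fin r → Fin n) (hf : Function.Injective f)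
    (h : ∀ i, f i ∈ hits (F i) π) : Rainbow F :=
  ⟨fun i => edge π (f i), fun i => mem_hits.1 (h i), fun _ _ hii j hj =>
    hii (hf ((π j).injective hj))⟩

end grid

/-- A quantitative Hall-type dichotomy for sets of nearly prescribed sizes. -/
lemma hall_dichotomy {n r : ℕ} (N : Fin r → Finset (Fin n))
    (hN : ¬ ∃ f : Fin r → Fin n, Function.Injective f ∧ ∀ i, f i ∈ N i)
    (I : Finset (Fin r)) {d : ℝ} (hI : 2 * d + 4 ≤ #I)
    (h1 : ∀ i ∉ I, ((i : ℕ) : ℝ) + 1 ≤ #(N i))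
    (h2 : ∀ i ∈ I, (r : ℝ) - 1 - d ≤ #(N i)) (h3 : ∀ i ∈ I, (#(N i) : ℝ) ≤ r + 1 + d) :
    1 ≤ ∑ i ∈ I, ((r : ℝ) - 1 - #(N i)) ∨
      ((∀ i, (#(N i) : ℝ) ≤ r - 1) ∧ ∃ U : Finset (Fin n), (#U : ℝ) ≤ r - 1 ∧ ∀ i, N i ⊆ U) := by
  classical
  rw [← all_card_le_biUnion_card_iff_exists_injective] at hN
  push Not at hN
  obtain ⟨J, hJ⟩ := hN
  have hJ' : (#(J.biUnion N) : ℝ) + 1 ≤ #J := by exact_mod_cast hJ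
  have hsub : ∀ i ∈ J, (#(N i) : ℝ) ≤ #(J.biUnion N) := fun i hi => by
    exact_mod_cast card_le_card (subset_biUnion_of_mem N hi)
  have hJne : J.Nonempty := card_pos.1 (by omega)
  set i0 := J.max' hJne
  have hi0 : i0 ∈ J := max'_mem _ _
  have hJcard : (#J : ℝ) ≤ (i0 : ℕ) + 1 := by
    have : J ⊆ Finset.Iic i0 := fun i hi => mem_Iic.2 (le_max' _ _ hi)
    have := card_le_card this
    rw [Fin.card_Iic] at this
    exact_mod_cast this
  have hi0I : i0 ∈ I := by
    by_contra h
    have := h1 _ h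
    have := hsub _ hi0
    linarith
  have had : (r : ℝ) - #J ≤ d := by
    have := h2 _ hi0I
    have := hsub _ hi0
    linarith
  have hJr : #J ≤ r := by simpa using card_le_univ J
  rcases hJr.eq_or_lt with heq | hlt
  · right
    have hJu : J = univ := by rw [← card_eq_iff_eq_univ]; simpa using heq
    have hc : (#(J.biUnion N) : ℝ) ≤ r - 1 := by
      have : (#J : ℝ) = r := by exact_mod_cast heq
      linarith
    exact ⟨fun i => (hsub i (hJu ▸ mem_univ i)).trans hc, J.biUnion N, hc,
      fun i => subset_biUnion_of_mem N (hJu ▸ mem_univ i)⟩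
  · left
    have ha : (1 : ℝ) ≤ r - #J := by
      have : (#J : ℝ) + 1 ≤ r := by exact_mod_cast hlt
      linarith
    set a : ℝ := r - #J with haDef
    have hIJ : (#(I \ J) : ℝ) ≤ a := by
      have : #(I \ J) ≤ #(univ \ J) := card_le_card (sdiff_subset_sdiff (subset_univ _) le_rfl)
      rw [card_sdiff_of_subset (subset_univ _), card_univ, Fintype.card_fin] at this
      have h' : #(I \ J) + #J ≤ r := by omega
      have : (#(I \ J) : ℝ) + #J ≤ r := by exact_mod_cast h'
      linarith
    have hsplit : (#(I \ J) : ℝ) + #(I ∩ J) = #I := by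
      exact_mod_cast card_sdiff_add_card_inter I J
    have hs1 : (#(I ∩ J) : ℝ) * a ≤ ∑ i ∈ I ∩ J, ((r : ℝ) - 1 - #(N i)) := by
      rw [← nsmul_eq_mul]
      refine card_nsmul_le_sum _ _ _ fun i hi => ?_
      have := hsub i (mem_inter.1 hi).2
      linarith
    have hs2 : (#(I \ J) : ℝ) * (-2 - d) ≤ ∑ i ∈ I \ J, ((r : ℝ) - 1 - #(N i)) := by
      rw [← nsmul_eq_mul]
      refine card_nsmul_le_sum _ _ _ fun i hi => ?_
      have := h3 i (mem_sdiff.1 hi).1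
      linarith
    have hs : ∑ i ∈ I, ((r : ℝ) - 1 - #(N i)) =
        ∑ i ∈ I \ J, ((r : ℝ) - 1 - #(N i)) + ∑ i ∈ I ∩ J, ((r : ℝ) - 1 - #(N i)) := by
      rw [← sum_union (disjoint_sdiff_inter I J), sdiff_union_inter]
    rw [hs]
    have hd : 1 ≤ d := ha.trans had
    nlinarith [mul_nonneg (sub_nonneg.2 hIJ) (by linarith : 0 ≤ 2 + d + a),
      mul_nonneg (by linarith : 0 ≤ a) (sub_nonneg.2 had),
      mul_nonneg (by linarith : 0 ≤ a) (sub_nonneg.2 hI)]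

lemma exp_le_quadratic {x : ℝ} (h0 : 0 ≤ x) (h1 : x ≤ 1 / 10) :
    Real.exp x ≤ 1 + x + x ^ 2 / 2 * (1 + x) := by
  have := Real.exp_bound' h0 (by linarith : x ≤ 1) (n := 3) (by norm_num)
  norm_num [sum_range_succ, Nat.factorial] at this
  nlinarith [pow_nonneg h0 3]

lemma exp_neg_le_quadratic {x : ℝ} (h0 : 0 ≤ x) :
    Real.exp (-x) ≤ 1 - x + x ^ 2 / 2 := by
  have h1 : 1 + x + x ^ 2 / 2 ≤ Real.exp x := Real.quadratic_le_exp_of_nonneg h0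
  rw [Real.exp_neg, inv_le_comm₀ (Real.exp_pos _) (by nlinarith [sq_nonneg (x-1)])]
  refine le_trans ?_ h1
  rw [inv_le_iff_one_le_mul₀ (by nlinarith [sq_nonneg (x-1)])]
  nlinarith [sq_nonneg (x ^ 2)]

section tails
variable {k n : ℕ} [NeZero n]

/-- The numerical assumptions on `s` and the deviation `d` used throughout. -/
structure Params (s : ℕ) (d : ℝ) : Prop where
  le_s : (10 : ℝ) ^ 8 ≤ s
  le_d : 10 ≤ d
  d_le : d ≤ s / 10
  log_le : 400 / 9 * (s * Real.log s) ≤ d ^ 2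

variable {s : ℕ} {d : ℝ}

lemma Params.s_pos (h : Params s d) : (0 : ℝ) < s := lt_of_lt_of_le (by norm_num) h.le_s

lemma exp_neg_mul_log {x : ℝ} (hx : 0 < x) (m : ℕ) : Real.exp (-(m * Real.log x)) = (x ^ m)⁻¹ := by
  rw [Real.exp_neg, Real.exp_nat_mul, Real.exp_log hx]

lemma Params.exp_le (h : Params s d) {x : ℝ} (hx : x ≤ -(9 / 40 * d ^ 2 / s)) :
    Real.exp x ≤ ((s : ℝ) ^ 10)⁻¹ := by
  rw [← exp_neg_mul_log h.s_pos, Real.exp_le_exp]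
  refine hx.trans (neg_le_neg ?_)
  rw [le_div_iff₀ h.s_pos]
  have := h.log_le
  push_cast
  nlinarith

lemma Params.exp_neg_le (h : Params s d) : Real.exp (-s) ≤ ((s : ℝ) ^ 10)⁻¹ := by
  refine h.exp_le (neg_le_neg ?_)
  have := h.s_pos
  rw [div_le_iff₀ this]
  nlinarith [h.d_le, h.le_d]

lemma Params.upper_tail (h : Params s d) (F : Finset (Fin k → Fin n)) (hF : mean F ≤ s) :
    𝔼 π, Real.exp (d / (2 * s) * (cnt F π - mean F - d)) ≤ ((s : ℝ) ^ 10)⁻¹ := by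
  have hs := h.s_pos
  have hd := h.le_d
  set x := d / s with hx
  have hx0 : 0 ≤ x := by positivity
  have hx1 : x ≤ 1 / 10 := by rw [hx, div_le_iff₀ hs]; linarith [h.d_le]
  have hl : d / (2 * s) = x / 2 := by rw [hx]; field_simp
  have hdx : d = x * s := by rw [hx]; field_simp
  have e : ∀ π, Real.exp (d / (2 * s) * (cnt F π - mean F - d)) =
      Real.exp (x / 2 * cnt F π) * Real.exp (-(x / 2) * (mean F + d)) := fun π => by
    rw [← Real.exp_add, hl]; congr 1; ring
  simp only [e]
  rw [← expect_mul]
  refine (mul_le_mul_of_nonneg_right (expect_exp_cnt_le F (x / 2)) (Real.exp_pos _).le).trans ?_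
  rw [← Real.exp_add]
  refine h.exp_le ?_
  have h2 := exp_le_quadratic hx0 hx1
  rw [show 2 * (x / 2) = x by ring]
  have h0 := mean_nonneg F
  have e3 : 9 / 40 * d ^ 2 / s = 9 / 40 * x ^ 2 * s := by rw [hdx]; field_simp
  rw [e3, hdx]
  have h4 : mean F / 2 * (Real.exp x - 1 - x) ≤ mean F / 2 * (x ^ 2 / 2 * (11 / 10)) := by
    refine mul_le_mul_of_nonneg_left ?_ (by linarith)
    nlinarith [sq_nonneg x]
  nlinarith [mul_le_mul_of_nonneg_right hF (sq_nonneg x)]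

lemma Params.lower_tail (h : Params s d) (F : Finset (Fin k → Fin n)) (hF : mean F ≤ s) :
    𝔼 π, Real.exp (-(d / (2 * s)) * (cnt F π - mean F + d)) ≤ ((s : ℝ) ^ 10)⁻¹ := by
  have hs := h.s_pos
  have hd := h.le_d
  set x := d / s with hx
  have hx0 : 0 ≤ x := by positivity
  have hl : d / (2 * s) = x / 2 := by rw [hx]; field_simp
  have hdx : d = x * s := by rw [hx]; field_simp
  have e : ∀ π, Real.exp (-(d / (2 * s)) * (cnt F π - mean F + d)) =
      Real.exp (-(x / 2) * cnt F π) * Real.exp ((x / 2) * (mean F - d)) := fun π => by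
    rw [← Real.exp_add, hl]; congr 1; ring
  simp only [e]
  rw [← expect_mul]
  refine (mul_le_mul_of_nonneg_right (expect_exp_cnt_le F (-(x / 2))) (Real.exp_pos _).le).trans ?_
  rw [← Real.exp_add]
  refine h.exp_le ?_
  have h2 := exp_neg_le_quadratic hx0
  rw [show 2 * -(x / 2) = -x by ring]
  have h0 := mean_nonneg F
  have e3 : 9 / 40 * d ^ 2 / s = 9 / 40 * x ^ 2 * s := by rw [hdx]; field_simp
  rw [e3, hdx]
  have h4 : mean F / 2 * (Real.exp (-x) - 1 + x) ≤ mean F / 2 * (x ^ 2 / 2) := by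
    refine mul_le_mul_of_nonneg_left ?_ (by linarith)
    linarith
  nlinarith [mul_le_mul_of_nonneg_right hF (sq_nonneg x)]

lemma Params.far_tail (h : Params s d) (F : Finset (Fin k → Fin n)) (hF : mean F ≤ s) :
    𝔼 π, Real.exp (1 / 2 * (cnt F π - 4 * s)) ≤ ((s : ℝ) ^ 10)⁻¹ := by
  have e : ∀ π, Real.exp (1 / 2 * (cnt F π - 4 * s)) =
      Real.exp (1 / 2 * cnt F π) * Real.exp (-2 * s) := fun π => by
    rw [← Real.exp_add]; congr 1; ring
  simp only [e]
  rw [← expect_mul]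
  refine (mul_le_mul_of_nonneg_right (expect_exp_cnt_le F (1 / 2)) (Real.exp_pos _).le).trans ?_
  rw [← Real.exp_add]
  refine le_trans (Real.exp_le_exp.2 ?_) h.exp_neg_le
  have h1 : Real.exp (2 * (1 / 2)) - 1 ≤ 2 := by
    rw [show (2 : ℝ) * (1 / 2) = 1 by norm_num]
    linarith [Real.exp_one_lt_d9]
  have := mul_le_mul_of_nonneg_left h1 (by linarith [mean_nonneg F] : 0 ≤ mean F / 2)
  linarith

/-- A nonnegative function of small mean that controls all large deviations of the counts. -/
lemma Params.exists_tail (h : Params s d) {r : ℕ} (hr : r ≤ s)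
    (F : Fin r → Finset (Fin k → Fin n)) (hF : ∀ i, mean (F i) ≤ s) :
    ∃ W : (Fin k → Equiv.Perm (Fin n)) → ℝ, 𝔼 π, W π ≤ 3 / (s : ℝ) ^ 9 ∧ (∀ π, 0 ≤ W π) ∧
      ∀ π, (∀ i, |cnt (F i) π - mean (F i)| < d) ∨
        (1 ≤ W π ∧ ∀ i, cnt (F i) π ≤ 4 * s * W π ∧ cnt (F i) π ^ 2 ≤ 16 * s ^ 2 * W π) := by
  have hs := h.s_pos
  have hs1 : (1 : ℝ) ≤ s := le_trans (by norm_num) h.le_s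
  have hd := h.le_d
  set T : Fin r → (Fin k → Equiv.Perm (Fin n)) → ℝ := fun i π =>
    Real.exp (d / (2 * s) * (cnt (F i) π - mean (F i) - d)) +
      Real.exp (-(d / (2 * s)) * (cnt (F i) π - mean (F i) + d)) +
      Real.exp (1 / 2 * (cnt (F i) π - 4 * s)) with hT
  have hT0 : ∀ i π, 0 ≤ T i π := fun i π => by simp only [hT]; positivity
  refine ⟨fun π => ∑ i, T i π, ?_, fun π => sum_nonneg fun i _ => hT0 i π, fun π => ?_⟩
  · rw [expect_sum_comm]
    calc _ ≤ ∑ i : Fin r, 3 * ((s : ℝ) ^ 10)⁻¹ := by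
          refine sum_le_sum fun i _ => ?_
          simp only [hT]
          rw [expect_add_distrib, expect_add_distrib]
          linarith [h.upper_tail (F i) (hF i), h.lower_tail (F i) (hF i), h.far_tail (F i) (hF i)]
      _ = r * (3 * ((s : ℝ) ^ 10)⁻¹) := by simp
      _ ≤ s * (3 * ((s : ℝ) ^ 10)⁻¹) := by gcongr
      _ = _ := by field_simp
  · by_cases hg : ∀ i, |cnt (F i) π - mean (F i)| < d
    · exact Or.inl hg
    right
    have hTW : ∀ i, T i π ≤ ∑ i, T i π := fun i =>
      single_le_sum (f := fun i => T i π) (fun i _ => hT0 i π) (mem_univ i)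
    have hW1 : 1 ≤ ∑ i, T i π := by
      push Not at hg
      obtain ⟨i, hi⟩ := hg
      refine le_trans ?_ (hTW i)
      have p1 := Real.exp_pos (d / (2 * s) * (cnt (F i) π - mean (F i) - d))
      have p2 := Real.exp_pos (-(d / (2 * s)) * (cnt (F i) π - mean (F i) + d))
      have p3 := Real.exp_pos (1 / 2 * (cnt (F i) π - 4 * s))
      rcases le_abs'.1 hi with h1 | h1
      · have := Real.one_le_exp (x := -(d / (2 * s)) * (cnt (F i) π - mean (F i) + d)) (by
          rw [neg_mul, ← mul_neg]
          exact mul_nonneg (by positivity) (by linarith))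
        simp only [hT]; linarith
      · have := Real.one_le_exp (x := d / (2 * s) * (cnt (F i) π - mean (F i) - d))
          (mul_nonneg (by positivity) (by linarith))
        simp only [hT]; linarith
    refine ⟨hW1, fun i => ?_⟩
    have hc := cnt_nonneg (F i) π
    by_cases hle : cnt (F i) π ≤ 4 * s
    · constructor <;> nlinarith
    · set u := cnt (F i) π - 4 * s with hu
      have hu0 : 0 ≤ u := by linarith
      have hcu : cnt (F i) π = 4 * s + u := by linarith
      have hE : Real.exp (1 / 4 * u) ^ 2 ≤ ∑ i, T i π := by
        refine le_trans ?_ (hTW i)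
        have p1 := Real.exp_pos (d / (2 * s) * (cnt (F i) π - mean (F i) - d))
        have p2 := Real.exp_pos (-(d / (2 * s)) * (cnt (F i) π - mean (F i) + d))
        rw [← Real.exp_nat_mul]
        simp only [hT]
        rw [show ((2 : ℕ) : ℝ) * (1 / 4 * u) = 1 / 2 * u by push_cast; ring]
        linarith
      have hE1 : 1 + 1 / 4 * u ≤ Real.exp (1 / 4 * u) := by
        linarith [Real.add_one_le_exp (1 / 4 * u)]
      have hW : (1 + 1 / 4 * u) ^ 2 ≤ ∑ i, T i π := le_trans (by gcongr) hE
      have hsu : 4 * s + u ≤ 4 * s * (1 + 1 / 4 * u) := by nlinarith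
      rw [hcu]
      constructor
      · calc _ ≤ 4 * s * (1 + 1 / 4 * u) := hsu
          _ ≤ 4 * s * (1 + 1 / 4 * u) ^ 2 := by
            refine mul_le_mul_of_nonneg_left ?_ (by positivity)
            nlinarith
          _ ≤ _ := by gcongr
      · calc _ ≤ (4 * s * (1 + 1 / 4 * u)) ^ 2 := by gcongr
          _ = 16 * s ^ 2 * (1 + 1 / 4 * u) ^ 2 := by ring
          _ ≤ _ := by gcongr

end tails

section
variable {k n s : ℕ} {d : ℝ}

lemma sum_sub_cnt_nonneg {r : ℕ} (hr : r ≤ s) {F : Fin r → Finset (Fin k → Fin n)}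
    {I : Finset (Fin r)} (hI : I.Nonempty) {π : Fin k → Equiv.Perm (Fin n)} {w : ℝ} (hw : 0 ≤ w)
    (hπ : (1 ≤ ∑ i ∈ I, ((r : ℝ) - 1 - cnt (F i) π) ∨ (∀ i, cnt (F i) π ≤ r - 1)) ∨
      ∀ i, cnt (F i) π ≤ 4 * s * w) :
    0 ≤ ∑ i ∈ I, ((r : ℝ) - 1 - cnt (F i) π) + 4 * s ^ 2 * w := by
  have h0 : 0 ≤ 4 * (s : ℝ) ^ 2 * w := by positivity
  rcases hπ with (h | h) | h
  · linarith
  · have : 0 ≤ ∑ i ∈ I, ((r : ℝ) - 1 - cnt (F i) π) :=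
      sum_nonneg fun i _ => sub_nonneg.2 (h i)
    linarith
  · obtain ⟨i0, -⟩ := hI
    have hr1 : (1 : ℝ) ≤ r := by exact_mod_cast (Nat.zero_lt_of_lt i0.2)
    have h1 : (#I : ℝ) * (-(4 * s * w)) ≤ ∑ i ∈ I, ((r : ℝ) - 1 - cnt (F i) π) := by
      rw [← nsmul_eq_mul]
      refine card_nsmul_le_sum _ _ _ fun i _ => ?_
      linarith [h i]
    have h2 : (#I : ℝ) ≤ s := by
      have : #I ≤ r := by simpa using card_le_univ I
      exact_mod_cast this.trans hr
    have h3 : (#I : ℝ) * (4 * s * w) ≤ s * (4 * s * w) := by gcongr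
    nlinarith

variable [NeZero n]

lemma mean_mul_pow (hk : 1 ≤ k) (F : Finset (Fin k → Fin n)) :
    mean F * (n : ℝ) ^ (k - 1) = #F := by
  have hn : (n : ℝ) ≠ 0 := by exact_mod_cast NeZero.ne n
  obtain ⟨k, rfl⟩ := Nat.exists_eq_add_of_le' hk
  rw [mean, dens_eq]
  simp only [Fintype.card_pi, Fintype.card_fin, prod_const, card_univ]
  push_cast
  rw [pow_succ]
  field_simp

lemma mean_le_iff (hk : 1 ≤ k) (F : Finset (Fin k → Fin n)) {c : ℝ} :
    mean F ≤ c ↔ (#F : ℝ) ≤ c * (n : ℝ) ^ (k - 1) := by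
  have hn : (0 : ℝ) < n := by exact_mod_cast Nat.pos_of_ne_zero (NeZero.ne n)
  rw [← mean_mul_pow hk, mul_le_mul_iff_left₀ (by positivity)]

lemma le_mean_iff (hk : 1 ≤ k) (F : Finset (Fin k → Fin n)) {c : ℝ} :
    c ≤ mean F ↔ c * (n : ℝ) ^ (k - 1) ≤ #F := by
  have hn : (0 : ℝ) < n := by exact_mod_cast Nat.pos_of_ne_zero (NeZero.ne n)
  rw [← mean_mul_pow hk, mul_le_mul_iff_left₀ (by positivity)]

lemma lt_mean_iff (hk : 1 ≤ k) (F : Finset (Fin k → Fin n)) {c : ℝ} :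
    c < mean F ↔ c * (n : ℝ) ^ (k - 1) < #F := by
  have hn : (0 : ℝ) < n := by exact_mod_cast Nat.pos_of_ne_zero (NeZero.ne n)
  rw [← mean_mul_pow hk, mul_lt_mul_iff_left₀ (by positivity)]

lemma exists_subset_mean (hk : 1 ≤ k) (F : Finset (Fin k → Fin n)) {c : ℝ} (hc : 0 ≤ c)
    (hF : c ≤ mean F) : ∃ G ⊆ F, c ≤ mean G ∧ mean G ≤ c + 1 := by
  have hn : (1 : ℝ) ≤ n := by exact_mod_cast Nat.pos_of_ne_zero (NeZero.ne n)
  rw [le_mean_iff hk] at hF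
  obtain ⟨G, hG, hGc⟩ := exists_subset_card_eq (Nat.ceil_le.2 hF)
  refine ⟨G, hG, ?_, ?_⟩
  · rw [le_mean_iff hk, hGc]; exact Nat.le_ceil _
  · rw [mean_le_iff hk, hGc, add_mul, one_mul]
    exact (Nat.ceil_lt_add_one (by positivity)).le.trans (by gcongr; exact one_le_pow₀ hn)

lemma Params.core (h : Params s d) {r : ℕ} (hr : r ≤ s)
    (F : Fin r → Finset (Fin k → Fin n)) (hF : ¬ Rainbow F) (I : Finset (Fin r))
    (hI : 2 * d + 4 ≤ #I) (hs : ∀ i, mean (F i) ≤ s)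
    (h1 : ∀ i ∉ I, ((i : ℕ) : ℝ) + 1 + d ≤ mean (F i))
    (h2 : ∀ i ∈ I, (r : ℝ) - 1 ≤ mean (F i)) (h3 : ∀ i ∈ I, mean (F i) ≤ r + 1) :
    ∃ W : (Fin k → Equiv.Perm (Fin n)) → ℝ, 𝔼 π, W π ≤ 3 / (s : ℝ) ^ 9 ∧ (∀ π, 0 ≤ W π) ∧
      ∀ π, ((∀ i, |cnt (F i) π - mean (F i)| < d) ∧
          (1 ≤ ∑ i ∈ I, ((r : ℝ) - 1 - cnt (F i) π) ∨ ((∀ i, cnt (F i) π ≤ r - 1) ∧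
            ∃ U : Finset (Fin n), (#U : ℝ) ≤ r - 1 ∧ ∀ i, hits (F i) π ⊆ U))) ∨
        (1 ≤ W π ∧ ∀ i, cnt (F i) π ≤ 4 * s * W π ∧ cnt (F i) π ^ 2 ≤ 16 * s ^ 2 * W π) := by
  obtain ⟨W, hW, hW0, hWt⟩ := h.exists_tail hr F hs
  refine ⟨W, hW, hW0, fun π => ?_⟩
  rcases hWt π with hg | hb
  · refine Or.inl ⟨hg, ?_⟩
    have hg' : ∀ i, -d < (#(hits (F i) π) : ℝ) - mean (F i) ∧
        (#(hits (F i) π) : ℝ) - mean (F i) < d := fun i => by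
      rw [← cnt_eq_card_hits]; exact abs_lt.1 (hg i)
    simp only [cnt_eq_card_hits]
    refine hall_dichotomy (fun i => hits (F i) π) ?_ I hI ?_ ?_ ?_
    · rintro ⟨f, hf, hfm⟩
      exact hF (rainbow_of_injective_hits π f hf hfm)
    · intro i hi; linarith [h1 i hi, hg' i]
    · intro i hi; linarith [h2 i hi, hg' i]
    · intro i hi; linarith [h3 i hi, hg' i]
  · exact Or.inr hb

lemma expect_sum_sub_cnt {r : ℕ} (F : Fin r → Finset (Fin k → Fin n)) (I : Finset (Fin r)) :
    𝔼 π, ∑ i ∈ I, ((r : ℝ) - 1 - cnt (F i) π) = ∑ i ∈ I, ((r : ℝ) - 1 - mean (F i)) := by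
  rw [expect_sum_comm]
  refine sum_congr rfl fun i _ => ?_
  rw [expect_sub_distrib, expect_cnt, Fintype.expect_const]

lemma Params.rainbow_of_slack_aux (h : Params s d) {r : ℕ} (hr : r + 1 = s)
    (F : Fin r → Finset (Fin k → Fin n)) (I : Finset (Fin r))
    (hI : 2 * d + 4 ≤ #I) (hs : ∀ i, mean (F i) ≤ s)
    (h1 : ∀ i ∉ I, ((i : ℕ) : ℝ) + 1 + d ≤ mean (F i))
    (h2 : ∀ i ∈ I, (r : ℝ) - 1 / 2 ≤ mean (F i)) (h3 : ∀ i ∈ I, mean (F i) ≤ r + 1) :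
    Rainbow F := by
  by_contra hF
  have hs1 := h.le_s
  have hs0 := h.s_pos
  obtain ⟨W, hW, hW0, hWt⟩ := h.core (by omega) F hF I hI hs h1
    (fun i hi => by linarith [h2 i hi]) h3
  have hIne : I.Nonempty := by
    rw [← card_pos]
    have : (0 : ℝ) < #I := by linarith [h.le_d]
    exact_mod_cast this
  have hpt : ∀ π, 0 ≤ ∑ i ∈ I, ((r : ℝ) - 1 - cnt (F i) π) + 4 * s ^ 2 * W π := fun π => by
    refine sum_sub_cnt_nonneg (by omega) hIne (hW0 π) ?_
    rcases hWt π with ⟨-, hg | hg⟩ | hb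
    · exact Or.inl (Or.inl hg)
    · exact Or.inl (Or.inr hg.1)
    · exact Or.inr fun i => (hb.2 i).1
  have hE : 0 ≤ 𝔼 π, (∑ i ∈ I, ((r : ℝ) - 1 - cnt (F i) π) + 4 * s ^ 2 * W π) :=
    expect_nonneg fun π _ => hpt π
  rw [expect_add_distrib, expect_sum_sub_cnt, ← mul_expect] at hE
  have hsum : ∑ i ∈ I, ((r : ℝ) - 1 - mean (F i)) ≤ #I * (-1 / 2) := by
    rw [← nsmul_eq_mul]
    refine sum_le_card_nsmul _ _ _ fun i hi => ?_
    linarith [h2 i hi]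
  have hsmall : 4 * (s : ℝ) ^ 2 * 𝔼 π, W π ≤ 1 := by
    calc _ ≤ 4 * (s : ℝ) ^ 2 * (3 / (s : ℝ) ^ 9) := by gcongr
      _ = 12 / (s : ℝ) ^ 7 := by field_simp; norm_num
      _ ≤ 1 := by
        rw [div_le_one (by positivity)]
        calc (12 : ℝ) ≤ (10 ^ 8) ^ 7 := by norm_num
          _ ≤ _ := by gcongr
  linarith [h.le_d]

/-- Families with a uniform surplus contain a rainbow matching. -/
lemma Params.rainbow_of_slack (h : Params s d) {r : ℕ} (hr : r + 1 = s) (hk : 1 ≤ k)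
    (F : Fin r → Finset (Fin k → Fin n)) (I : Finset (Fin r))
    (hI : 2 * d + 4 ≤ #I)
    (h0 : ∀ i ∉ I, ((i : ℕ) : ℝ) + 1 + d ≤ r)
    (h1 : ∀ i ∉ I, ((i : ℕ) : ℝ) + 1 + d ≤ mean (F i))
    (h2 : ∀ i ∈ I, (r : ℝ) - 1 / 2 ≤ mean (F i)) :
    Rainbow F := by
  classical
  have hd := h.le_d
  have hrs : (r : ℝ) + 1 = s := by exact_mod_cast hr
  have hr1 : (1 : ℝ) ≤ r := by linarith [h.le_s]
  choose G hGF hG1 hG2 using fun i => exists_subset_mean hk (F i)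
    (c := if i ∈ I then (r : ℝ) - 1 / 2 else ((i : ℕ) : ℝ) + 1 + d)
    (by split_ifs <;> [linarith; positivity])
    (by split_ifs with hi <;> [exact h2 i hi; exact h1 i hi])
  refine Rainbow.mono ?_ hGF
  refine h.rainbow_of_slack_aux hr G I hI (fun i => ?_) (fun i hi => ?_) (fun i hi => ?_)
    (fun i hi => ?_)
  · have := hG2 i
    split_ifs at this with hi
    · linarith
    · linarith [h0 i hi]
  · have := hG1 i
    rwa [if_neg hi] at this
  · have := hG1 i
    rwa [if_pos hi] at this
  · have := hG2 i
    rw [if_pos hi] at this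
    linarith

end

section
variable {k n : ℕ} {s : ℕ} {d : ℝ}

lemma hits_sdiff (F G : Finset (Fin k → Fin n)) (π : Fin k → Equiv.Perm (Fin n)) :
    hits (F \ G) π = hits F π \ hits G π := by
  ext t; simp [mem_hits]

lemma mean_sdiff_of_card_eq [NeZero n] {F G : Finset (Fin k → Fin n)}
    (h : #F = #G) : mean (F \ G) = mean (G \ F) := by
  rw [mean, mean, dens_eq, dens_eq]
  congr 3
  have h1 := card_sdiff_add_card_inter F G
  have h2 := card_sdiff_add_card_inter G F
  rw [inter_comm] at h2
  omega

variable [NeZero n]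

/-- Cross-dependent families just above the threshold have a concentrated last count and nearly
coincide. -/
lemma Params.concentration (h : Params s d) (F : Fin s → Finset (Fin k → Fin n))
    (hF : ¬ Rainbow F) (I : Finset (Fin s)) (hI : 2 * d + 4 ≤ #I) (hs : ∀ i, mean (F i) ≤ s)
    (h1 : ∀ i ∉ I, ((i : ℕ) : ℝ) + 1 + d ≤ mean (F i))
    (h2 : ∀ i ∈ I, (s : ℝ) - 1 ≤ mean (F i)) {l : Fin s} (hl : l ∈ I) :
    𝔼 π, (cnt (F l) π - (s - 1)) ^ 2 ≤ 13 / (s : ℝ) ^ 5 ∧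
      ∀ i, mean (F i \ F l) ≤ 36 / (s : ℝ) ^ 6 := by
  have hs1 := h.le_s
  have hs0 := h.s_pos
  have hd := h.le_d
  have hds := h.d_le
  obtain ⟨W, hW, hW0, hWt⟩ := h.core le_rfl F hF I hI hs h1 h2
    (fun i _ => by linarith [hs i])
  set Y : (Fin k → Equiv.Perm (Fin n)) → ℝ := fun π => ∑ i ∈ I, ((s : ℝ) - 1 - cnt (F i) π)
    with hY
  have hpt : ∀ π, 0 ≤ Y π + 4 * s ^ 2 * W π := fun π => by
    refine sum_sub_cnt_nonneg le_rfl ⟨l, hl⟩ (hW0 π) ?_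
    rcases hWt π with ⟨-, hg | hg⟩ | hb
    · exact Or.inl (Or.inl hg)
    · exact Or.inl (Or.inr hg.1)
    · exact Or.inr fun i => (hb.2 i).1
  have hE : 𝔼 π, (Y π + 4 * s ^ 2 * W π) ≤ 12 / (s : ℝ) ^ 7 := by
    rw [expect_add_distrib, expect_sum_sub_cnt, ← mul_expect]
    have : ∑ i ∈ I, ((s : ℝ) - 1 - mean (F i)) ≤ 0 := sum_nonpos fun i hi => by
      linarith [h2 i hi]
    calc _ ≤ 0 + 4 * (s : ℝ) ^ 2 * (3 / (s : ℝ) ^ 9) := by gcongr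
      _ = _ := by field_simp; norm_num
  have hYl : ∀ π, (∀ i, cnt (F i) π ≤ s - 1) → (s : ℝ) - 1 - cnt (F l) π ≤ Y π := fun π hg =>
    single_le_sum (f := fun i => (s : ℝ) - 1 - cnt (F i) π)
      (fun i _ => sub_nonneg.2 (hg i)) hl
  have hlow := h2 l hl
  have hup := hs l
  constructor
  · have hp : ∀ π, (cnt (F l) π - (s - 1)) ^ 2 ≤
        s ^ 2 * (Y π + 4 * s ^ 2 * W π) + 17 * s ^ 2 * W π := fun π => by
      have hw := hW0 π
      have hsw : 0 ≤ (s : ℝ) ^ 2 * W π := by positivity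
      have hssw : 0 ≤ (s : ℝ) ^ 2 * (s ^ 2 * W π) := by positivity
      rcases hWt π with ⟨hc, hg | hg⟩ | hb
      · have hg' : 1 ≤ Y π := hg
        have hc := abs_lt.1 (hc l)
        have : (cnt (F l) π - (s - 1)) ^ 2 ≤ (s : ℝ) ^ 2 := by
          apply sq_le_sq'
          · linarith
          · linarith
        nlinarith [mul_le_mul_of_nonneg_left hg' (sq_nonneg (s : ℝ))]
      · have hc := abs_lt.1 (hc l)
        have h3 := hYl π hg.1
        have h4 := hg.1 l
        have h5 : ((s : ℝ) - 1 - cnt (F l) π) ^ 2 ≤ s * ((s : ℝ) - 1 - cnt (F l) π) := by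
          rw [sq]
          exact mul_le_mul_of_nonneg_right (by linarith) (by linarith)
        have h6 : (s : ℝ) * ((s : ℝ) - 1 - cnt (F l) π) ≤ s * Y π := by gcongr
        have h7 : (s : ℝ) * Y π ≤ s ^ 2 * Y π := by
          have : 0 ≤ Y π := by linarith
          rw [sq, mul_assoc]
          exact le_mul_of_one_le_left (by positivity) (by linarith)
        nlinarith
      · have h3 := (hb.2 l).2
        have h4 := cnt_nonneg (F l) π
        have h5 := mul_nonneg (sq_nonneg (s : ℝ)) (hpt π)
        nlinarith [mul_le_mul_of_nonneg_left hb.1 (sq_nonneg (s : ℝ))]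
    calc _ ≤ 𝔼 π, (s ^ 2 * (Y π + 4 * s ^ 2 * W π) + 17 * s ^ 2 * W π) :=
          expect_le_expect fun π _ => hp π
      _ ≤ s ^ 2 * (12 / (s : ℝ) ^ 7) + 17 * s ^ 2 * (3 / (s : ℝ) ^ 9) := by
          rw [expect_add_distrib, ← mul_expect, ← mul_expect]
          gcongr
      _ = 12 / (s : ℝ) ^ 5 + 51 / s ^ 2 / (s : ℝ) ^ 5 := by field_simp; norm_num
      _ ≤ 12 / (s : ℝ) ^ 5 + 1 / (s : ℝ) ^ 5 := by
          gcongr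
          rw [div_le_one (by positivity)]
          nlinarith
      _ = _ := by ring
  · intro i
    rw [← expect_cnt]
    have hp : ∀ π, cnt (F i \ F l) π ≤ 2 * s * (Y π + 4 * s ^ 2 * W π) + 4 * s * W π :=
        fun π => by
      have hw := hW0 π
      have hsw : 0 ≤ (s : ℝ) * W π := by positivity
      have hssw : 0 ≤ (s : ℝ) * (s ^ 2 * W π) := by positivity
      have hle : cnt (F i \ F l) π ≤ cnt (F i) π := by
        rw [cnt_eq_card_hits, cnt_eq_card_hits, hits_sdiff]
        exact_mod_cast card_le_card sdiff_subset
      rcases hWt π with ⟨hc, hg | ⟨hg, U, hU, hUs⟩⟩ | hb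
      · have hg' : 1 ≤ Y π := hg
        have hc := abs_lt.1 (hc i)
        have := hs i
        nlinarith [mul_le_mul_of_nonneg_left hg' hs0.le]
      · have h3 := hYl π hg
        have h4 : cnt (F i \ F l) π + cnt (F l) π ≤ s - 1 := by
          refine le_trans ?_ hU
          rw [cnt_eq_card_hits, cnt_eq_card_hits, hits_sdiff]
          have : #(hits (F i) π \ hits (F l) π) + #(hits (F l) π) ≤ #U := by
            rw [← card_union_of_disjoint sdiff_disjoint, sdiff_union_self_eq_union]
            exact card_le_card (union_subset (hUs i) (hUs l))
          exact_mod_cast this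
        have h5 := hg l
        have h7 : Y π ≤ 2 * s * Y π :=
          le_mul_of_one_le_left (by linarith) (by linarith)
        nlinarith
      · have h3 := (hb.2 i).1
        have h5 := mul_nonneg hs0.le (hpt π)
        nlinarith
    calc _ ≤ 𝔼 π, (2 * s * (Y π + 4 * s ^ 2 * W π) + 4 * s * W π) :=
          expect_le_expect fun π _ => hp π
      _ ≤ 2 * s * (12 / (s : ℝ) ^ 7) + 4 * s * (3 / (s : ℝ) ^ 9) := by
          rw [expect_add_distrib, ← mul_expect, ← mul_expect]
          gcongr
      _ = 24 / (s : ℝ) ^ 6 + 12 / s ^ 2 / (s : ℝ) ^ 6 := by field_simp; ring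
      _ ≤ 24 / (s : ℝ) ^ 6 + 12 / (s : ℝ) ^ 6 := by
          gcongr
          exact div_le_self (by norm_num) (by nlinarith)
      _ = _ := by ring

end

section
variable {k n : ℕ}

/-- The point with the coordinates of `x` on `T` and those of `y` elsewhere. -/
def mix {α : Type*} (T : Finset (Fin k)) (x y : Fin k → α) : Fin k → α :=
  fun j => if j ∈ T then x j else y j

lemma mix_apply {α : Type*} (T : Finset (Fin k)) (x y : Fin k → α) (j : Fin k) :
    mix T x y j = if j ∈ T then x j else y j := rfl

/-- The mixed second difference of `f` when the `T`-coordinates of two points are swapped. -/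
def swapDiff (f : (Fin k → Fin n) → ℝ) (T : Finset (Fin k)) (x y : Fin k → Fin n) : ℝ :=
  f x + f y - f (mix T x y) - f (mix T y x)

variable {f : (Fin k → Fin n) → ℝ} {T : Finset (Fin k)}

lemma act_mix (π : Fin k → Equiv.Perm (Fin n)) (x y : Fin k → Fin n) :
    act π (mix T x y) = mix T (act π x) (act π y) := by
  funext j
  simp only [act, mix]
  split_ifs <;> rfl

lemma swapDiff_eq_add (x y w : Fin k → Fin n) :
    swapDiff f T x y = swapDiff f T x w + swapDiff f T y w -
      swapDiff f T (mix T x y) w - swapDiff f T (mix T y x) w := by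
  have e1 : ∀ x y : Fin k → Fin n, mix T (mix T x y) w = mix T x w := fun x y => by
    funext j; simp only [mix]; split_ifs <;> rfl
  have e2 : ∀ x y : Fin k → Fin n, mix T w (mix T x y) = mix T w y := fun x y => by
    funext j; simp only [mix]; split_ifs <;> rfl
  simp only [swapDiff, e1, e2]
  ring

/-- The permutations that exchange the `T`-coordinates of the edges with indices `a` and `b`. -/
def swapOn (T : Finset (Fin k)) (a b : Fin n) : Fin k → Equiv.Perm (Fin n) :=
  fun j => if j ∈ T then Equiv.swap a b else 1

lemma edge_swapOn_left (π : Fin k → Equiv.Perm (Fin n)) (a b : Fin n) :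
    edge (π * swapOn T a b) a = mix T (edge π b) (edge π a) := by
  funext j
  simp only [edge, swapOn, mix, Pi.mul_apply, Equiv.Perm.mul_apply]
  split_ifs <;> simp

lemma edge_swapOn_right (π : Fin k → Equiv.Perm (Fin n)) (a b : Fin n) :
    edge (π * swapOn T a b) b = mix T (edge π a) (edge π b) := by
  funext j
  simp only [edge, swapOn, mix, Pi.mul_apply, Equiv.Perm.mul_apply]
  split_ifs <;> simp

lemma edge_swapOn_of_ne (π : Fin k → Equiv.Perm (Fin n)) {a b t : Fin n} (ha : t ≠ a)
    (hb : t ≠ b) : edge (π * swapOn T a b) t = edge π t := by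
  funext j
  simp only [edge, swapOn, Pi.mul_apply, Equiv.Perm.mul_apply]
  split_ifs
  · rw [Equiv.swap_apply_of_ne_of_ne ha hb]
  · rfl

lemma swapDiff_swapOn (π : Fin k → Equiv.Perm (Fin n)) (a b : Fin n) :
    swapDiff f T (edge (π * swapOn T a b) a) (edge (π * swapOn T a b) b) =
      -swapDiff f T (edge π a) (edge π b) := by
  have e : ∀ x y : Fin k → Fin n, mix T (mix T x y) (mix T y x) = x := fun x y => by
    funext j; simp only [mix]; split_ifs <;> rfl
  simp only [edge_swapOn_left, edge_swapOn_right, swapDiff, e]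
  ring

lemma sum_edge_swapOn (π : Fin k → Equiv.Perm (Fin n)) {a b : Fin n} (hab : a ≠ b) :
    ∑ t, f (edge (π * swapOn T a b) t) =
      ∑ t, f (edge π t) - swapDiff f T (edge π a) (edge π b) := by
  rw [eq_sub_iff_add_eq, ← eq_sub_iff_add_eq', ← sum_sub_distrib,
    Fintype.sum_eq_add a b hab]
  · rw [edge_swapOn_left, edge_swapOn_right, swapDiff]; ring
  · rintro t ⟨ha, hb⟩
    rw [edge_swapOn_of_ne π ha hb, sub_self]

lemma sum_expect_swapDiff_sq_le {ι : Type*} [Fintype ι] [DecidableEq ι] (a b : ι → Fin n)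
    (hab : ∀ p q, a p ≠ b q) (ha : Function.Injective a) (hb : Function.Injective b) (c : ℝ) :
    ∑ p, 𝔼 π, swapDiff f T (edge π (a p)) (edge π (b p)) ^ 2 ≤
      4 * 𝔼 π, (∑ t, f (edge π t) - c) ^ 2 := by
  set D : ι → (Fin k → Equiv.Perm (Fin n)) → ℝ := fun p π =>
    swapDiff f T (edge π (a p)) (edge π (b p)) with hD
  set X : (Fin k → Equiv.Perm (Fin n)) → ℝ := fun π => ∑ t, f (edge π t) - c with hX
  have hDD : ∀ p π, D p (π * swapOn T (a p) (b p)) = -D p π := fun p π => swapDiff_swapOn _ _ _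
  have hDq : ∀ p q π, q ≠ p → D q (π * swapOn T (a p) (b p)) = D q π := fun p q π hqp => by
    simp only [hD]
    rw [edge_swapOn_of_ne π (ha.ne hqp) (hab _ _),
      edge_swapOn_of_ne π (hab _ _).symm (hb.ne hqp)]
  have hXD : ∀ p π, X (π * swapOn T (a p) (b p)) = X π - D p π := fun p π => by
    simp only [hX, hD]
    rw [sum_edge_swapOn π (hab p p)]; ring
  have h1 : ∀ p q, q ≠ p → 𝔼 π, D p π * D q π = 0 := fun p q hqp => by
    have := expect_mul_right (swapOn T (a p) (b p)) fun π => D p π * D q π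
    simp only [hDD, hDq p q _ hqp, neg_mul, expect_neg_distrib] at this
    linarith
  have h2 : ∀ p, 𝔼 π, X π * D p π = 1 / 2 * 𝔼 π, D p π ^ 2 := fun p => by
    have := expect_mul_right (swapOn T (a p) (b p)) fun π => X π * D p π
    have e : ∀ π, (X π - D p π) * -D p π = -(X π * D p π) + D p π ^ 2 := fun π => by ring
    simp only [hDD, hXD, e, expect_add_distrib, expect_neg_distrib] at this
    linarith
  have h3 : 𝔼 π, (∑ p, D p π) ^ 2 = ∑ p, 𝔼 π, D p π ^ 2 := by
    simp only [sq, sum_mul_sum]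
    rw [expect_sum_comm]
    refine sum_congr rfl fun p _ => ?_
    rw [expect_sum_comm, sum_eq_single p (fun q _ hq => h1 p q hq) (by simp)]
  have h4 : 0 ≤ 𝔼 π, (X π - 1 / 2 * ∑ p, D p π) ^ 2 := expect_nonneg fun _ _ => sq_nonneg _
  have e : ∀ π, (X π - 1 / 2 * ∑ p, D p π) ^ 2 =
      X π ^ 2 - ∑ p, X π * D p π + 1 / 4 * (∑ p, D p π) ^ 2 := fun π => by
    rw [← mul_sum]; ring
  simp only [e] at h4
  rw [expect_add_distrib, expect_sub_distrib, expect_sum_comm, ← mul_expect, h3] at h4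
  simp only [h2] at h4
  rw [← mul_sum] at h4
  linarith

lemma expect_swapDiff_edge_sq_le {c η : ℝ} (h : 𝔼 π, (∑ t, f (edge π t) - c) ^ 2 ≤ η)
    {t u : Fin n} (htu : t ≠ u) :
    𝔼 π, swapDiff f T (edge π t) (edge π u) ^ 2 ≤ 12 * η / n := by
  have hn : 2 ≤ n := by
    have := t.2
    have := u.2
    have : (t : ℕ) ≠ u := fun h => htu (Fin.ext h)
    omega
  have key := sum_expect_swapDiff_sq_le (f := f) (T := T) (ι := Fin (n / 2))
    (fun p => ⟨2 * p, by omega⟩) (fun p => ⟨2 * p + 1, by omega⟩)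
    (fun p q h => by have := Fin.mk.inj h; omega)
    (fun p q h => by have := Fin.mk.inj h; exact Fin.ext (by omega))
    (fun p q h => by have := Fin.mk.inj h; exact Fin.ext (by omega)) c
  have e : ∀ a b : Fin n, a ≠ b → 𝔼 π, swapDiff f T (edge π a) (edge π b) ^ 2 =
      𝔼 π, swapDiff f T (edge π t) (edge π u) ^ 2 := fun a b hab =>
    expect_act_act (z := fun _ => a) (w := fun _ => b) (fun _ => hab) htu
      fun x y => swapDiff f T x y ^ 2
  rw [sum_congr rfl fun p _ => e _ _ (fun h => by have := Fin.mk.inj h; omega)] at key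
  rw [sum_const, card_univ, Fintype.card_fin, nsmul_eq_mul] at key
  have hn0 : (0 : ℝ) < n := by exact_mod_cast (by omega : 0 < n)
  rw [le_div_iff₀ hn0]
  have h3 : (n : ℝ) ≤ 3 * (n / 2 : ℕ) := by exact_mod_cast (by omega : n ≤ 3 * (n / 2))
  have h4 : 0 ≤ 𝔼 π, swapDiff f T (edge π t) (edge π u) ^ 2 :=
    expect_nonneg fun _ _ => sq_nonneg _
  nlinarith

/-- Swapping coordinates of two independent random points rarely changes anything. -/
lemma expect_swapDiff_sq_le (hn : 3 ≤ n) {c η : ℝ}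
    (h : 𝔼 π, (∑ t, f (edge π t) - c) ^ 2 ≤ η) (T : Finset (Fin k)) :
    𝔼 x, 𝔼 y, swapDiff f T x y ^ 2 ≤ 192 * η / n := by
  have : NeZero n := ⟨by omega⟩
  have htu : (⟨0, by omega⟩ : Fin n) ≠ ⟨1, by omega⟩ := by simp
  have hv := expect_swapDiff_edge_sq_le (T := T) h htu
  have hz : ∀ z w : Fin k → Fin n, (∀ j, z j ≠ w j) →
      𝔼 π, swapDiff f T (act π z) (act π w) ^ 2 ≤ 12 * η / n := fun z w hzw => by
    rw [expect_act_act hzw htu fun x y => swapDiff f T x y ^ 2]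
    exact hv
  rw [← expect_act_both]
  refine (expect_le_expect fun x _ => expect_le_expect fun y _ =>
    (?_ : _ ≤ 192 * η / n)).trans (by simp)
  have hw : ∀ j, ∃ v : Fin n, v ≠ x j ∧ v ≠ y j := fun j => by
    by_contra! hcon
    have : (univ : Finset (Fin n)) ⊆ {x j, y j} := fun v _ => by
      by_cases hv : v = x j
      · simp [hv]
      · simp [hcon v hv]
    have := (card_le_card this).trans card_le_two
    simp at this
    omega
  choose w hw1 hw2 using hw
  have hmix : ∀ x y : Fin k → Fin n, (∀ j, w j ≠ x j) → (∀ j, w j ≠ y j) →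
      ∀ j, mix T x y j ≠ w j := fun x y hx hy j => by
    rw [mix_apply]; split_ifs
    · exact (hx j).symm
    · exact (hy j).symm
  have b1 := hz x w fun j => (hw1 j).symm
  have b2 := hz y w fun j => (hw2 j).symm
  have b3 := hz (mix T x y) w (hmix x y hw1 hw2)
  have b4 := hz (mix T y x) w (hmix y x hw2 hw1)
  calc 𝔼 π, swapDiff f T (act π x) (act π y) ^ 2
      ≤ 𝔼 π, 4 * (swapDiff f T (act π x) (act π w) ^ 2 + swapDiff f T (act π y) (act π w) ^ 2 +
        swapDiff f T (act π (mix T x y)) (act π w) ^ 2 +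
        swapDiff f T (act π (mix T y x)) (act π w) ^ 2) := by
        refine expect_le_expect fun π _ => ?_
        rw [swapDiff_eq_add (act π x) (act π y) (act π w), act_mix, act_mix]
        set p := swapDiff f T (act π x) (act π w)
        set q := swapDiff f T (act π y) (act π w)
        set r := swapDiff f T (mix T (act π x) (act π y)) (act π w)
        set t := swapDiff f T (mix T (act π y) (act π x)) (act π w)
        nlinarith [sq_nonneg (p - q), sq_nonneg (p + r), sq_nonneg (p + t), sq_nonneg (q + r),
          sq_nonneg (q + t), sq_nonneg (r - t)]
    _ ≤ _ := by
        rw [← mul_expect, expect_add_distrib, expect_add_distrib, expect_add_distrib]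
        calc _ ≤ 4 * (12 * η / n + 12 * η / n + 12 * η / n + 12 * η / n) := by gcongr
          _ = _ := by ring

end

section mix
variable {k : ℕ} {α : Type*} {T S : Finset (Fin k)} {f g : (Fin k → α) → ℝ}

lemma mix_compl (x y : Fin k → α) : mix Tᶜ x y = mix T y x := by
  funext j
  simp only [mix, mem_compl]
  split_ifs <;> simp_all

/-- The function depends only on the coordinates in `T`. -/
def IsOn (T : Finset (Fin k)) (g : (Fin k → α) → ℝ) : Prop := ∀ x y, g (mix T x y) = g x

lemma IsOn.mono (hg : IsOn T g) (h : T ⊆ S) : IsOn S g := fun x y => by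
  rw [← hg (mix S x y) x]
  congr 1
  funext j
  simp only [mix]
  split_ifs with h1 h2
  · rfl
  · exact absurd (h h1) h2
  · rfl

lemma IsOn.mul (hf : IsOn T f) (hg : IsOn T g) : IsOn T fun x => f x * g x := fun x y => by
  simp only [hf x y, hg x y]

variable [Fintype α]

lemma expect_mix_mix (T : Finset (Fin k)) (G : (Fin k → α) → (Fin k → α) → ℝ) :
    𝔼 x, 𝔼 y, G (mix T x y) (mix T y x) = 𝔼 x, 𝔼 y, G x y := by
  rw [← expect_product', ← expect_product', univ_product_univ]
  have e : ∀ x y : Fin k → α, mix T (mix T x y) (mix T y x) = x := fun x y => by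
    funext j; simp only [mix]; split_ifs <;> rfl
  let φ : (Fin k → α) × (Fin k → α) → (Fin k → α) × (Fin k → α) :=
    fun p => (mix T p.1 p.2, mix T p.2 p.1)
  have hφ : Function.Involutive φ := fun p => Prod.ext (e _ _) (e _ _)
  exact Fintype.expect_equiv hφ.toPerm _ _ fun _ => rfl

lemma isOn_ind_filter {p : (Fin k → α) → Prop} [DecidablePred p]
    (h : ∀ x y, p (mix T x y) ↔ p x) : IsOn T (ind (univ.filter p)) := fun x y => by
  simp only [ind, mem_filter, mem_univ, true_and, h]

/-- The conditional average of `f` given the coordinates in `T`. -/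
noncomputable def avg (f : (Fin k → α) → ℝ) (T : Finset (Fin k)) (x : Fin k → α) : ℝ :=
  𝔼 y, f (mix T x y)

lemma avg_mix (x y : Fin k → α) : avg f T (mix T x y) = avg f T x := by
  have e : ∀ z, mix T (mix T x y) z = mix T x z := fun z => by
    funext j; simp only [mix]; split_ifs <;> rfl
  simp only [avg, e]

variable [Nonempty α]

lemma expect_mix (T : Finset (Fin k)) (g : (Fin k → α) → ℝ) :
    𝔼 x, 𝔼 y, g (mix T x y) = 𝔼 x, g x := by
  rw [expect_mix_mix T fun x _ => g x]
  simp only [Fintype.expect_const]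

/-- Functions of disjoint sets of coordinates are independent. -/
lemma IsOn.expect_mul (hf : IsOn T f) (hg : IsOn Tᶜ g) :
    𝔼 x, f x * g x = (𝔼 x, f x) * 𝔼 x, g x := by
  have e : 𝔼 x, 𝔼 y, f x * g y = (𝔼 x, f x) * 𝔼 x, g x := by
    rw [Finset.expect_mul]
    exact expect_congr rfl fun x _ => (Finset.mul_expect _ _ _).symm
  rw [← e, ← expect_mix_mix T]
  have : ∀ x y, f (mix T x y) * g (mix T y x) = f x * g x := fun x y => by
    rw [hf, ← mix_compl, hg]
  simp only [this, Fintype.expect_const]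

lemma IsOn.expect_mul_avg (hg : IsOn T g) : 𝔼 x, g x * avg f T x = 𝔼 x, g x * f x := by
  rw [← expect_mix T fun x => g x * f x]
  refine expect_congr rfl fun x _ => ?_
  rw [avg, mul_expect]
  exact expect_congr rfl fun y _ => by rw [hg x y]

lemma IsOn.expect_mul_avg_compl (hST : Disjoint S T) (hg : IsOn (S ∪ T) g) :
    𝔼 x, g x * avg f Sᶜ x = 𝔼 x, g x * avg f T x := by
  rw [← expect_mix (S ∪ T) fun x => g x * avg f Sᶜ x]
  refine expect_congr rfl fun x _ => ?_
  simp only [hg x, avg, ← mul_expect]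
  congr 1
  rw [← expect_mix S fun w => f (mix T x w), expect_comm]
  refine expect_congr rfl fun y _ => expect_congr rfl fun z _ => ?_
  congr 1
  funext j
  have : j ∈ S → j ∉ T := fun h => Finset.disjoint_left.1 hST h
  simp only [mix, mem_compl, mem_union]
  split_ifs <;> simp_all

end mix

lemma swapDiff_ind_bounds {k n : ℕ} (F : Finset (Fin k → Fin n)) (T : Finset (Fin k)) (x y) :
    -swapDiff (ind F) T x y ≤ swapDiff (ind F) T x y ^ 2 ∧
    ind F x * ((1 - ind F (mix T x y)) * (1 - ind F (mix Tᶜ x y))) ≤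
      swapDiff (ind F) T x y ^ 2 := by
  rw [mix_compl]
  simp only [swapDiff]
  rcases ind_eq_or F x with h1 | h1 <;> rcases ind_eq_or F y with h2 | h2 <;>
  rcases ind_eq_or F (mix T x y) with h3 | h3 <;>
  rcases ind_eq_or F (mix T y x) with h4 | h4 <;> rw [h1, h2, h3, h4] <;> norm_num

section dens
variable {α : Type*}

lemma ind_mono {A B : Finset α} (h : A ⊆ B) (x : α) : ind A x ≤ ind B x := by
  by_cases hx : x ∈ A
  · rw [ind_of_mem hx, ind_of_mem (h hx)]
  · rw [ind_of_notMem hx]; exact ind_nonneg _ _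

lemma ind_inter [DecidableEq α] (A B : Finset α) (x : α) : ind (A ∩ B) x = ind A x * ind B x := by
  by_cases h1 : x ∈ A <;> by_cases h2 : x ∈ B <;> simp [ind, h1, h2]

lemma ind_sdiff [DecidableEq α] (A B : Finset α) (x : α) : ind (A \ B) x = ind A x * (1 - ind B x) := by
  by_cases h1 : x ∈ A <;> by_cases h2 : x ∈ B <;> simp [ind, h1, h2]

variable [Fintype α]

lemma dens_mono {A B : Finset α} (h : A ⊆ B) : dens A ≤ dens B :=
  expect_le_expect fun x _ => ind_mono h x

variable [DecidableEq α]

lemma dens_union_add_inter (A B : Finset α) :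
    dens (A ∪ B) + dens (A ∩ B) = dens A + dens B := by
  simp only [dens_eq, ← add_div]
  congr 1
  exact_mod_cast card_union_add_card_inter A B

lemma dens_union_le (A B : Finset α) : dens (A ∪ B) ≤ dens A + dens B := by
  have := dens_union_add_inter A B
  linarith [dens_nonneg (A ∩ B)]

lemma dens_le_add_sdiff (A B : Finset α) : dens A ≤ dens B + dens (A \ B) := by
  refine (dens_mono ?_).trans (dens_union_le B (A \ B))
  intro x hx
  by_cases h : x ∈ B <;> simp [hx, h]

/-- If `h ≥ c` on `B`, then `c` times the density of `B` is at most the average over all points of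
`h` times the indicator function of `B`. -/
lemma mul_dens_le {B : Finset α} {h : α → ℝ} {c : ℝ} (hB : ∀ x ∈ B, c ≤ h x) :
    c * dens B ≤ 𝔼 x, ind B x * h x := by
  rw [dens, mul_expect]
  refine expect_le_expect fun x _ => ?_
  by_cases hx : x ∈ B
  · rw [ind_of_mem hx, mul_one, one_mul]; exact hB x hx
  · rw [ind_of_notMem hx]; simp

end dens

section
variable {k n : ℕ}

/-- The points whose conditional density given the coordinates in `T` is at least `1 - θ`. -/
noncomputable def heavy (F : Finset (Fin k → Fin n)) (θ : ℝ) (T : Finset (Fin k)) :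
    Finset (Fin k → Fin n) := univ.filter fun x => 1 - θ ≤ avg (ind F) T x

lemma mem_heavy {F : Finset (Fin k → Fin n)} {θ : ℝ} {T : Finset (Fin k)} {x} :
    x ∈ heavy F θ T ↔ 1 - θ ≤ avg (ind F) T x := by simp [heavy]

lemma isOn_heavy (F : Finset (Fin k → Fin n)) (θ : ℝ) (T : Finset (Fin k)) :
    IsOn T (ind (heavy F θ T)) := isOn_ind_filter fun x y => by rw [avg_mix]

lemma IsOn.ind_sdiff {T : Finset (Fin k)} {A B : Finset (Fin k → Fin n)} (hA : IsOn T (ind A))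
    (hB : IsOn T (ind B)) : IsOn T (ind (A \ B)) := fun x y => by
  simp only [CrossMatching.ind_sdiff, hA x y, hB x y]

lemma avg_le_one [NeZero n] (F : Finset (Fin k → Fin n)) (T : Finset (Fin k)) (x) :
    avg (ind F) T x ≤ 1 :=
  (expect_le_expect fun _ _ => ind_le_one _ _).trans (Fintype.expect_const _).le

/-- The quantities `D` bounding the mixed second differences of the family `F`. -/
structure Rigid (F : Finset (Fin k → Fin n)) (θ δ : ℝ) : Prop where
  pos : 0 < θ
  le_one : θ ≤ 1
  dens_le : dens F ≤ 1 - 4 * θ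
  bound : ∀ T, 𝔼 x, 𝔼 y, swapDiff (ind F) T x y ^ 2 ≤ δ

variable {F : Finset (Fin k → Fin n)} {θ δ : ℝ} {S T : Finset (Fin k)}

lemma Rigid.δ_nonneg (h : Rigid F θ δ) : 0 ≤ δ :=
  le_trans (expect_nonneg fun _ _ => expect_nonneg fun _ _ => sq_nonneg _) (h.bound ∅)

lemma Rigid.expect_le (h : Rigid F θ δ) (B : Finset (Fin k → Fin n)) (T : Finset (Fin k)) :
    𝔼 x, ind B x * 𝔼 y, swapDiff (ind F) T x y ^ 2 ≤ δ := by
  refine le_trans (expect_le_expect fun x _ => ?_) (h.bound T)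
  exact mul_le_of_le_one_left (expect_nonneg fun _ _ => sq_nonneg _) (ind_le_one _ _)

lemma le_expect_swapDiff_sq [NeZero n] (F : Finset (Fin k → Fin n)) (T : Finset (Fin k)) (x) :
    avg (ind F) T x + avg (ind F) Tᶜ x - dens F - ind F x ≤
      𝔼 y, swapDiff (ind F) T x y ^ 2 := by
  refine le_trans (le_of_eq ?_) (expect_le_expect fun y _ => (swapDiff_ind_bounds F T x y).1)
  simp only [swapDiff, avg, dens, mix_compl, expect_neg_distrib, expect_sub_distrib,
    expect_add_distrib, Fintype.expect_const]
  ring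

lemma le_expect_swapDiff_sq' [NeZero n] (F : Finset (Fin k → Fin n)) (T : Finset (Fin k)) (x) :
    ind F x * ((1 - avg (ind F) T x) * (1 - avg (ind F) Tᶜ x)) ≤
      𝔼 y, swapDiff (ind F) T x y ^ 2 := by
  refine le_trans (le_of_eq ?_) (expect_le_expect fun y _ => (swapDiff_ind_bounds F T x y).2)
  rw [← mul_expect]
  congr 1
  have e1 : IsOn Tᶜ fun y => 1 - ind F (mix T x y) := fun y z => by
    have : mix T x (mix Tᶜ y z) = mix T x y := by
      funext j; simp only [mix, mem_compl]; split_ifs <;> rfl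
    simp only [this]
  have e2 : IsOn T fun y => 1 - ind F (mix Tᶜ x y) := fun y z => by
    have : mix Tᶜ x (mix T y z) = mix Tᶜ x y := by
      funext j; simp only [mix, mem_compl]; split_ifs <;> simp_all
    simp only [this]
  rw [expect_congr rfl fun y _ => mul_comm (1 - ind F (mix T x y)) (1 - ind F (mix Tᶜ x y)),
    e2.expect_mul e1, mul_comm]
  simp only [expect_sub_distrib, Fintype.expect_const, avg]

/-- Few points outside the family are heavy. -/
lemma Rigid.dens_heavy_sdiff_le [NeZero n] (h : Rigid F θ δ) (T : Finset (Fin k)) :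
    3 * θ * dens (heavy F θ T \ F) ≤ δ := by
  refine le_trans (mul_dens_le fun x hx => ?_) (h.expect_le _ T)
  rw [mem_sdiff, mem_heavy] at hx
  refine le_trans ?_ (le_expect_swapDiff_sq F T x)
  have : 0 ≤ avg (ind F) Tᶜ x := expect_nonneg fun _ _ => ind_nonneg _ _
  rw [ind_of_notMem hx.2]
  linarith [h.dens_le]

/-- Few points of the family are neither `T`-heavy nor `Tᶜ`-heavy. -/
lemma Rigid.dens_sdiff_heavy_le [NeZero n] (h : Rigid F θ δ) (T : Finset (Fin k)) :
    θ ^ 2 * dens (F \ (heavy F θ T ∪ heavy F θ Tᶜ)) ≤ δ := by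
  refine le_trans (mul_dens_le fun x hx => ?_) (h.expect_le _ T)
  rw [mem_sdiff, notMem_union, mem_heavy, mem_heavy, not_le, not_le] at hx
  refine le_trans ?_ (le_expect_swapDiff_sq' F T x)
  rw [ind_of_mem hx.1, one_mul, sq]
  have := h.pos
  exact mul_le_mul (by linarith) (by linarith) h.pos.le (by linarith)

/-- Few points are heavy for two disjoint sets of coordinates. -/
lemma Rigid.dens_heavy_inter_le [NeZero n] (h : Rigid F θ δ) (hST : Disjoint S T) :
    2 * θ * dens (heavy F θ S ∩ heavy F θ T) ≤ δ := by
  have hTS : T ⊆ Sᶜ := fun j hj => mem_compl.2 fun hj' => Finset.disjoint_left.1 hST hj' hj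
  set a := ind (heavy F θ S)
  set b := ind (heavy F θ T)
  have ha : IsOn S a := isOn_heavy F θ S
  have hb : IsOn T b := isOn_heavy F θ T
  have hab : 𝔼 x, a x * b x = (𝔼 x, a x) * 𝔼 x, b x := ha.expect_mul (hb.mono hTS)
  have e1 : (1 - θ) * dens (heavy F θ S ∩ heavy F θ T) ≤
      𝔼 x, ind (heavy F θ S ∩ heavy F θ T) x * avg (ind F) Sᶜ x := by
    have hbc : IsOn Sᶜ fun x => b x * avg (ind F) Sᶜ x :=
      (hb.mono hTS).mul fun x y => avg_mix x y
    simp only [dens, ind_inter]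
    rw [hab, expect_congr rfl fun x _ => mul_assoc _ _ _, ha.expect_mul hbc,
      (hb.mono hTS).expect_mul_avg, ← hb.expect_mul_avg, mul_left_comm]
    refine mul_le_mul_of_nonneg_left ?_ (expect_nonneg fun _ _ => ind_nonneg _ _)
    exact mul_dens_le fun x hx => mem_heavy.1 hx
  have e2 := h.expect_le (heavy F θ S ∩ heavy F θ T) S
  have e3 : -((1 - θ) - 2 * θ) * dens (heavy F θ S ∩ heavy F θ T) ≤
      𝔼 x, ind (heavy F θ S ∩ heavy F θ T) x *
        ((𝔼 y, swapDiff (ind F) S x y ^ 2) - avg (ind F) Sᶜ x) := by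
    refine mul_dens_le fun x hx => ?_
    have h1 := le_expect_swapDiff_sq F S x
    have h2 := mem_heavy.1 (mem_inter.1 hx).1
    linarith [ind_le_one F x, h.dens_le]
  simp only [mul_sub, expect_sub_distrib] at e3
  linarith

/-- For sets depending on `T`, being inside the heavy set up to points of low average. -/
lemma Rigid.dens_le_of_avg_le [NeZero n] (h : Rigid F θ δ) {B : Finset (Fin k → Fin n)} {c : ℝ}
    (hB : IsOn T (ind B)) (hBS : B ⊆ heavy F θ S)
    (hc : ∀ x ∈ B, avg (ind F) T x ≤ 1 - c) : 3 * θ * (c * dens B) ≤ δ := by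
  refine le_trans (mul_le_mul_of_nonneg_left ?_ (by linarith [h.pos]))
    (h.dens_heavy_sdiff_le S)
  calc c * dens B ≤ 𝔼 x, ind B x * (1 - avg (ind F) T x) :=
        mul_dens_le fun x hx => by linarith [hc x hx]
    _ = 𝔼 x, ind B x * (1 - ind F x) := by
        simp only [mul_sub, expect_sub_distrib, hB.expect_mul_avg]
    _ = dens (B \ F) := by simp only [dens, CrossMatching.ind_sdiff]
    _ ≤ _ := dens_mono (sdiff_subset_sdiff hBS le_rfl)

lemma Rigid.dens_heavy_sdiff_heavy_le [NeZero n] (h : Rigid F θ δ) (hST : S ⊆ T) :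
    3 * θ ^ 2 * dens (heavy F θ S \ heavy F θ T) ≤ δ := by
  have := h.dens_le_of_avg_le (B := heavy F θ S \ heavy F θ T) (c := θ)
    (((isOn_heavy F θ S).mono hST).ind_sdiff (isOn_heavy F θ T)) sdiff_subset fun x hx => by
      have := (mem_sdiff.1 hx).2
      rw [mem_heavy] at this
      linarith
  linarith

/-- Few points are heavy for a union of two disjoint sets but for neither of them. -/
lemma Rigid.dens_heavy_union_le [NeZero n] (h : Rigid F θ δ) (hST : Disjoint S T) :
    θ ^ 2 * dens (heavy F θ (S ∪ T) \ (heavy F θ S ∪ heavy F θ T)) ≤ 3 * δ := by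
  have hθ := h.pos
  have hSB : IsOn (S ∪ T) (ind (heavy F θ S)) := (isOn_heavy F θ S).mono subset_union_left
  have hTB : IsOn (S ∪ T) (ind (heavy F θ T)) := (isOn_heavy F θ T).mono subset_union_right
  have hUB := isOn_heavy F θ (S ∪ T)
  set B := (heavy F θ (S ∪ T) \ heavy F θ S) \ heavy F θ T with hBdef
  have hBe : heavy F θ (S ∪ T) \ (heavy F θ S ∪ heavy F θ T) = B := by
    ext x; simp only [hBdef, mem_sdiff, mem_union, not_or, and_assoc]
  have hB : IsOn (S ∪ T) (ind B) := (hUB.ind_sdiff hSB).ind_sdiff hTB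
  set H := univ.filter fun x => 1 - θ / 2 ≤ avg (ind F) (S ∪ T) x with hH
  have hHon : IsOn (S ∪ T) (ind H) := isOn_ind_filter fun x y => by rw [avg_mix]
  have b1 := h.dens_le_of_avg_le (S := S ∪ T) (c := θ / 2) (hB.ind_sdiff hHon)
    (fun x hx => (mem_sdiff.1 (mem_sdiff.1 (mem_sdiff.1 hx).1).1).1) fun x hx => by
      have := (mem_sdiff.1 hx).2
      simp only [hH, mem_filter, mem_univ, true_and, not_le] at this
      exact this.le
  have hBH : IsOn (S ∪ T) (ind (B ∩ H)) := fun x y => by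
    simp only [ind_inter, hB x y, hHon x y]
  have b2 : θ / 2 * dens (B ∩ H) ≤
      𝔼 x, ind (B ∩ H) x * (avg (ind F) (S ∪ T) x - avg (ind F) T x) := by
    refine mul_dens_le fun x hx => ?_
    simp only [hBdef, hH, mem_inter, mem_sdiff, mem_heavy, mem_filter, mem_univ, true_and,
      not_le] at hx
    linarith [hx.1.2, hx.2]
  have b3 : 𝔼 x, ind (B ∩ H) x * (avg (ind F) (S ∪ T) x - avg (ind F) T x) =
      𝔼 x, ind (B ∩ H) x * (ind F x - avg (ind F) Sᶜ x) := by
    simp only [mul_sub, expect_sub_distrib, hBH.expect_mul_avg, hBH.expect_mul_avg_compl hST]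
  have b4 : θ * 𝔼 x, ind (B ∩ H) x * (ind F x - avg (ind F) Sᶜ x) ≤ δ := by
    refine le_trans ?_ (h.expect_le (B ∩ H) S)
    rw [mul_expect]
    refine expect_le_expect fun x _ => ?_
    rw [mul_left_comm]
    by_cases hx : x ∈ B ∩ H
    · rw [ind_of_mem hx, one_mul, one_mul]
      refine le_trans ?_ (le_expect_swapDiff_sq' F S x)
      simp only [hBdef, mem_inter, mem_sdiff, mem_heavy, not_le] at hx
      have c1 := avg_le_one F Sᶜ x
      have c2 : 0 ≤ avg (ind F) Sᶜ x := expect_nonneg fun _ _ => ind_nonneg _ _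
      rcases ind_eq_or F x with h1 | h1 <;> rw [h1]
      · nlinarith
      · rw [one_mul]
        exact mul_le_mul_of_nonneg_right (by linarith [hx.1.1.2]) (by linarith)
    · rw [ind_of_notMem hx]; simp
  have b5 := dens_union_le (B \ H) (B ∩ H)
  rw [sdiff_union_inter] at b5
  rw [hBe]
  have b6 : θ * (θ / 2 * dens (B ∩ H)) ≤ δ :=
    (mul_le_mul_of_nonneg_left (b2.trans b3.le) hθ.le).trans b4
  have := mul_le_mul_of_nonneg_left b5 (sq_nonneg θ)
  linarith [h.δ_nonneg]

end

section
variable {k n : ℕ} {F : Finset (Fin k → Fin n)} {θ δ : ℝ} {S T : Finset (Fin k)}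

lemma expect_cnt_sq_le [NeZero n] (E : Finset (Fin k → Fin n)) {q : ℝ} (hq : mean E ≤ q) (hq' : q ≤ 1 / 4) :
    𝔼 π, cnt E π ^ 2 ≤ 14 * q := by
  have h0 := mean_nonneg E
  have h1 : 𝔼 π, cnt E π ^ 2 ≤ 2 * (𝔼 π, Real.exp (1 * cnt E π) - 1) := by
    have : 𝔼 π, (Real.exp (1 * cnt E π) - 1) = 𝔼 π, Real.exp (1 * cnt E π) - 1 := by
      rw [expect_sub_distrib, Fintype.expect_const]
    rw [← this, mul_expect]
    refine expect_le_expect fun π _ => ?_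
    have := Real.quadratic_le_exp_of_nonneg (cnt_nonneg E π)
    rw [one_mul]
    linarith [cnt_nonneg E π]
  have h2 := expect_exp_cnt_le E 1
  have e3 : Real.exp (2 * 1) ≤ 39 / 5 := by
    have := Real.exp_one_lt_d9
    rw [two_mul, Real.exp_add]
    nlinarith [Real.exp_pos 1]
  have h3 : Real.exp (mean E / 2 * (Real.exp (2 * 1) - 1)) ≤ Real.exp (17 / 5 * q) := by
    refine Real.exp_le_exp.2 ?_
    nlinarith
  have h4 := (abs_le.1 (Real.abs_exp_sub_one_le (x := 17 / 5 * q)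
    (abs_le.2 ⟨by linarith, by linarith⟩))).2
  rw [abs_of_nonneg (by linarith : 0 ≤ 17 / 5 * q)] at h4
  linarith

/-- Up to a small set, the family splits into the `T`-heavy and the `Tᶜ`-heavy points. -/
lemma Rigid.exists_error [NeZero n] (h : Rigid F θ δ) (T : Finset (Fin k)) :
    ∃ E : Finset (Fin k → Fin n), θ ^ 2 * dens E ≤ 3 * δ ∧
      ∀ x, |ind F x - (ind (heavy F θ T) x + ind (heavy F θ Tᶜ) x)| ≤ 2 * ind E x := by
  refine ⟨((heavy F θ T \ F) ∪ (heavy F θ Tᶜ \ F)) ∪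
    ((F \ (heavy F θ T ∪ heavy F θ Tᶜ)) ∪ (heavy F θ T ∩ heavy F θ Tᶜ)), ?_, fun x => ?_⟩
  · have h1 := dens_union_le ((heavy F θ T \ F) ∪ (heavy F θ Tᶜ \ F))
      ((F \ (heavy F θ T ∪ heavy F θ Tᶜ)) ∪ (heavy F θ T ∩ heavy F θ Tᶜ))
    have h2 := dens_union_le (heavy F θ T \ F) (heavy F θ Tᶜ \ F)
    have h3 := dens_union_le (F \ (heavy F θ T ∪ heavy F θ Tᶜ)) (heavy F θ T ∩ heavy F θ Tᶜ)
    have a1 := h.dens_heavy_sdiff_le T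
    have a2 := h.dens_heavy_sdiff_le Tᶜ
    have a3 := h.dens_sdiff_heavy_le T
    have a4 := h.dens_heavy_inter_le (disjoint_compl_right (a := T))
    have hθ := h.pos
    have hθ1 := h.le_one
    have hδ := h.δ_nonneg
    have b1 := mul_le_mul_of_nonneg_left a1 hθ.le
    have b2 := mul_le_mul_of_nonneg_left a2 hθ.le
    have b4 := mul_le_mul_of_nonneg_left a4 hθ.le
    have c := mul_le_mul_of_nonneg_right hθ1 hδ
    have := mul_le_mul_of_nonneg_left h1 (sq_nonneg θ)
    have := mul_le_mul_of_nonneg_left h2 (sq_nonneg θ)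
    have := mul_le_mul_of_nonneg_left h3 (sq_nonneg θ)
    linarith
  · by_cases hF : x ∈ F <;> by_cases h1 : x ∈ heavy F θ T <;> by_cases h2 : x ∈ heavy F θ Tᶜ <;>
      (simp [ind, hF, h1, h2]; try norm_num)

lemma Rigid.abs_mean_heavy_union_le [NeZero n] (h : Rigid F θ δ) (hST : Disjoint S T) :
    θ ^ 2 * |mean (heavy F θ (S ∪ T)) - (mean (heavy F θ S) + mean (heavy F θ T))| ≤
      3 * δ * n := by
  have h1 := dens_le_add_sdiff (heavy F θ (S ∪ T)) (heavy F θ S ∪ heavy F θ T)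
  have h2 := dens_union_add_inter (heavy F θ S) (heavy F θ T)
  have h3 := dens_nonneg (heavy F θ S ∩ heavy F θ T)
  have h4 := dens_le_add_sdiff (heavy F θ S ∪ heavy F θ T) (heavy F θ (S ∪ T))
  rw [union_sdiff_distrib] at h4
  have h5 := dens_union_le (heavy F θ S \ heavy F θ (S ∪ T)) (heavy F θ T \ heavy F θ (S ∪ T))
  have a1 := h.dens_heavy_union_le hST
  have a2 := h.dens_heavy_inter_le hST
  have a3 := h.dens_heavy_sdiff_heavy_le (subset_union_left : S ⊆ S ∪ T)
  have a4 := h.dens_heavy_sdiff_heavy_le (subset_union_right : T ⊆ S ∪ T)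
  have hθ := h.pos
  have hδ := h.δ_nonneg
  have b2 := mul_le_mul_of_nonneg_left a2 hθ.le
  have c := mul_le_mul_of_nonneg_right h.le_one hδ
  have key : θ ^ 2 * |dens (heavy F θ (S ∪ T)) - (dens (heavy F θ S) + dens (heavy F θ T))| ≤
      3 * δ := by
    have e : ∀ z : ℝ, θ ^ 2 * |z| = |θ ^ 2 * z| := fun z => by
      rw [abs_mul, abs_of_nonneg (sq_nonneg θ)]
    rw [e, abs_le]
    have d1 := mul_le_mul_of_nonneg_left (h1.trans (add_le_add_left
      (by linarith : dens (heavy F θ S ∪ heavy F θ T) ≤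
        dens (heavy F θ S) + dens (heavy F θ T)) _)) (sq_nonneg θ)
    have d2 := mul_le_mul_of_nonneg_left (h4.trans (add_le_add_right h5 _)) (sq_nonneg θ)
    have d3 := congrArg (fun z => θ ^ 2 * z) h2
    constructor <;> linarith
  have := mul_le_mul_of_nonneg_right key (Nat.cast_nonneg (α := ℝ) n)
  refine le_trans (le_of_eq ?_) this
  simp only [mean, ← mul_add, ← mul_sub, abs_mul, Nat.abs_cast]
  ring

lemma cnt_heavy_mix (π ρ : Fin k → Equiv.Perm (Fin n)) :
    cnt (heavy F θ T) (mix T π ρ) = cnt (heavy F θ T) π := by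
  simp only [cnt]
  refine sum_congr rfl fun t _ => ?_
  rw [← isOn_heavy F θ T (edge π t) (edge ρ t)]
  congr 1
  funext j
  simp only [edge, mix]
  split_ifs <;> rfl

/-- The expected number of edges inside a heavy set is nearly an integer. -/
lemma Rigid.exists_nat_mean_heavy [NeZero n] (h : Rigid F θ δ) {c η q : ℝ} (hη : 𝔼 π, (cnt F π - c) ^ 2 ≤ η)
    (hq : 3 * δ * n ≤ θ ^ 2 * q) (hq' : q ≤ 1 / 4) (T : Finset (Fin k)) :
    ∃ z : ℕ, (mean (heavy F θ T) - z) ^ 2 ≤ 8 * η + 448 * q := by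
  obtain ⟨E, hE, hFE⟩ := h.exists_error T
  have hEq : mean E ≤ q := by
    have := mul_le_mul_of_nonneg_right hE (Nat.cast_nonneg (α := ℝ) n)
    have h2 : θ ^ 2 * mean E ≤ θ ^ 2 * q := by
      rw [mean]; linarith
    exact le_of_mul_le_mul_left h2 (pow_pos h.pos 2)
  have hE2 := expect_cnt_sq_le E hEq hq'
  set r := cnt (heavy F θ T)
  set r' := cnt (heavy F θ Tᶜ)
  have e1 : ∀ π, |cnt F π - (r π + r' π)| ≤ 2 * cnt E π := fun π => by
    simp only [r, r', cnt, ← sum_add_distrib, ← sum_sub_distrib, mul_sum]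
    exact (abs_sum_le_sum_abs _ _).trans (sum_le_sum fun t _ => hFE _)
  set G : (Fin k → Equiv.Perm (Fin n)) → ℝ := fun π => (r π + r' π - c) ^ 2
  have e2 : 𝔼 π, G π ≤ 2 * η + 112 * q := by
    calc 𝔼 π, G π ≤ 𝔼 π, (2 * (cnt F π - c) ^ 2 + 8 * cnt E π ^ 2) := by
          refine expect_le_expect fun π _ => ?_
          have h1 := abs_le.1 (e1 π)
          simp only [G]
          have h2 : (cnt F π - (r π + r' π)) ^ 2 ≤ (2 * cnt E π) ^ 2 :=
            sq_le_sq' (by linarith) h1.2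
          nlinarith [sq_nonneg ((cnt F π - c) + (cnt F π - (r π + r' π)))]
      _ ≤ _ := by
          rw [expect_add_distrib, ← mul_expect, ← mul_expect]
          linarith
  have e3 : 𝔼 ρ, 𝔼 π, (r π - r ρ) ^ 2 ≤ 8 * η + 448 * q := by
    calc 𝔼 ρ, 𝔼 π, (r π - r ρ) ^ 2 ≤ 𝔼 ρ, 𝔼 π, (2 * G π + 2 * G (mix T ρ π)) := by
          refine expect_le_expect fun ρ _ => expect_le_expect fun π _ => ?_
          have h1 : r (mix T ρ π) = r ρ := cnt_heavy_mix ρ π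
          have h2 : r' (mix T ρ π) = r' π := by
            rw [← mix_compl]; exact cnt_heavy_mix π ρ
          simp only [G, h1, h2]
          nlinarith [sq_nonneg ((r π + r' π - c) + (r ρ + r' π - c))]
      _ = 4 * 𝔼 π, G π := by
          simp only [expect_add_distrib, ← mul_expect, expect_mix, Fintype.expect_const]
          ring
      _ ≤ _ := by linarith
  obtain ⟨ρ, -, hρ⟩ := exists_le_of_expect_le univ_nonempty e3
  refine ⟨#(hits (heavy F θ T) ρ), le_trans ?_ hρ⟩
  rw [← cnt_eq_card_hits]
  set m := mean (heavy F θ T)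
  have : 𝔼 π, (2 * (m - r ρ) * (r π - r ρ) - (m - r ρ) ^ 2) = (m - r ρ) ^ 2 := by
    rw [expect_sub_distrib, ← mul_expect, expect_sub_distrib, Fintype.expect_const,
      Fintype.expect_const, expect_cnt]
    ring
  change (m - r ρ) ^ 2 ≤ _
  rw [← this]
  refine expect_le_expect fun π _ => ?_
  nlinarith [sq_nonneg (r π - m)]

lemma avg_univ (F : Finset (Fin k → Fin n)) (x) [Nonempty (Fin n)] :
    avg (ind F) univ x = ind F x := by
  have : ∀ y, mix univ x y = x := fun y => by funext j; simp [mix]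
  simp only [avg, this, Fintype.expect_const]

lemma Rigid.heavy_univ [NeZero n] (h : Rigid F θ δ) : heavy F θ univ = F := by
  have h1 : θ ≤ 1 / 4 := by linarith [h.dens_le, dens_nonneg F]
  ext x
  rw [mem_heavy, avg_univ]
  by_cases hx : x ∈ F
  · simp [ind_of_mem hx, hx, h.pos.le]
  · simp only [ind_of_notMem hx, hx, iff_false]; linarith

lemma Rigid.mean_heavy_empty (h : Rigid F θ δ) : mean (heavy F θ ∅) = 0 := by
  have : heavy F θ ∅ = ∅ := by
    refine eq_empty_of_forall_notMem fun x hx => ?_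
    have e : ∀ y, mix ∅ x y = y := fun y => by funext j; simp [mix]
    rw [mem_heavy] at hx
    simp only [avg, e] at hx
    have := h.dens_le
    rw [dens] at this
    linarith [h.pos]
  simp [this, mean, dens_eq]

/-- The symbols that make a point heavy on a single coordinate. -/
noncomputable def heavySymbols (F : Finset (Fin k → Fin n)) (θ : ℝ) (j : Fin k) : Finset (Fin n) :=
  univ.filter fun v => (fun _ => v) ∈ heavy F θ {j}

lemma mem_heavy_singleton {j : Fin k} {x : Fin k → Fin n} :
    x ∈ heavy F θ {j} ↔ x j ∈ heavySymbols F θ j := by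
  rw [heavySymbols, mem_filter, mem_heavy, mem_heavy]
  simp only [mem_univ, true_and]
  have : mix {j} x (fun _ => x j) = fun _ => x j := by
    funext i; simp only [mix, mem_singleton]; split_ifs with hi
    · rw [hi]
    · rfl
  rw [← this, avg_mix]

lemma expect_apply [NeZero n] (j : Fin k) (g : Fin n → ℝ) : 𝔼 x : Fin k → Fin n, g (x j) = 𝔼 v, g v := by
  have : 𝔼 x : Fin k → Fin n, g (x j) =
      𝔼 p : Fin n × ({i // i ≠ j} → Fin n), g p.1 :=
    Fintype.expect_equiv (Equiv.funSplitAt j (Fin n)) _ _ fun x => rfl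
  rw [this, ← univ_product_univ, expect_product' univ univ fun a _ => g a]
  simp only [Fintype.expect_const]

lemma ind_heavy_singleton (j : Fin k) (x : Fin k → Fin n) :
    ind (heavy F θ {j}) x = ind (heavySymbols F θ j) (x j) := by
  by_cases hx : x j ∈ heavySymbols F θ j
  · rw [ind_of_mem hx, ind_of_mem (mem_heavy_singleton.2 hx)]
  · rw [ind_of_notMem hx, ind_of_notMem (mem_heavy_singleton.not.2 hx)]

lemma dens_heavy_singleton [NeZero n] (j : Fin k) :
    dens (heavy F θ {j}) = #(heavySymbols F θ j) / n := by
  simp only [dens, ind_heavy_singleton]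
  rw [expect_apply j (ind (heavySymbols F θ j)), Fintype.expect_eq_sum_div_card, sum_ind,
    Fintype.card_fin]

lemma mean_heavy_singleton [NeZero n] (j : Fin k) : mean (heavy F θ {j}) = #(heavySymbols F θ j) := by
  rw [mean, dens_heavy_singleton, mul_div_cancel₀ _ (NeZero.ne (n : ℝ))]

/-- Symbols heavy on different coordinates are few. -/
lemma Rigid.card_heavySymbols_mul_le [NeZero n] (h : Rigid F θ δ) {i j : Fin k} (hij : i ≠ j) :
    2 * θ * (#(heavySymbols F θ i) * #(heavySymbols F θ j)) ≤ δ * n ^ 2 := by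
  have hn : (0 : ℝ) < n := Nat.cast_pos.2 (NeZero.pos n)
  have h1 := h.dens_heavy_inter_le (disjoint_singleton.2 hij)
  have hi : IsOn ({i} : Finset (Fin k))ᶜ (ind (heavy F θ {j})) := (isOn_heavy F θ {j}).mono fun a => by
    simp only [mem_singleton, mem_compl]; rintro rfl; exact hij.symm
  have h2 : dens (heavy F θ {i} ∩ heavy F θ {j}) =
      dens (heavy F θ {i}) * dens (heavy F θ {j}) := by
    simp only [dens, ind_inter]
    exact (isOn_heavy F θ {i}).expect_mul hi
  rw [h2, dens_heavy_singleton, dens_heavy_singleton] at h1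
  have := mul_le_mul_of_nonneg_right h1 (sq_nonneg (n : ℝ))
  refine le_trans (le_of_eq ?_) this
  field_simp

/-- A family with concentrated intersection with random perfect matchings is approximately a
union of stars, with an integral total number of symbols. -/
lemma Rigid.sum_card_heavySymbols [NeZero n] (h : Rigid F θ δ) {c η q : ℝ}
    (hη : 𝔼 π, (cnt F π - c) ^ 2 ≤ η) (hq : 3 * δ * n ≤ θ ^ 2 * q) (hq' : q ≤ 1 / 100)
    (hs : 8 * η + 448 * q ≤ 1 / 10000) (m : ℕ) (hm : |mean F - m| ≤ 9 / 10) :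
    ∑ j, #(heavySymbols F θ j) = m := by
  have key : ∀ T : Finset (Fin k), |mean (heavy F θ T) - ∑ j ∈ T, (#(heavySymbols F θ j) : ℝ)|
      ≤ 1 / 100 := by
    intro T
    induction T using Finset.induction_on with
    | empty => simp [h.mean_heavy_empty]
    | insert j T hj ih =>
      obtain ⟨z, hz⟩ := h.exists_nat_mean_heavy hη hq (by linarith) (insert j T)
      have hz' : |mean (heavy F θ (insert j T)) - z| ≤ 1 / 100 :=
        abs_le_of_sq_le_sq (by linarith) (by norm_num)
      have h2 := h.abs_mean_heavy_union_le (disjoint_singleton_left.2 hj)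
      rw [← insert_eq, mean_heavy_singleton] at h2
      have h3 := le_of_mul_le_mul_left (h2.trans hq) (pow_pos h.pos 2)
      have e : z = ∑ i ∈ insert j T, #(heavySymbols F θ i) := by
        rw [sum_insert hj]
        have a1 := abs_le.1 hz'
        have a2 := abs_le.1 h3
        have a3 := abs_le.1 ih
        have b1 : (z : ℝ) < (#(heavySymbols F θ j) + ∑ i ∈ T, #(heavySymbols F θ i) : ℕ) + 1 := by
          push_cast; linarith [a1.1, a2.2, a3.2]
        have b2 : ((#(heavySymbols F θ j) + ∑ i ∈ T, #(heavySymbols F θ i) : ℕ) : ℝ) < z + 1 := by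
          push_cast; linarith [a1.2, a2.1, a3.1]
        have b1' : z < (#(heavySymbols F θ j) + ∑ i ∈ T, #(heavySymbols F θ i)) + 1 := by
          exact_mod_cast b1
        have b2' : (#(heavySymbols F θ j) + ∑ i ∈ T, #(heavySymbols F θ i)) < z + 1 := by
          exact_mod_cast b2
        omega
      rw [e] at hz'
      exact_mod_cast hz'
  have := abs_le.1 (key univ)
  rw [h.heavy_univ] at this
  have hm' := abs_le.1 hm
  have b1 : (m : ℝ) < (∑ j, #(heavySymbols F θ j) : ℕ) + 1 := by
    push_cast; linarith [this.2, hm'.1]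
  have b2 : ((∑ j, #(heavySymbols F θ j) : ℕ) : ℝ) < m + 1 := by
    push_cast; linarith [this.1, hm'.2]
  have b1' : m < ∑ j, #(heavySymbols F θ j) + 1 := by exact_mod_cast b1
  have b2' : ∑ j, #(heavySymbols F θ j) < m + 1 := by exact_mod_cast b2
  omega

end

lemma dens_biUnion_le {ι α : Type*} [Fintype ι] [Fintype α] [DecidableEq α] (A : ι → Finset α) :
    dens (univ.biUnion A) ≤ ∑ i, dens (A i) := by
  simp only [dens_eq, ← sum_div]
  exact div_le_div_of_nonneg_right (by exact_mod_cast card_biUnion_le) (Nat.cast_nonneg _)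

section star
variable {k n : ℕ}

/-- The points having some coordinate `j` in `S j`. -/
def star (S : Fin k → Finset (Fin n)) : Finset (Fin k → Fin n) :=
  univ.filter fun x => ∃ j, x j ∈ S j

lemma mem_star {S : Fin k → Finset (Fin n)} {x : Fin k → Fin n} :
    x ∈ star S ↔ ∃ j, x j ∈ S j := by simp [star]

lemma ind_star_le (S : Fin k → Finset (Fin n)) (x : Fin k → Fin n) :
    ind (star S) x ≤ ∑ j, ind (S j) (x j) := by
  by_cases hx : x ∈ star S
  · obtain ⟨j, hj⟩ := mem_star.1 hx
    rw [ind_of_mem hx, ← ind_of_mem hj]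
    exact single_le_sum (f := fun j => ind (S j) (x j)) (fun i _ => ind_nonneg _ _) (mem_univ j)
  · rw [ind_of_notMem hx]
    exact sum_nonneg fun _ _ => ind_nonneg _ _

lemma le_ind_star (S : Fin k → Finset (Fin n)) (x : Fin k → Fin n) :
    ∑ j, ind (S j) (x j) - ∑ i, ∑ j ∈ univ.erase i, ind (S i) (x i) * ind (S j) (x j) ≤
      ind (star S) x := by
  have e : ∑ i, ∑ j ∈ univ.erase i, ind (S i) (x i) * ind (S j) (x j) =
      (∑ j, ind (S j) (x j)) ^ 2 - ∑ j, ind (S j) (x j) := by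
    rw [sq, sum_mul_sum, ← sum_sub_distrib]
    refine sum_congr rfl fun i _ => ?_
    rw [← add_sum_erase _ _ (mem_univ i), ← sq, ind_sq]
    ring
  rw [e]
  by_cases hx : x ∈ star S
  · rw [ind_of_mem hx]
    nlinarith [sq_nonneg (∑ j, ind (S j) (x j) - 1)]
  · rw [ind_of_notMem hx, sum_eq_zero fun j _ => ind_of_notMem fun hj => hx (mem_star.2 ⟨j, hj⟩)]
    norm_num

lemma expect_ind_apply [NeZero n] (A : Finset (Fin n)) (j : Fin k) :
    𝔼 x : Fin k → Fin n, ind A (x j) = #A / n := by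
  rw [expect_apply j (ind A), Fintype.expect_eq_sum_div_card, sum_ind, Fintype.card_fin]

lemma expect_ind_apply_mul [NeZero n] {i j : Fin k} (hij : j ≠ i) (A B : Finset (Fin n)) :
    𝔼 x : Fin k → Fin n, ind A (x i) * ind B (x j) = #A / n * (#B / n) := by
  rw [← expect_ind_apply A i, ← expect_ind_apply B j]
  refine IsOn.expect_mul (T := {i}) (f := fun x => ind A (x i)) (g := fun x => ind B (x j))
    (fun x y => ?_) fun x y => ?_
  · simp [mix]
  · simp [mix, hij]

lemma mean_star_le [NeZero n] (S : Fin k → Finset (Fin n)) : mean (star S) ≤ ∑ j, #(S j) := by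
  have hn : (n : ℝ) ≠ 0 := NeZero.ne _
  have : dens (star S) ≤ 𝔼 x : Fin k → Fin n, ∑ j, ind (S j) (x j) :=
    expect_le_expect fun x _ => ind_star_le S x
  rw [expect_sum_comm] at this
  simp only [expect_ind_apply, ← sum_div] at this
  rw [mean]
  refine (mul_le_mul_of_nonneg_left this (Nat.cast_nonneg n)).trans (le_of_eq ?_)
  push_cast
  field_simp

lemma le_mean_star [NeZero n] (S : Fin k → Finset (Fin n)) {κ : ℝ} (hκ : 0 ≤ κ)
    (h : ∀ i j, i ≠ j → (#(S i) * #(S j) : ℝ) ≤ κ * n) :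
    (∑ j, #(S j) : ℕ) - κ * (∑ j, #(S j) : ℕ) ^ 2 ≤ mean (star S) := by
  have hn : (0 : ℝ) < n := Nat.cast_pos.2 (NeZero.pos n)
  have h1 := expect_le_expect (s := univ) fun x _ => le_ind_star S x
  rw [expect_sub_distrib, expect_sum_comm, expect_sum_comm] at h1
  simp only [expect_ind_apply, ← sum_div] at h1
  have h2 : ∑ i, 𝔼 x : Fin k → Fin n, ∑ j ∈ univ.erase i, ind (S i) (x i) * ind (S j) (x j) ≤
      κ / n * (∑ j, (#(S j) : ℝ)) ^ 2 := by
    rw [sq, sum_mul_sum, mul_sum]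
    refine sum_le_sum fun i _ => ?_
    rw [expect_sum_comm, mul_sum]
    refine le_trans (sum_le_sum fun j hj => ?_) (sum_le_sum_of_subset_of_nonneg (erase_subset i univ)
      fun j _ _ => by positivity)
    rw [expect_ind_apply_mul (ne_of_mem_erase hj)]
    have h3 := h i j (ne_of_mem_erase hj).symm
    rcases Nat.eq_zero_or_pos (#(S i) * #(S j)) with h0 | h0
    · have : (#(S i) * #(S j) : ℝ) = 0 := by exact_mod_cast h0
      rw [div_mul_div_comm, this]; simp
    · have : (1 : ℝ) ≤ #(S i) * #(S j) := by exact_mod_cast h0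
      rw [div_mul_div_comm, div_le_iff₀ (by positivity)]
      have : κ / n * (#(S i) * #(S j) : ℝ) * (n * n) = κ * n * (#(S i) * #(S j)) := by
        field_simp
      rw [this]
      nlinarith
  have h4 : (∑ j, (#(S j) : ℝ)) / n - κ / n * (∑ j, (#(S j) : ℝ)) ^ 2 ≤ dens (star S) := by
    rw [dens]; linarith
  have h5 := mul_le_mul_of_nonneg_left h4 hn.le
  rw [mean]
  push_cast
  refine le_trans (le_of_eq ?_) h5
  field_simp

/-- Few points of a union of stars share a coordinate with a given point outside it. -/
lemma mean_star_filter_le [NeZero n] (S : Fin k → Finset (Fin n)) {x : Fin k → Fin n} (hx : x ∉ star S) :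
    mean ((star S).filter fun z => ∃ i, z i = x i) ≤ (∑ j, #(S j) : ℕ) * k / n := by
  have hn : (n : ℝ) ≠ 0 := NeZero.ne _
  have h1 : dens ((star S).filter fun z => ∃ i, z i = x i) ≤
      𝔼 z : Fin k → Fin n, ∑ j, ∑ i ∈ univ.erase j, ind (S j) (z j) * ind {x i} (z i) := by
    refine expect_le_expect fun z _ => ?_
    have h0 : ∀ j i, 0 ≤ ind (S j) (z j) * ind {x i} (z i) := fun j i =>
      mul_nonneg (ind_nonneg _ _) (ind_nonneg _ _)
    by_cases hz : z ∈ (star S).filter fun z => ∃ i, z i = x i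
    · obtain ⟨hz1, i, hi⟩ := mem_filter.1 hz
      obtain ⟨j, hj⟩ := mem_star.1 hz1
      have hij : i ≠ j := by
        rintro rfl
        exact hx (mem_star.2 ⟨i, hi ▸ hj⟩)
      have e : ind ((star S).filter fun z => ∃ i, z i = x i) z =
          ind (S j) (z j) * ind {x i} (z i) := by
        rw [ind_of_mem hz, ind_of_mem hj, ind_of_mem (mem_singleton.2 hi), one_mul]
      rw [e]
      refine le_trans ?_ (single_le_sum (f := fun j => ∑ i ∈ univ.erase j,
        ind (S j) (z j) * ind {x i} (z i)) (fun j _ => sum_nonneg fun i _ => h0 j i) (mem_univ j))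
      exact single_le_sum (f := fun i => ind (S j) (z j) * ind {x i} (z i)) (fun i _ => h0 j i)
        (mem_erase.2 ⟨hij, mem_univ i⟩)
    · rw [ind_of_notMem hz]
      exact sum_nonneg fun j _ => sum_nonneg fun i _ => h0 j i
  have h2 : 𝔼 z : Fin k → Fin n, ∑ j, ∑ i ∈ univ.erase j, ind (S j) (z j) * ind {x i} (z i) ≤
      ∑ j, ∑ _i : Fin k, #(S j) / n * ((1 : ℝ) / n) := by
    rw [expect_sum_comm]
    refine sum_le_sum fun j _ => ?_
    rw [expect_sum_comm]
    refine le_trans (sum_le_sum fun i hi => ?_) (sum_le_sum_of_subset_of_nonneg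
      (erase_subset j univ) fun j _ _ => by positivity)
    rw [expect_ind_apply_mul (ne_of_mem_erase hi), card_singleton, Nat.cast_one]
  rw [mean]
  refine (mul_le_mul_of_nonneg_left (h1.trans h2) (Nat.cast_nonneg n)).trans (le_of_eq ?_)
  simp only [sum_const, card_univ, Fintype.card_fin, nsmul_eq_mul, ← mul_sum, ← sum_mul, ← sum_div]
  push_cast
  field_simp

lemma mean_star_sdiff_le (S : Fin k → Finset (Fin n)) (F : Finset (Fin k → Fin n)) {ε : ℝ}
    (hε : 0 ≤ ε) (h : ∀ j, mean ((univ.filter fun x => x j ∈ S j) \ F) ≤ ε) :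
    mean (star S \ F) ≤ ε * (∑ j, #(S j) : ℕ) := by
  have h0 : star S \ F ⊆ univ.biUnion fun j => (univ.filter fun x => x j ∈ S j) \ F := fun x hx => by
    obtain ⟨hx1, hx2⟩ := mem_sdiff.1 hx
    obtain ⟨j, hj⟩ := mem_star.1 hx1
    exact mem_biUnion.2 ⟨j, mem_univ j, mem_sdiff.2 ⟨mem_filter.2 ⟨mem_univ x, hj⟩, hx2⟩⟩
  have h1 := (dens_mono h0).trans (dens_biUnion_le _)
  rw [mean]
  refine (mul_le_mul_of_nonneg_left h1 (Nat.cast_nonneg n)).trans ?_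
  push_cast
  rw [mul_sum, mul_sum]
  refine sum_le_sum fun j _ => ?_
  rcases Nat.eq_zero_or_pos #(S j) with h0 | h0
  · simp [card_eq_zero.1 h0, dens_eq]
  · exact (h j).trans (le_mul_of_one_le_right hε (by exact_mod_cast h0))

end star

section mean
variable {k n : ℕ}

lemma mean_mono {A B : Finset (Fin k → Fin n)} (h : A ⊆ B) : mean A ≤ mean B :=
  mul_le_mul_of_nonneg_left (dens_mono h) (Nat.cast_nonneg _)

lemma mean_union_le (A B : Finset (Fin k → Fin n)) : mean (A ∪ B) ≤ mean A + mean B := by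
  rw [mean, mean, mean, ← mul_add]
  exact mul_le_mul_of_nonneg_left (dens_union_le A B) (Nat.cast_nonneg _)

lemma mean_le_add_sdiff (A B : Finset (Fin k → Fin n)) : mean A ≤ mean B + mean (A \ B) := by
  rw [mean, mean, mean, ← mul_add]
  exact mul_le_mul_of_nonneg_left (dens_le_add_sdiff A B) (Nat.cast_nonneg _)

lemma mean_add_sdiff (A B : Finset (Fin k → Fin n)) :
    mean A + mean (B \ A) = mean B + mean (A \ B) := by
  simp only [mean, dens_eq, ← mul_add, ← add_div]
  congr 2
  have h1 := card_union_of_disjoint (disjoint_sdiff (s := A) (t := B))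
  have h2 := card_union_of_disjoint (disjoint_sdiff (s := B) (t := A))
  rw [union_sdiff_self_eq_union] at h1 h2
  rw [union_comm, h1] at h2
  exact_mod_cast h2

end mean

section pull
variable {k n : ℕ} (x : Fin k → Fin (n + 1))

/-- The points of the smaller grid as the points sharing no coordinate with `x`. -/
def avoid (y : Fin k → Fin n) : Fin k → Fin (n + 1) := fun j => (x j).succAbove (y j)

lemma avoid_injective : Function.Injective (avoid x) := fun y z h => by
  funext j
  exact Fin.succAbove_right_injective (congrFun h j)

variable {x} in
lemma exists_avoid {z : Fin k → Fin (n + 1)} (h : ∀ j, z j ≠ x j) : ∃ y, avoid x y = z := by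
  choose y hy using fun j => Fin.exists_succAbove_eq (h j)
  exact ⟨y, funext hy⟩

/-- The members of a family sharing no coordinate with `x`. -/
def pull (A : Finset (Fin k → Fin (n + 1))) : Finset (Fin k → Fin n) :=
  univ.filter fun y => avoid x y ∈ A

variable {x} {A B : Finset (Fin k → Fin (n + 1))} {S : Fin k → Finset (Fin (n + 1))}

lemma mem_pull {y : Fin k → Fin n} : y ∈ pull x A ↔ avoid x y ∈ A := by simp [pull]

lemma pull_sdiff : pull x (A \ B) = pull x A \ pull x B := by
  ext y; simp [mem_pull]

lemma card_pull_le : #(pull x A) ≤ #A :=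
  card_le_card_of_injOn (avoid x) (fun _ hy => mem_pull.1 hy) (avoid_injective x).injOn

lemma card_le_card_pull : #A ≤ #(pull x A) + #(A.filter fun z => ∃ j, z j = x j) := by
  rw [← card_filter_add_card_filter_not fun z => ∃ j, z j = x j, add_comm]
  refine Nat.add_le_add_right ?_ _
  rw [← card_map ⟨avoid x, avoid_injective x⟩]
  refine card_le_card fun z hz => ?_
  obtain ⟨hz1, hz2⟩ := mem_filter.1 hz
  obtain ⟨y, hy⟩ := exists_avoid fun j hj => hz2 ⟨j, hj⟩
  exact mem_map.2 ⟨y, mem_pull.2 (hy ▸ hz1), hy⟩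

lemma pull_star : pull x (star S) = star fun j => univ.filter fun v => (x j).succAbove v ∈ S j := by
  ext y; simp [mem_pull, mem_star, avoid]

lemma card_filter_succAbove {a : Fin (n + 1)} {U : Finset (Fin (n + 1))} (ha : a ∉ U) :
    #(univ.filter fun v => a.succAbove v ∈ U) = #U := by
  rw [← card_map a.succAboveEmb]
  congr 1
  ext v
  simp only [mem_map, mem_filter, mem_univ, true_and, Fin.coe_succAboveEmb]
  constructor
  · rintro ⟨w, hw, rfl⟩; exact hw
  · intro hv
    obtain ⟨w, hw⟩ := Fin.exists_succAbove_eq fun h : v = a => ha (h ▸ hv)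
    exact ⟨w, hw ▸ hv, hw⟩

variable [NeZero n]

lemma one_add_inv_pow_le (hkn : 2 * k ≤ n) : ((n : ℝ) + 1) ^ (k - 1) ≤ 2 * n ^ (k - 1) := by
  have hn : (0 : ℝ) < n := Nat.cast_pos.2 (NeZero.pos n)
  have h1 : (1 : ℝ) + 1 / n ≤ Real.exp (1 / n) := by
    rw [add_comm]; exact Real.add_one_le_exp _
  have h2 : ((1 : ℝ) + 1 / n) ^ (k - 1) ≤ 2 := by
    refine (pow_le_pow_left₀ (by positivity) h1 _).trans ?_
    rw [← Real.exp_nat_mul]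
    have h3 : ((k - 1 : ℕ) : ℝ) * (1 / n) ≤ 1 / 2 := by
      rw [mul_one_div, div_le_div_iff₀ hn (by norm_num)]
      have : (k - 1) * 2 ≤ 1 * n := by omega
      exact_mod_cast this
    refine (Real.exp_le_exp.2 h3).trans ?_
    have h4 : Real.exp (1 / 2) ^ 2 = Real.exp 1 := by rw [← Real.exp_nat_mul]; norm_num
    nlinarith [Real.exp_one_lt_d9, Real.exp_pos (1 / 2)]
  calc ((n : ℝ) + 1) ^ (k - 1) = (1 + 1 / n) ^ (k - 1) * n ^ (k - 1) := by
        rw [← mul_pow]; congr 1; field_simp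
    _ ≤ _ := by gcongr

lemma mean_pull_le (hk : 1 ≤ k) (hkn : 2 * k ≤ n) : mean (pull x A) ≤ 2 * mean A := by
  have hn : (0 : ℝ) < n := Nat.cast_pos.2 (NeZero.pos n)
  have h1 := mean_mul_pow hk (pull x A)
  have h2 := mean_mul_pow hk A
  have h3 : (#(pull x A) : ℝ) ≤ #A := by exact_mod_cast card_pull_le
  have h4 := mul_le_mul_of_nonneg_left (one_add_inv_pow_le hkn) (mean_nonneg A)
  push_cast at h2
  refine le_of_mul_le_mul_right ?_ (pow_pos hn (k - 1))
  linarith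

lemma le_mean_pull (hk : 1 ≤ k) :
    mean A ≤ mean (pull x A) + mean (A.filter fun z => ∃ j, z j = x j) := by
  have h1 := mean_mul_pow hk (pull x A)
  have h2 := mean_mul_pow hk A
  have h3 := mean_mul_pow hk (A.filter fun z => ∃ j, z j = x j)
  have h4 : (#A : ℝ) ≤ #(pull x A) + #(A.filter fun z => ∃ j, z j = x j) := by
    exact_mod_cast card_le_card_pull
  have h5 : (n : ℝ) ^ (k - 1) ≤ ((n + 1 : ℕ) : ℝ) ^ (k - 1) := by
    gcongr; exact Nat.le_succ n
  have h6 := mul_le_mul_of_nonneg_left h5 (mean_nonneg (pull x A))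
  refine le_of_mul_le_mul_right ?_ (pow_pos (Nat.cast_pos.2 n.succ_pos : (0:ℝ) < (n + 1 : ℕ)) (k - 1))
  rw [add_mul]
  linarith

end pull

/-- A rainbow matching of the members of all but the last family avoiding a member of the last one
extends. -/
lemma rainbow_of_pull {k n r : ℕ} {F : Fin (r + 1) → Finset (Fin k → Fin (n + 1))}
    {x : Fin k → Fin (n + 1)} (hx : x ∈ F (Fin.last r))
    (h : Rainbow fun i : Fin r => pull x (F i.castSucc)) : Rainbow F := by
  obtain ⟨g, hg, hd⟩ := h
  refine ⟨Fin.snoc (fun i => avoid x (g i)) x, fun i => ?_, fun i i' hii j => ?_⟩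
  · refine Fin.lastCases ?_ (fun i => ?_) i
    · simpa using hx
    · simpa using mem_pull.1 (hg i)
  · induction i using Fin.lastCases with
    | last =>
      induction i' using Fin.lastCases with
      | last => exact absurd rfl hii
      | cast i' =>
        rw [Fin.snoc_last, Fin.snoc_castSucc]
        exact (Fin.succAbove_ne _ _).symm
    | cast i =>
      induction i' using Fin.lastCases with
      | last =>
        rw [Fin.snoc_last, Fin.snoc_castSucc]
        exact Fin.succAbove_ne _ _
      | cast i' =>
        rw [Fin.snoc_castSucc, Fin.snoc_castSucc]
        exact fun e => hd i i' (fun h => hii (h ▸ rfl)) j (Fin.succAbove_right_injective e)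

/-- If the last family is approximately a union of stars with a total of `r` symbols and the
families indexed by `I` nearly agree with it, then there is a rainbow matching. -/
lemma Params.rainbow_of_star {k n r : ℕ} {d : ℝ} [NeZero n] (h : Params (r + 1) d) (hk : 1 ≤ k)
    (hkn : (((r + 1 : ℕ) : ℝ)) * k ≤ d * ((n + 1 : ℕ) : ℝ))
    (F : Fin (r + 1) → Finset (Fin k → Fin (n + 1))) (I : Finset (Fin (r + 1)))
    (hI : 2 * d + 5 ≤ #I) {κ ε γ : ℝ} (hκ : 0 ≤ κ) (hε : 0 ≤ ε)
    (hκr : κ * r ^ 2 ≤ 1 / 100) (hεr : ε * r ≤ 1 / 100) (hγ : γ ≤ 1 / 100)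
    (S : Fin k → Finset (Fin (n + 1))) (hS : ∑ j, #(S j) = r)
    (hSS : ∀ i j, i ≠ j → (#(S i) * #(S j) : ℝ) ≤ κ * ((n + 1 : ℕ) : ℝ))
    (hSF : ∀ j, mean ((univ.filter fun x => x j ∈ S j) \ F (Fin.last r)) ≤ ε)
    (hl1 : r < mean (F (Fin.last r))) (hl2 : mean (F (Fin.last r)) ≤ r + 1 / 2)
    (hFl : ∀ i, mean (F i \ F (Fin.last r)) ≤ γ)
    (hlF : ∀ i ∈ I, mean (F (Fin.last r) \ F i) ≤ γ)
    (h0 : ∀ i ∉ I, ((i : ℕ) : ℝ) + 1 + 3 * d ≤ r)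
    (h1 : ∀ i ∉ I, ((i : ℕ) : ℝ) + 1 + 3 * d ≤ mean (F i)) : Rainbow F := by
  have hn : (1 : ℝ) ≤ n := Nat.one_le_cast.2 (NeZero.pos n)
  have hd := h.le_d
  have hkn2 : 2 * k ≤ n := by
    have hd1 := h.d_le
    have hs := h.s_pos
    have h2 : (((r + 1 : ℕ) : ℝ)) * k ≤ ((r + 1 : ℕ) : ℝ) * (((n + 1 : ℕ) : ℝ) / 10) := by
      refine hkn.trans ?_
      rw [mul_div_assoc', mul_div_right_comm]
      exact mul_le_mul_of_nonneg_right hd1 (Nat.cast_nonneg _)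
    have h3 := le_of_mul_le_mul_left h2 hs
    push_cast at h3
    have h4 : (2 * k : ℝ) ≤ n := by linarith
    exact_mod_cast h4
  set L := F (Fin.last r)
  have hstar1 := mean_star_le S
  have hstar2 := le_mean_star S hκ hSS
  have hstar3 := mean_star_sdiff_le S L hε hSF
  rw [hS] at hstar1 hstar2 hstar3
  have hLstar : mean (L \ star S) ≤ 1 := by
    have := mean_add_sdiff (star S) L
    linarith
  obtain ⟨x, hxL, hxS⟩ : ∃ x ∈ L, x ∉ star S := by
    by_contra hcon
    push Not at hcon
    have := mean_mono (show L ⊆ star S from hcon)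
    linarith
  refine rainbow_of_pull hxL ?_
  refine h.rainbow_of_slack rfl hk _ (univ.filter fun i : Fin r => i.castSucc ∈ I) ?_
    (fun i hi => ?_) (fun i hi => ?_) fun i hi => ?_
  · have hc : #I ≤ #(univ.filter fun i : Fin r => i.castSucc ∈ I) + 1 := by
      have hsub : I ⊆ insert (Fin.last r)
          ((univ.filter fun i : Fin r => i.castSucc ∈ I).map Fin.castSuccEmb) := fun i hi => by
        induction i using Fin.lastCases with
        | last => simp
        | cast i => simp [hi]
      refine (card_le_card hsub).trans ((card_insert_le _ _).trans ?_)
      rw [card_map]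
    have hc' : (#I : ℝ) ≤ #(univ.filter fun i : Fin r => i.castSucc ∈ I) + 1 := by
      exact_mod_cast hc
    linarith
  · have := h0 i.castSucc (by simpa using hi)
    rw [Fin.val_castSucc] at this
    linarith
  · have h2 := h1 i.castSucc (by simpa using hi)
    rw [Fin.val_castSucc] at h2
    have h3 := le_mean_pull (x := x) (A := F i.castSucc) hk
    have h4 : mean ((F i.castSucc).filter fun z => ∃ j, z j = x j) ≤ γ + 1 + d := by
      have h5 : ((F i.castSucc).filter fun z => ∃ j, z j = x j) ⊆
          ((F i.castSucc \ L) ∪ (L \ star S)) ∪ (star S).filter fun z => ∃ j, z j = x j := by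
        intro z hz
        obtain ⟨hz1, hz2⟩ := mem_filter.1 hz
        simp only [mem_union, mem_sdiff, mem_filter]
        tauto
      have h6 := mean_star_filter_le S hxS
      rw [hS] at h6
      have h7 : (r : ℝ) * k / ((n + 1 : ℕ) : ℝ) ≤ d := by
        rw [div_le_iff₀ (by positivity)]
        refine le_trans ?_ hkn
        gcongr
        exact Nat.le_succ r
      have h8 := (mean_mono h5).trans (mean_union_le _ _)
      have h9 := mean_union_le (F i.castSucc \ L) (L \ star S)
      linarith [hFl i.castSucc]
    linarith
  · have hi' : i.castSucc ∈ I := by simpa using hi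
    have h2 := mean_le_add_sdiff (pull x (star S)) (pull x (F i.castSucc))
    rw [← pull_sdiff] at h2
    have h3 : mean (star S \ F i.castSucc) ≤ 2 / 100 := by
      have h4 : star S \ F i.castSucc ⊆ (star S \ L) ∪ (L \ F i.castSucc) := by
        intro z hz
        simp only [mem_union, mem_sdiff] at hz ⊢
        tauto
      linarith [(mean_mono h4).trans (mean_union_le _ _), hlF _ hi']
    have h4 := mean_pull_le (x := x) (A := star S \ F i.castSucc) hk hkn2
    have hc : ∀ j, #(univ.filter fun v => (x j).succAbove v ∈ S j) = #(S j) := fun j =>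
      card_filter_succAbove fun hj => hxS (mem_star.2 ⟨j, hj⟩)
    have h5 := le_mean_star (fun j => univ.filter fun v => (x j).succAbove v ∈ S j)
      (κ := 2 * κ) (by linarith) fun a b hab => by
        rw [hc, hc]
        refine (hSS a b hab).trans ?_
        push_cast
        nlinarith
    rw [← pull_star] at h5
    simp only [hc, hS] at h5
    linarith

section
variable {k n s : ℕ} {d : ℝ}

lemma Params.exists_star [NeZero n] (h : Params s d) (hsn : s ≤ n) (F : Finset (Fin k → Fin n))
    (h1 : (s : ℝ) - 1 ≤ mean F) (h2 : mean F ≤ s - 1 / 2)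
    (hc : 𝔼 π, (cnt F π - (s - 1)) ^ 2 ≤ 13 / (s : ℝ) ^ 5) :
    ∃ S : Fin k → Finset (Fin n), ∑ j, #(S j) = s - 1 ∧
      (∀ i j, i ≠ j → (#(S i) * #(S j) : ℝ) ≤ 1 / (10 ^ 4 * s ^ 3) * n) ∧
      ∀ j, mean ((univ.filter fun x => x j ∈ S j) \ F) ≤ 1 / (10 ^ 4 * s ^ 3) := by
  have hs := h.s_pos
  have hs8 := h.le_s
  have hsn' : (s : ℝ) ≤ n := Nat.cast_le.2 hsn
  have hn : (0 : ℝ) < n := hs.trans_le hsn'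
  obtain ⟨u, hu⟩ : ∃ u : ℝ, u = 1 / s := ⟨_, rfl⟩
  have hsu : s * u = 1 := by rw [hu]; field_simp
  have hu0 : 0 < u := by rw [hu]; positivity
  have hu1 : u ≤ 1 / 10 ^ 8 := by
    rw [hu]; exact one_div_le_one_div_of_le (by norm_num) hs8
  have hu5 : 13 / (s : ℝ) ^ 5 = 13 * u ^ 5 := by rw [hu]; field_simp
  have hu3 : 1 / (10 ^ 4 * (s : ℝ) ^ 3) = u ^ 3 / 10 ^ 4 := by rw [hu]; field_simp
  rw [hu5] at hc
  rw [hu3]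
  have hu4 : u ^ 4 ≤ u ^ 3 / 10 ^ 8 := by
    rw [pow_succ u 3, ← mul_one_div]
    exact mul_le_mul_of_nonneg_left hu1 (by positivity)
  have hR : Rigid F (u / 8) (192 * (13 * u ^ 5) / n) := by
    refine ⟨by positivity, by linarith, ?_, expect_swapDiff_sq_le ?_ hc⟩
    · have : s * dens F ≤ s - 1 / 2 :=
        (mul_le_mul_of_nonneg_right hsn' (dens_nonneg F)).trans h2
      have h3 := mul_le_mul_of_nonneg_right this hu0.le
      have : dens F = s * dens F * u := by rw [mul_right_comm, hsu, one_mul]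
      rw [this]
      linarith
    · have : (3 : ℝ) ≤ n := by linarith
      exact_mod_cast this
  refine ⟨heavySymbols F (u / 8), ?_, fun i j hij => ?_, fun j => ?_⟩
  · have hp3 : u ^ 3 ≤ 1 / 10 ^ 24 := by
      refine (pow_le_pow_left₀ hu0.le hu1 3).trans ?_
      norm_num
    have hp5 : u ^ 5 ≤ u ^ 3 := pow_le_pow_of_le_one hu0.le (by linarith) (by norm_num)
    refine hR.sum_card_heavySymbols (q := 479232 * u ^ 3) hc (le_of_eq ?_) ?_ ?_ (s - 1) ?_
    · field_simp; ring
    · linarith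
    · linarith
    · have : 1 ≤ s := Nat.cast_pos.1 hs
      push_cast [this]
      rw [abs_le]; constructor <;> linarith
  · have h3 := hR.card_heavySymbols_mul_le hij
    have h4 : 192 * (13 * u ^ 5) / n * n ^ 2 = u / 4 * (9984 * u ^ 4 * n) := by field_simp; ring
    rw [h4] at h3
    have h5 : (#(heavySymbols F (u / 8) i) * #(heavySymbols F (u / 8) j) : ℝ) ≤
        9984 * u ^ 4 * n := by
      refine le_of_mul_le_mul_left ?_ (by positivity : 0 < u / 4)
      linarith
    refine h5.trans (mul_le_mul_of_nonneg_right ?_ hn.le)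
    linarith [pow_pos hu0 3]
  · have h3 := hR.dens_heavy_sdiff_le {j}
    have e : heavy F (u / 8) {j} = univ.filter fun x => x j ∈ heavySymbols F (u / 8) j := by
      ext x; simp [mem_heavy_singleton]
    rw [e] at h3
    have h4 := mul_le_mul_of_nonneg_right h3 hn.le
    rw [div_mul_cancel₀ _ hn.ne'] at h4
    have h5 : mean ((univ.filter fun x => x j ∈ heavySymbols F (u / 8) j) \ F) ≤ 6656 * u ^ 4 := by
      refine le_of_mul_le_mul_left ?_ (by positivity : 0 < 3 * (u / 8))
      rw [mean]
      have : 3 * (u / 8) * (6656 * u ^ 4) = 192 * (13 * u ^ 5) := by ring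
      linarith
    linarith [pow_pos hu0 3]

/-- The case of families of controlled sizes. -/
lemma Params.rainbow_of_card_eq {r : ℕ} [NeZero n] (h : Params (r + 1) d) (hk : 1 ≤ k)
    (hrn : r ≤ n) (hkn : (((r + 1 : ℕ) : ℝ)) * k ≤ d * ((n + 1 : ℕ) : ℝ))
    (F : Fin (r + 1) → Finset (Fin k → Fin (n + 1))) (I : Finset (Fin (r + 1)))
    (hI : 2 * d + 5 ≤ #I) (hlI : Fin.last r ∈ I)
    (hl1 : r < mean (F (Fin.last r))) (hl2 : mean (F (Fin.last r)) ≤ r + 1 / 2)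
    (hIF : ∀ i ∈ I, #(F i) = #(F (Fin.last r)))
    (h0 : ∀ i ∉ I, ((i : ℕ) : ℝ) + 1 + 3 * d ≤ r)
    (h1 : ∀ i ∉ I, ((i : ℕ) : ℝ) + 1 + 3 * d ≤ mean (F i))
    (h2 : ∀ i ∉ I, mean (F i) ≤ r + 1) : Rainbow F := by
  by_contra hF
  have hd := h.le_d
  have hs := h.s_pos
  have hs8 := h.le_s
  have hI' : ∀ i ∈ I, mean (F i) = mean (F (Fin.last r)) := fun i hi => by
    simp only [mean, dens_eq, hIF i hi]
  have hcast : ((r + 1 : ℕ) : ℝ) - 1 = r := by push_cast; ring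
  obtain ⟨hc, hd⟩ := h.concentration F hF I (by linarith) (fun i => by
      push_cast
      by_cases hi : i ∈ I
      · rw [hI' i hi]; linarith
      · exact h2 i hi)
    (fun i hi => by linarith [h1 i hi]) (fun i hi => by rw [hI' i hi, hcast]; exact hl1.le) hlI
  obtain ⟨S, hS, hSS, hSF⟩ := h.exists_star (by omega) (F (Fin.last r)) (by rw [hcast]; exact hl1.le)
    (by push_cast; linarith) hc
  have hs2 : (r : ℝ) ≤ ((r + 1 : ℕ) : ℝ) := by push_cast; linarith
  set s : ℝ := ((r + 1 : ℕ) : ℝ)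
  have hs1 : (1 : ℝ) ≤ s := by linarith
  refine hF (h.rainbow_of_star hk hkn F I hI (κ := 1 / (10 ^ 4 * s ^ 3)) (ε := 1 / (10 ^ 4 * s ^ 3))
    (γ := 36 / s ^ 6) (by positivity) (by positivity) ?_ ?_ ?_ S hS hSS hSF hl1 hl2 hd
    (fun i hi => ?_) h0 h1)
  · rw [one_div_mul_eq_div, div_le_div_iff₀ (by positivity) (by norm_num)]
    have : (r : ℝ) ^ 2 ≤ s ^ 2 := by gcongr
    have : s ^ 2 ≤ s ^ 3 := pow_le_pow_right₀ hs1 (by norm_num)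
    linarith [pow_pos hs 3]
  · rw [one_div_mul_eq_div, div_le_div_iff₀ (by positivity) (by norm_num)]
    have : s ≤ s ^ 3 := le_self_pow₀ hs1 (by norm_num)
    linarith [pow_pos hs 3]
  · rw [div_le_div_iff₀ (by positivity) (by norm_num)]
    have : s ≤ s ^ 6 := le_self_pow₀ hs1 (by norm_num)
    linarith
  · rw [← mean_sdiff_of_card_eq (hIF i hi)]
    exact hd i

end

section
variable {k n s : ℕ} {d : ℝ}

/-- The main case, with at least two coordinates and a large alphabet. -/
lemma Params.rainbow (h : Params s d) (hk : 2 ≤ k) (hsn : s ≤ n) (hkn : (s : ℝ) * k ≤ d * n)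
    (F : Fin s → Finset (Fin k → Fin n))
    (hF : ∀ i : Fin s, min ((s : ℝ) - 1) (((i : ℕ) : ℝ) + 1 + 3 * d) * (n : ℝ) ^ (k - 1) < #(F i)) :
    Rainbow F := by
  have hs8 := h.le_s
  have hd := h.le_d
  have hds := h.d_le
  obtain ⟨r, rfl⟩ : ∃ r, s = r + 1 := Nat.exists_eq_add_of_lt (Nat.cast_pos.1 h.s_pos) |>.imp
    fun r hr => by omega
  obtain ⟨n, rfl⟩ : ∃ m, n = m + 1 := ⟨n - 1, by omega⟩
  push_cast at hs8 hds
  have hr : (10 : ℝ) ≤ r := by linarith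
  have : NeZero n := ⟨by
    rintro rfl
    have : (r : ℝ) + 1 ≤ 1 := by exact_mod_cast hsn
    linarith⟩
  have hn2 : (2 : ℝ) ≤ ((n + 1 : ℕ) : ℝ) := by
    have := NeZero.pos n
    exact_mod_cast Nat.succ_le_succ this
  have hp : (2 : ℝ) ≤ ((n + 1 : ℕ) : ℝ) ^ (k - 1) :=
    hn2.trans (le_self_pow₀ (by linarith) (by omega))
  have hcast : ((r + 1 : ℕ) : ℝ) - 1 = r := by push_cast; ring
  rw [hcast] at hF
  set p : ℝ := ((n + 1 : ℕ) : ℝ) ^ (k - 1)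
  set f : Fin (r + 1) → ℝ := fun i => min (r : ℝ) (((i : ℕ) : ℝ) + 1 + 3 * d)
  have hf0 : ∀ i, 0 ≤ f i := fun i => le_min (by linarith) (by positivity)
  have hG : ∀ i, ∃ G ⊆ F i, #G = ⌊f i * p⌋₊ + 1 := fun i =>
    exists_subset_card_eq ((Nat.floor_lt (mul_nonneg (hf0 i) (by linarith : 0 ≤ p))).2 (hF i))
  choose G hGF hG using hG
  have hGl : ∀ i, f i < mean (G i) := fun i => by
    rw [lt_mean_iff (by omega), hG]
    exact (Nat.lt_floor_add_one (f i * p)).trans_eq (Nat.cast_succ _).symm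
  have hGu : ∀ i, mean (G i) ≤ f i + 1 / 2 := fun i => by
    rw [mean_le_iff (by omega), hG]
    rw [Nat.cast_add, Nat.cast_one]
    have := Nat.floor_le (mul_nonneg (hf0 i) (by linarith : 0 ≤ p))
    change _ ≤ (f i + 1 / 2) * p
    linarith
  set I : Finset (Fin (r + 1)) := univ.filter fun i => (r : ℝ) ≤ ((i : ℕ) : ℝ) + 1 + 3 * d
  have hIf : ∀ i ∈ I, f i = r := fun i hi => min_eq_left (mem_filter.1 hi).2
  have hIf' : ∀ i ∉ I, f i = ((i : ℕ) : ℝ) + 1 + 3 * d ∧ ((i : ℕ) : ℝ) + 1 + 3 * d ≤ r :=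
    fun i hi => by
      have : ((i : ℕ) : ℝ) + 1 + 3 * d < r := by simpa [I] using hi
      exact ⟨min_eq_right this.le, this.le⟩
  have hl : Fin.last r ∈ I := by
    simp only [I, mem_filter, mem_univ, true_and, Fin.val_last]
    linarith
  have hI : 2 * d + 5 ≤ #I := by
    have h1 := Nat.ceil_lt_add_one (show 0 ≤ (r : ℝ) - 1 - 3 * d by linarith)
    have h2 : ⌈(r : ℝ) - 1 - 3 * d⌉₊ < r + 1 := by
      have : (⌈(r : ℝ) - 1 - 3 * d⌉₊ : ℝ) < ((r + 1 : ℕ) : ℝ) := by push_cast; linarith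
      exact_mod_cast this
    have h3 : Ici (⟨⌈(r : ℝ) - 1 - 3 * d⌉₊, h2⟩ : Fin (r + 1)) ⊆ I := fun i hi => by
      have h4 : ⌈(r : ℝ) - 1 - 3 * d⌉₊ ≤ (i : ℕ) := Fin.le_def.1 (mem_Ici.1 hi)
      have h5 := Nat.ceil_le.1 h4
      simp only [I, mem_filter, mem_univ, true_and]
      linarith
    have h4 := card_le_card h3
    rw [Fin.card_Ici] at h4
    have h5 : ((r + 1 : ℕ) : ℝ) ≤ (#I : ℝ) + (⌈(r : ℝ) - 1 - 3 * d⌉₊ : ℝ) := by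
      have : r + 1 ≤ #I + ⌈(r : ℝ) - 1 - 3 * d⌉₊ := by
        simp only at h4; omega
      exact_mod_cast this
    push_cast at h5
    linarith
  refine Rainbow.mono (h.rainbow_of_card_eq (by omega) (by omega) hkn G I hI hl ?_ ?_
    (fun i hi => ?_) (fun i hi => (hIf' i hi).2) (fun i hi => ?_) fun i hi => ?_) hGF
  · exact (hIf _ hl).symm.trans_lt (hGl _)
  · rw [← hIf _ hl]; exact hGu _
  · rw [hG, hG, hIf i hi, hIf _ hl]
  · rw [← (hIf' i hi).1]; exact (hGl i).le
  · have h1 := hIf' i hi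
    linarith [hGu i, h1.1, h1.2]

/-- Families with one coordinate, greedily. -/
lemma rainbow_of_lt_card (F : Fin s → Finset (Fin 1 → Fin n)) (hF : ∀ i : Fin s, (i : ℕ) < #(F i)) :
    Rainbow F := by
  obtain ⟨g, hg, hgF⟩ := (all_card_le_biUnion_card_iff_exists_injective F).1 fun A => by
    rcases A.eq_empty_or_nonempty with rfl | hA
    · simp
    · obtain ⟨m, hm, hmax⟩ := A.exists_max_image id hA
      have h1 : A ⊆ Iic m := fun i hi => mem_Iic.2 (hmax i hi)
      calc #A ≤ #(Iic m) := card_le_card h1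
        _ = (m : ℕ) + 1 := Fin.card_Iic _
        _ ≤ #(F m) := hF m
        _ ≤ _ := card_le_card (subset_biUnion_of_mem F hm)
  refine ⟨g, hgF, fun i i' hii j hj => hii (hg (funext fun a => ?_))⟩
  rwa [Subsingleton.elim a j]

lemma exists_forall_params {C : ℝ} (hC : 20 ≤ C) :
    ∃ s0 : ℕ, ∀ s : ℕ, s0 < s → Params s (C * Real.sqrt (s * Real.log s) / 3) := by
  have h1 : ∀ᶠ x : ℝ in Filter.atTop, ‖Real.log x‖ ≤ 9 / (100 * C ^ 2) * ‖id x‖ :=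
    Real.isLittleO_log_id_atTop.bound (by positivity)
  obtain ⟨s0, hs0⟩ := Filter.eventually_atTop.1 (tendsto_natCast_atTop_atTop.eventually h1)
  refine ⟨max s0 (10 ^ 8), fun s hs => ?_⟩
  have hs8 : (10 ^ 8 : ℝ) ≤ s := by exact_mod_cast ((le_max_right _ _).trans_lt hs).le
  have hlog : 1 ≤ Real.log s := by
    rw [Real.le_log_iff_exp_le (by linarith)]
    linarith [Real.exp_one_lt_d9]
  have hls := hs0 s ((le_max_left _ _).trans_lt hs).le
  rw [Real.norm_of_nonneg (by linarith), id, Real.norm_of_nonneg (by positivity), div_mul_eq_mul_div,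
    le_div_iff₀ (by positivity)] at hls
  have hsl : (s : ℝ) ≤ s * Real.log s := le_mul_of_one_le_right (by linarith) hlog
  have hsq : Real.sqrt (s * Real.log s) ^ 2 = s * Real.log s := Real.sq_sqrt (by linarith)
  refine ⟨hs8, ?_, ?_, ?_⟩
  · have : 10 ≤ Real.sqrt (s * Real.log s) := Real.le_sqrt_of_sq_le (by linarith)
    nlinarith
  · refine abs_le_of_sq_le_sq' ?_ (by positivity) |>.2
    have h2 := mul_le_mul_of_nonneg_left hls (Nat.cast_nonneg (α := ℝ) s)
    rw [div_pow, mul_pow, hsq]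
    linarith
  · have h2 : (400 : ℝ) ≤ C ^ 2 := by nlinarith
    have h3 := mul_le_mul_of_nonneg_right h2 (by linarith : 0 ≤ s * Real.log s)
    rw [div_pow, mul_pow, hsq]
    linarith

lemma mul_le_of_lt_div {C : ℝ} (hs : 1 < s)
    (h : (k : ℝ) < C * n / (3 * Real.sqrt ((s : ℝ) / Real.log s))) :
    (s : ℝ) * k ≤ C * Real.sqrt (s * Real.log s) / 3 * n := by
  have hs' : (1 : ℝ) < s := by exact_mod_cast hs
  have hl : 0 < Real.log s := Real.log_pos hs'
  have h1 : 0 < Real.sqrt ((s : ℝ) / Real.log s) := Real.sqrt_pos.2 (by positivity)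
  have h2 : Real.sqrt (s * Real.log s) * Real.sqrt ((s : ℝ) / Real.log s) = s := by
    rw [← Real.sqrt_mul (by positivity), mul_assoc, mul_div_cancel₀ _ hl.ne',
      Real.sqrt_mul_self (by positivity)]
  rw [lt_div_iff₀ (by positivity)] at h
  have h3 := mul_le_mul_of_nonneg_left h.le (Real.sqrt_nonneg (s * Real.log s))
  have h4 : Real.sqrt (s * Real.log s) * (k * (3 * Real.sqrt ((s : ℝ) / Real.log s))) =
      3 * k * (Real.sqrt (s * Real.log s) * Real.sqrt ((s : ℝ) / Real.log s)) := by ring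
  rw [h4, h2] at h3
  linarith

end
end CrossMatching

theorem stmt1 (C : ℝ) (hC : 20 ≤ C) :
    ∃ s0 : ℕ, ∀ s : ℕ, s0 < s → ∀ n k : ℕ,
      (k : ℝ) < C * n / (3 * Real.sqrt ((s : ℝ) / Real.log s)) →
      ∀ F : Fin s → Finset (Fin k → Fin n),
        (∀ i : Fin s,
          min ((s : ℝ) - 1) (((i : ℕ) + 1 : ℝ) + C * Real.sqrt ((s : ℝ) * Real.log s)) *
            (n : ℝ) ^ ((k : ℤ) - 1) < ((F i).card : ℝ)) →
        ∃ g : Fin s → (Fin k → Fin n), (∀ i, g i ∈ F i) ∧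
          ∀ i i', i ≠ i' → ∀ j, g i j ≠ g i' j := by
  obtain ⟨s0, hs0⟩ := CrossMatching.exists_forall_params hC
  refine ⟨s0, fun s hs n k hkn F hF => ?_⟩
  have h := hs0 s hs
  have hs8 := h.le_s
  have hd := h.le_d
  have h3d : C * Real.sqrt ((s : ℝ) * Real.log s) =
      3 * (C * Real.sqrt ((s : ℝ) * Real.log s) / 3) := by ring
  have hs1 : 1 < s := by
    have : (1 : ℝ) < s := by linarith
    exact_mod_cast this
  have hn : 0 < n := by
    rcases Nat.eq_zero_or_pos n with rfl | hn
    · simp only [Nat.cast_zero, mul_zero, zero_div] at hkn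
      exact absurd hkn (not_lt.2 (Nat.cast_nonneg k))
    · exact hn
  have hn' : (0 : ℝ) < n := Nat.cast_pos.2 hn
  have hmin : ∀ i : Fin s, ((i : ℕ) : ℝ) ≤
      min ((s : ℝ) - 1) (((i : ℕ) + 1 : ℝ) + C * Real.sqrt ((s : ℝ) * Real.log s)) := fun i => by
    have : (((i : ℕ) + 1 : ℕ) : ℝ) ≤ s := Nat.cast_le.2 i.2
    push_cast at this
    exact le_min (by linarith) (by linarith)
  rcases Nat.eq_zero_or_pos k with rfl | hk
  · have hne : ∀ i, (F i).Nonempty := fun i => by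
      rw [← Finset.card_pos, ← Nat.cast_pos (α := ℝ)]
      exact lt_of_le_of_lt (mul_nonneg ((Nat.cast_nonneg _).trans (hmin i)) (by positivity)) (hF i)
    choose g hg using hne
    exact ⟨g, hg, fun _ _ _ j => j.elim0⟩
  have hz : (n : ℝ) ^ ((k : ℤ) - 1) = (n : ℝ) ^ (k - 1) := by
    rw [← zpow_natCast, Nat.cast_pred hk]
  rw [hz] at hF
  have hsn : s ≤ n := by
    by_contra hns
    have h1 := hF ⟨s - 1, by omega⟩
    have h2 : ((s - 1 : ℕ) : ℝ) = (s : ℝ) - 1 := by push_cast [hs1.le]; ring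
    have h3 := hmin ⟨s - 1, by omega⟩
    have h4 : (n : ℝ) ≤ ((s - 1 : ℕ) : ℝ) := by exact_mod_cast (by omega : n ≤ s - 1)
    have h5 := mul_le_mul_of_nonneg_right (h4.trans h3) (pow_nonneg hn'.le (k - 1))
    rw [← pow_succ', Nat.sub_add_cancel hk] at h5
    have h6 := Finset.card_le_univ (F ⟨s - 1, by omega⟩)
    rw [Fintype.card_fun, Fintype.card_fin, Fintype.card_fin] at h6
    have h7 : ((F ⟨s - 1, by omega⟩).card : ℝ) ≤ (n : ℝ) ^ k := by exact_mod_cast h6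
    linarith
  rcases Nat.lt_or_ge k 2 with hk2 | hk2
  · obtain rfl : k = 1 := by omega
    refine CrossMatching.rainbow_of_lt_card F fun i => ?_
    have h1 := hF i
    rw [pow_zero, mul_one] at h1
    exact_mod_cast (hmin i).trans_lt h1
  · refine h.rainbow hk2 hsn (CrossMatching.mul_le_of_lt_div hs1 hkn) F fun i => ?_
    rw [← h3d]
    exact hF i
end

section
/- Let p be a prime, s ≥ 1 an integer, and let f_1, …, f_s be nonnegative integers such that the coefficient of the monomial x_1^{f_1}·x_2^{f_2}⋯x_s^{f_s} in the polynomial ∏_{1 ≤ i < j ≤ s} (x_j − x_i)², computed over the field Z/pZ, is nonzero. Then the sequence p·f_1, …, p·f_s is satisfying for k = 2 and n = p: whenever families F_1, …, F_s ⊆ [p]² satisfy |F_i| > p·f_i for every i ∈ [s], the families contain a rainbow matching. -/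
open MvPolynomial in
/-- Perturbing homogeneous factors by terms of lower degree does not change the coefficients of a
product in top degree. -/
theorem MvPolynomial.coeff_prod_add_of_isHomogeneous {σ ι R : Type*} [CommRing R]
    (T : Finset ι) (A B : ι → MvPolynomial σ R) (a b : ι → ℕ)
    (hA : ∀ k ∈ T, (A k).IsHomogeneous (a k)) (hB : ∀ k ∈ T, (B k).IsHomogeneous (b k))
    (hab : ∀ k ∈ T, b k < a k) (m : σ →₀ ℕ) (hm : m.degree = ∑ k ∈ T, a k) :
    coeff m (∏ k ∈ T, (A k + B k)) = coeff m (∏ k ∈ T, A k) := by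
  classical
  rw [Finset.prod_add, coeff_sum, Finset.sum_eq_single T]
  · simp
  · intro t ht hne
    have hts : t ⊆ T := Finset.mem_powerset.mp ht
    have hhom : ((∏ k ∈ t, A k) * ∏ k ∈ T \ t, B k).IsHomogeneous
        (∑ k ∈ t, a k + ∑ k ∈ T \ t, b k) :=
      (IsHomogeneous.prod _ _ _ fun k hk => hA k (hts hk)).mul
        (IsHomogeneous.prod _ _ _ fun k hk => hB k (Finset.sdiff_subset hk))
    refine hhom.coeff_eq_zero ?_
    have hnon : (T \ t).Nonempty :=
      Finset.sdiff_nonempty.mpr fun h => hne (hts.antisymm h)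
    have hlt : ∑ k ∈ T \ t, b k < ∑ k ∈ T \ t, a k :=
      Finset.sum_lt_sum_of_nonempty hnon fun k hk => hab k (Finset.sdiff_subset hk)
    have hsum := Finset.sum_sdiff (f := a) hts
    omega
  · simp

/-- Among the `p` diagonals of `[p]²`, a set of more than `p * m` pairs meets one of them in more
than `m` points; these are recorded by their first coordinates. -/
theorem exists_diagonal_lt_card {p : ℕ} [NeZero p] (e : Fin p → ZMod p)
    (he : Function.Injective e) (F : Finset (Fin p × Fin p)) (m : ℕ) (hF : p * m < F.card) :
    ∃ (d : ZMod p) (S : Finset (ZMod p)), m < S.card ∧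
      ∀ x ∈ S, ∃ q ∈ F, e q.1 = x ∧ e q.2 = x + d := by
  classical
  obtain ⟨d, -, hd⟩ := Finset.exists_lt_card_fiber_of_mul_lt_card_of_maps_to
    (s := F) (t := (Finset.univ : Finset (ZMod p))) (f := fun q => e q.2 - e q.1) (n := m)
    (fun _ _ => Finset.mem_univ _) (by simpa [ZMod.card] using hF)
  refine ⟨d, ({q ∈ F | e q.2 - e q.1 = d}).image fun q => e q.1, ?_, ?_⟩
  · rwa [Finset.card_image_of_injOn]
    intro q hq r hr hqr
    simp only [Finset.coe_filter, Set.mem_ofPred_eq] at hq hr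
    have h2 : e q.2 = e r.2 := by
      rw [sub_eq_iff_eq_add.mp hq.2, sub_eq_iff_eq_add.mp hr.2]
      exact congrArg (d + ·) hqr
    exact Prod.ext (he hqr) (he h2)
  · intro x hx
    obtain ⟨q, hq, rfl⟩ := Finset.mem_image.mp hx
    rw [Finset.mem_filter] at hq
    exact ⟨q, hq.1, rfl, by rw [← hq.2]; ring⟩

/-- Theorem 1.4 (Combinatorial Nullstellensatz application): if the coefficient of
`x_1^{f_1}⋯x_s^{f_s}` in `∏_{i<j} (x_j - x_i)²` over `ℤ/pℤ` is nonzero, then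
`p·f_1, …, p·f_s` is a satisfying sequence for `k = 2`, `n = p`. -/
theorem stmt2 (p : ℕ) (hp : p.Prime) (s : ℕ) (hs : 1 ≤ s) (f : Fin s → ℕ)
    (hcoeff : MvPolynomial.coeff (Finsupp.equivFunOnFinite.symm f)
      (∏ ij ∈ Finset.univ.filter (fun ij : Fin s × Fin s => ij.1 < ij.2),
        (MvPolynomial.X ij.2 - MvPolynomial.X ij.1) ^ 2 : MvPolynomial (Fin s) (ZMod p)) ≠ 0)
    (F : Fin s → Finset (Fin p × Fin p))
    (hF : ∀ i : Fin s, p * f i < (F i).card) :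
    ∃ g : Fin s → Fin p × Fin p, (∀ i, g i ∈ F i) ∧
      ∀ i i', i ≠ i' → (g i).1 ≠ (g i').1 ∧ (g i).2 ≠ (g i').2 := by
  classical
  have : Fact p.Prime := ⟨hp⟩
  set e : Fin p → ZMod p := fun x => (x.val : ZMod p)
  have he : Function.Injective e := fun x y hxy => Fin.ext <| by
    simpa [e, ZMod.val_natCast_of_lt x.isLt, ZMod.val_natCast_of_lt y.isLt] using
      congrArg ZMod.val hxy
  choose d S hcard hS using fun i => exists_diagonal_lt_card e he (F i) (f i) (hF i)
  set m : Fin s →₀ ℕ := Finsupp.equivFunOnFinite.symm f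
  set T := Finset.univ.filter (fun ij : Fin s × Fin s => ij.1 < ij.2)
  let L : Fin s × Fin s → MvPolynomial (Fin s) (ZMod p) :=
    fun ij => MvPolynomial.X ij.2 - MvPolynomial.X ij.1
  let B : Fin s × Fin s → MvPolynomial (Fin s) (ZMod p) :=
    fun ij => MvPolynomial.C (d ij.2 - d ij.1) * L ij
  have hL : ∀ ij, (L ij).IsHomogeneous 1 := fun ij =>
    (MvPolynomial.isHomogeneous_X _ _).sub (MvPolynomial.isHomogeneous_X _ _)
  have hA : ∀ ij, (L ij ^ 2).IsHomogeneous 2 := fun ij => by simpa using (hL ij).pow 2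
  have hB : ∀ ij, (B ij).IsHomogeneous 1 := fun ij =>
    (MvPolynomial.isHomogeneous_C (Fin s) (d ij.2 - d ij.1)).mul (hL ij)
  have hm : m.degree = ∑ _ij ∈ T, 2 := by
    by_contra hne
    exact hcoeff ((MvPolynomial.IsHomogeneous.prod T _ _ fun ij _ => hA ij).coeff_eq_zero hne)
  have hP : MvPolynomial.coeff m (∏ ij ∈ T, (L ij ^ 2 + B ij)) ≠ 0 := by
    rw [MvPolynomial.coeff_prod_add_of_isHomogeneous T _ B (fun _ => 2) (fun _ => 1)
      (fun ij _ => hA ij) (fun ij _ => hB ij) (fun _ _ => one_lt_two) m hm]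
    exact hcoeff
  have hdeg : (∏ ij ∈ T, (L ij ^ 2 + B ij)).totalDegree = m.degree := by
    refine le_antisymm ?_ (MvPolynomial.le_totalDegree (MvPolynomial.mem_support_iff.mpr hP))
    rw [hm]
    refine (MvPolynomial.totalDegree_finsetProd _ _).trans (Finset.sum_le_sum fun ij _ => ?_)
    exact (MvPolynomial.totalDegree_add _ _).trans
      (max_le (hA ij).totalDegree_le ((hB ij).totalDegree_le.trans one_le_two))
  obtain ⟨x, hx, hne⟩ := MvPolynomial.combinatorial_nullstellensatz_exists_eval_nonzero
    _ m hP hdeg S hcard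
  choose g hg hg₁ hg₂ using fun i => hS i (x i) (hx i)
  rw [map_prod, Finset.prod_ne_zero_iff] at hne
  have hlt : ∀ i j, i < j → (g i).1 ≠ (g j).1 ∧ (g i).2 ≠ (g j).2 := by
    intro i j hij
    have h := hne (i, j) (by simp [T, hij])
    have hfac : MvPolynomial.eval x (L (i, j) ^ 2 + B (i, j)) =
        (e (g j).1 - e (g i).1) * (e (g j).2 - e (g i).2) := by
      simp only [L, B, hg₁, hg₂, map_add, map_mul, map_pow, map_sub, MvPolynomial.eval_X,
        MvPolynomial.eval_C]
      ring
    rw [hfac] at h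
    exact ⟨fun h1 => h (by simp [h1]), fun h2 => h (by simp [h2])⟩
  refine ⟨g, hg, fun i j hij => ?_⟩
  rcases lt_or_gt_of_ne hij with h | h
  · exact hlt i j h
  · exact ⟨(hlt j i h).1.symm, (hlt j i h).2.symm⟩
end
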